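/- (a) The RTT integral form 𝓤_v^>(Lo_{2n}) does not depend on the sign ε∈{+,−} nor on the choices of decompositions used in defining the elements Ẽ^ε_{β,s}. (b) For any fixed ε∈{+,−} and fixed choices of decompositions, the ordered monomials 𝓔̃^ε_h := ∏_{(β,s)} (𝓔̃^ε_{β,s})^{h(β,s)} (product taken from left to right in increasing order of (β,s)), for h∈H, form a basis of 𝓤_v^>(Lo_{2n}) as a ℤ[v,v^{−1}]-module. -/

import Mathlib

noncomputable section
open scoped BigOperators DirectSum

/-! ### Base field ℚ(v) and quantum numbers -/

/-- the base field `ℚ(v)`. -/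
abbrev KK : Type := RatFunc ℚ
/-- the variable `v ∈ ℚ(v)`. -/
def vv : KK := RatFunc.X
/-- integer powers of `v`. -/
def vpow (m : ℤ) : KK := vv ^ m
/-- the quantum integer `[m]_u = (uᵐ - u⁻ᵐ)/(u - u⁻¹)`. -/
def qInt (u : KK) (m : ℕ) : KK := (u ^ (m : ℤ) - u ^ (-(m : ℤ))) / (u - u⁻¹)
/-- the quantum factorial `[m]_u!`. -/
def qFact (u : KK) (m : ℕ) : KK := ∏ k ∈ Finset.range m, qInt u (k + 1)
/-- the quantum binomial coefficient. -/
def qBinom (u : KK) (m k : ℕ) : KK := qFact u m / (qFact u k * qFact u (m - k))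
/-- `⟨m⟩_v = vᵐ - v⁻ᵐ`. -/
def qBrack (m : ℕ) : KK := vpow (m : ℤ) - vpow (-(m : ℤ))
/-- the sign `ε ∈ {+,-}` as `±1`. -/
def sgn (ε : Bool) : ℤ := if ε then 1 else -1
/-- `l` is an integer power of `v`. -/
def IsVpow (l : KK) : Prop := ∃ m : ℤ, l = vpow m

/-! ### Cartan data of types `C_n` and `D_n` (1-based indices) -/

/-- the Cartan matrix of type `C_n` (1-based indices). -/
def aC (n i j : ℕ) : ℤ :=
  if i = j then 2 else if i + 1 = n ∧ j = n then -2
  else if i + 1 = j ∨ j + 1 = i then -1 else 0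
/-- the symmetrizing integers `d_i` of type `C_n`. -/
def dC (n i : ℕ) : ℕ := if i = n then 2 else 1
/-- the Cartan matrix of type `D_n` (1-based indices). -/
def aD (n i j : ℕ) : ℤ :=
  if i = j then 2
  else if (i + 1 = j ∧ j + 1 ≤ n) ∨ (j + 1 = i ∧ i + 1 ≤ n) then -1
  else if (i + 2 = n ∧ j = n) ∨ (j + 2 = n ∧ i = n) then -1 else 0
/-- the symmetrizing integers `d_i` of type `D_n` (all equal to `1`). -/
def dD (n i : ℕ) : ℕ := 1

/-! ### The positive subalgebra of the quantum loop algebra, for Cartan data `(A, Dd)` -/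

section Ualg
variable (n : ℕ) (A : ℕ → ℕ → ℤ) (Dd : ℕ → ℕ)

/-- the free `ℚ(v)`-algebra on generators `e_{i,r}`, `i ∈ I`, `r ∈ ℤ`. -/
abbrev FA := FreeAlgebra KK (Fin n × ℤ)
/-- the free generator `e_{i,r}`. -/
def fg (i : Fin n) (r : ℤ) : FA n := FreeAlgebra.ι KK (i, r)

/-- the `z^{-r₁}⋯z^{-r_m}w^{-t}`-coefficient of the Serre relation between colors `i ≠ j`. -/
def serreElt (i j : Fin n) (m : ℕ) (r : Fin m → ℤ) (t : ℤ) : FA n :=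
  ∑ σ : Equiv.Perm (Fin m), ∑ k ∈ Finset.range (m + 1),
    ((-1 : KK) ^ k * qBinom (vpow (Dd (i.1 + 1))) m k) •
      (((List.ofFn fun l => fg n i (r (σ l))).take k
        ++ fg n j t :: (List.ofFn fun l => fg n i (r (σ l))).drop k).prod)

/-- the defining relations of `U_v^>(Lg)` in the new Drinfeld realization: the coefficients of
`(z - v_i^{a_ij} w) e_i(z) e_j(w) = (v_i^{a_ij} z - w) e_j(w) e_i(z)` and of the Serre relations. -/
inductive URel : FA n → FA n → Prop
  | loop (i j : Fin n) (r s : ℤ) :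
      URel (fg n i (r + 1) * fg n j s
             - vpow ((Dd (i.1 + 1) : ℤ) * A (i.1 + 1) (j.1 + 1)) • (fg n i r * fg n j (s + 1)))
           (vpow ((Dd (i.1 + 1) : ℤ) * A (i.1 + 1) (j.1 + 1)) • (fg n j s * fg n i (r + 1))
             - fg n j (s + 1) * fg n i r)
  | serre (i j : Fin n) (hij : i ≠ j) (r : Fin (1 - A (i.1 + 1) (j.1 + 1)).toNat → ℤ) (t : ℤ) :
      URel (serreElt n Dd i j _ r t) 0

/-- the positive subalgebra `U_v^>(Lg)` of the quantum loop algebra. -/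
abbrev UA := RingQuot (URel n A Dd)
/-- the generator `e_{i,r}` of `U_v^>(Lg)`. -/
def ug (i : Fin n) (r : ℤ) : UA n A Dd := RingQuot.mkAlgHom KK (URel n A Dd) (fg n i r)
/-- the generator `e_{i,r}` with a 1-based index `1 ≤ i ≤ n` (and junk value `0` otherwise). -/
def g1 (i : ℕ) (r : ℤ) : UA n A Dd := if h : 1 ≤ i ∧ i ≤ n then ug n A Dd ⟨i - 1, by omega⟩ r else 0

end Ualg

/-! ### `q`-brackets, ordered monomials, and ℤ[v,v⁻¹]-forms -/

section Aux
variable {B : Type} [Ring B] [Module KK B]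

/-- the `u`-commutator `[x,y]_u = xy - u · yx`. -/
def qcm (u : KK) (x y : B) : B := x * y - u • (y * x)

/-- the iterated `q`-bracket `[⋯[[g i₁ s₁, g i₂ s₂]_{λ₁}, g i₃ s₃]_{λ₂}, ⋯]_{λ_{ℓ-1}}`. -/
def chainE (g : ℕ → ℤ → B) (w : List ℕ) (ss : List ℤ) (ls : List KK) : B :=
  match w, ss with
  | i :: w', s :: ss' =>
      ((w'.zip ss').zip ls).foldl
        (fun acc p => acc * g p.1.1 p.1.2 - p.2 • (g p.1.1 p.1.2 * acc)) (g i s)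
  | _, _ => 0
end Aux

section Mon
variable {B : Type} [Ring B] {ι : Type} [LinearOrder ι]
/-- the ordered monomial `∏→ (E p)^(h p)`, the product taken in increasing order of `p`. -/
def ordMon (E : ι → B) (h : ι →₀ ℕ) : B := ((h.support.sort (· ≤ ·)).map (fun p => E p ^ h p)).prod
end Mon

/-- the subring `ℤ[v,v⁻¹] ⊆ ℚ(v)`. -/
def Rint : Subring KK := Subring.closure {vv, vv⁻¹}

section Forms
variable {B : Type} [Ring B] [Algebra KK B]
/-- the `ℤ[v,v⁻¹]`-subalgebra of a `ℚ(v)`-algebra generated by a set `X`, realized as the subring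
generated by `X` together with the central scalars `v^{±1}`. -/
def zvForm (X : Set B) : Subring B :=
  Subring.closure ({algebraMap KK B vv, algebraMap KK B vv⁻¹} ∪ X)
end Forms

/-! ### Positive roots of type `D_n` with the fixed convex (lexicographic) order -/

section RootsD
variable (n : ℕ)

/-- Positive roots of type `D_n`, encoded as lexicographically ordered pairs `(i,t)`:
`[i,i+t]` for `i+t<n` or `i=n`; `[i,n]` for `i+t=n`; `[i,n,n-1]` for `i+t=n+1`;
`[i,n,j]` with `j = 2n-i-t` for `i+t ≥ n+2`.  The induced linear order is exactly the
convex order coming from standard Lyndon words. -/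
def IsPosRootD (p : Fin (n + 1) ×ₗ Fin (2 * n + 1)) : Prop :=
  1 ≤ ((ofLex p).1 : ℕ) ∧ (n - 1 ≤ ((ofLex p).1 : ℕ) → ((ofLex p).2 : ℕ) = 0) ∧
    (((ofLex p).2 : ℕ) = 0 ∨ ((ofLex p).2 : ℕ) + 2 * ((ofLex p).1 : ℕ) + 1 ≤ 2 * n)

instance : DecidablePred (IsPosRootD n) := fun p => by unfold IsPosRootD; infer_instance

/-- the set `Δ⁺` of positive roots of type `D_n`, with its convex linear order. -/
abbrev PosRootD := {p : Fin (n + 1) ×ₗ Fin (2 * n + 1) // IsPosRootD n p}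

variable {n}
/-- the first index `i` of a positive root. -/
def riD (β : PosRootD n) : ℕ := ((ofLex β.1).1 : ℕ)
/-- the offset `t` of a positive root within its block. -/
def rtD (β : PosRootD n) : ℕ := ((ofLex β.1).2 : ℕ)

/-- multiplicity of `α_c` (1-based color `c`) in the positive root `β` (type `D_n`). -/
def nuD (β : PosRootD n) (c : ℕ) : ℕ :=
  let i := riD β; let t := rtD β
  if i + t < n ∨ i = n then (if i ≤ c ∧ c ≤ i + t then 1 else 0)
  else if i + t = n then (if (i ≤ c ∧ c ≤ n - 2) ∨ c = n then 1 else 0)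
  else if i + t = n + 1 then (if i ≤ c ∧ c ≤ n then 1 else 0)
  else (if i ≤ c ∧ c < 2 * n - i - t then 1
        else if 2 * n - i - t ≤ c ∧ c ≤ n - 2 then 2
        else if c = n - 1 ∨ c = n then 1 else 0)

/-- standard Lyndon word (list of 1-based simple-root indices) of `β` (type `D_n`). -/
def wordD (β : PosRootD n) : List ℕ :=
  let i := riD β; let t := rtD β
  if i + t < n ∨ i = n then List.range' i (t + 1)
  else if i + t = n then List.range' i (n - 1 - i) ++ [n]
  else if i + t = n + 1 then List.range' i (n - 1 - i) ++ [n, n - 1]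
  else List.range' i (n - 1 - i) ++ [n] ++ (List.range' (2 * n - i - t) (n - (2 * n - i - t))).reverse

/-- the height `|β|` of a positive root (type `D_n`). -/
def heightD (β : PosRootD n) : ℕ := (wordD β).length

/-- `β` is a root of the form `[i,n,j]` with `i < j ≤ n-2`. -/
def isSpecD (β : PosRootD n) : Prop := n + 2 ≤ riD β + rtD β
instance (β : PosRootD n) : Decidable (isSpecD β) := by unfold isSpecD; infer_instance
end RootsD

/-! ### General quantum root vectors of type `D_n` -/

section RVD
variable (n : ℕ)

/-- the positive subalgebra `U_v^>(Lo_{2n})`. -/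
abbrev UD := UA n (aD n) (dD n)
/-- generators of `U_v^>(Lo_{2n})` with 1-based indices. -/
def genD : ℕ → ℤ → UD n := g1 n (aD n) (dD n)

variable {n}
/-- `E` is a quantum root vector `E_{β,s}` of type `D_n` for some choice of the parameters
`λ_k ∈ v^ℤ` and of a decomposition of `s`: an iterated `q`-bracket along the standard Lyndon
word of `β`. -/
def IsRVD (β : PosRootD n) (s : ℤ) (E : UD n) : Prop :=
  ∃ (ss : List ℤ) (ls : List KK),
    ss.length = (wordD β).length ∧ ls.length + 1 = (wordD β).length ∧ ss.sum = s ∧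
    (∀ l ∈ ls, IsVpow l) ∧ E = chainE (genD n) (wordD β) ss ls
end RVD

/-! ### The specific quantum root vectors `Ẽ^ε_{β,s}` of type `D_n` -/

section TildeD
variable {n : ℕ}

/-- the specific quantum root vector `Ẽ^ε_{β,s}` of type `D_n`, determined by the sign `ε`
and the decomposition data `t` (assigning `s_ℓ` to each 1-based index `ℓ`); all `q`-bracket
parameters equal `v^{±1}`. -/
def tildeED (ε : Bool) (β : PosRootD n) (t : ℕ → ℤ) : UD n :=
  chainE (genD (n := n)) (wordD β) ((wordD β).map t)
    (List.replicate ((wordD β).length - 1) (vpow (sgn ε)))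

/-- the value `s` represented by the decomposition data `t` for the root `β` (type `D_n`). -/
def sOfD (β : PosRootD n) (t : ℕ → ℤ) : ℤ := ((wordD β).map t).sum

/-- the normalized divided power `Ẽ^{ε,(k)}_{β,s} = (Ẽ^ε_{β,s})^k/[k]_v!` of type `D_n`. -/
def tildeEPowD (ε : Bool) (β : PosRootD n) (t : ℕ → ℤ) (k : ℕ) : UD n :=
  (qFact vv k)⁻¹ • (tildeED ε β t) ^ k

/-- the normalized quantum root vector `𝓔̃^ε_{β,s} = ⟨1⟩_v · Ẽ^ε_{β,s}` of type `D_n`. -/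
def rttED (ε : Bool) (β : PosRootD n) (t : ℕ → ℤ) : UD n := qBrack 1 • tildeED ε β t

/-- the Lusztig integral form `𝐔_v^>(Lo_{2n})`: the `ℤ[v,v⁻¹]`-subalgebra generated by the
divided powers `e_{i,r}^k/[k]_v!`. -/
def LusFormD (n : ℕ) : Subring (UD n) :=
  zvForm {x | ∃ (i : Fin n) (r : ℤ) (k : ℕ),
    x = (qFact vv k)⁻¹ • (ug n (aD n) (dD n) i r) ^ k}

/-- the RTT integral form `𝓤_v^>(Lo_{2n})` attached to a sign `ε` and a choice `T` of
decompositions. -/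
def RttFormD (ε : Bool) (T : PosRootD n × ℤ → (ℕ → ℤ)) : Subring (UD n) :=
  zvForm {x | ∃ p : PosRootD n × ℤ, x = rttED ε p.1 (T p)}

end TildeD

section
set_option autoImplicit false
set_option linter.unusedSectionVars false

lemma vv_ne_zero : (vv : KK) ≠ 0 := RatFunc.X_ne_zero

/-- evaluation of a nonzero polynomial at the transcendental `v` does not vanish. -/
lemma vv_aeval_ne_zero (p : Polynomial ℚ) (hp : p ≠ 0) : Polynomial.aeval vv p ≠ 0 := by
  have h : Polynomial.aeval vv p = algebraMap (Polynomial ℚ) KK p := by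
    have : (Polynomial.aeval (RatFunc.X : RatFunc ℚ) : Polynomial ℚ →ₐ[ℚ] RatFunc ℚ) =
        IsScalarTower.toAlgHom ℚ (Polynomial ℚ) (RatFunc ℚ) := by
      ext; simp
    exact congrArg (fun f => f p) this
  rw [h]
  exact RatFunc.algebraMap_ne_zero hp

open Polynomial in
lemma vv_sq_add_one_ne_zero : (vv : KK) ^ 2 + 1 ≠ 0 := by
  have := vv_aeval_ne_zero (X ^ 2 + 1) (by
    intro h; have := congrArg (eval 0) h; simp at this)
  simpa using this

open Polynomial in
lemma vv_sq_sub_one_ne_zero : (vv : KK) ^ 2 - 1 ≠ 0 := by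
  have := vv_aeval_ne_zero (X ^ 2 - 1) (by
    intro h; have := congrArg (eval 0) h; simp at this)
  simpa using this

/-- Data of a weight-graded algebra satisfying the relations of `U_v^>(Lo_{2n})`, with 1-based
generators; `τ μ` multiplies `e j r` by `v ^ μ j`. -/
structure LoopAlg {F : Type} [Field F] (v : F) (n : ℕ) (B : Type) [Ring B] [Algebra F B] where
  v_ne : v ≠ 0
  v_add : v ^ 2 + 1 ≠ 0
  v_sub : v ^ 2 - 1 ≠ 0
  e : ℕ → ℤ → B
  τ : (ℕ → ℤ) → B →ₐ[F] B
  τ_e : ∀ μ j r, τ μ (e j r) = v ^ μ j • e j r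
  τ_add : ∀ μ ν x, τ (μ + ν) x = τ μ (τ ν x)
  τ_zero : ∀ x, τ 0 x = x
  loop : ∀ i j r s, 1 ≤ i → i ≤ n → 1 ≤ j → j ≤ n →
    e i (r + 1) * e j s - v ^ aD n i j • (e i r * e j (s + 1)) =
      v ^ aD n i j • (e j s * e i (r + 1)) - e j (s + 1) * e i r
  comm : ∀ i j r s, 1 ≤ i → i ≤ n → 1 ≤ j → j ≤ n → aD n i j = 0 →
    e i r * e j s = e j s * e i r
  serre : ∀ i j r s t, 1 ≤ i → i ≤ n → 1 ≤ j → j ≤ n → aD n i j = -1 →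
    (e i r * e i s * e j t - (v + v⁻¹) • (e i r * e j t * e i s) + e j t * e i r * e i s) +
    (e i s * e i r * e j t - (v + v⁻¹) • (e i s * e j t * e i r) + e j t * e i s * e i r) = 0

lemma aD_symm (n i j : ℕ) : aD n i j = aD n j i := by
  unfold aD; split_ifs <;> omega

lemma aD_self (n i : ℕ) : aD n i i = 2 := by simp [aD]

namespace LoopAlg
variable {F : Type} [Field F] [CharZero F] {v : F}
variable {n : ℕ} {B : Type} [Ring B] [Algebra F B] (L : LoopAlg v n B)

/-- the twist attached to a color. -/
def M (n j c : ℕ) : ℤ := -aD n c j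

/-- twisted commutator with `g`. -/
def DD (g : B) (μ : ℕ → ℤ) : B →ₗ[F] B :=
  LinearMap.mulRight F g - LinearMap.mulLeft F g ∘ₗ (L.τ μ).toLinearMap

lemma DD_apply (g : B) (μ : ℕ → ℤ) (x : B) : L.DD g μ x = x * g - g * L.τ μ x := by
  simp [DD]

lemma DD_mul (g : B) (μ : ℕ → ℤ) (x y : B) :
    L.DD g μ (x * y) = x * L.DD g μ y + L.DD g μ x * L.τ μ y := by
  simp only [DD_apply, map_mul]; noncomm_ring

/-- the twisted derivation attached to the generator `e j r`. -/
def D (j : ℕ) (r : ℤ) : B →ₗ[F] B := L.DD (L.e j r) (M n j)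

lemma D_apply (j : ℕ) (r : ℤ) (x : B) :
    L.D j r x = x * L.e j r - L.e j r * L.τ (M n j) x := L.DD_apply _ _ _

lemma D_mul (j : ℕ) (r : ℤ) (x y : B) :
    L.D j r (x * y) = x * L.D j r y + L.D j r x * L.τ (M n j) y := L.DD_mul _ _ _ _

lemma τ_comm (μ ν : ℕ → ℤ) (x : B) : L.τ μ (L.τ ν x) = L.τ ν (L.τ μ x) := by
  rw [← L.τ_add, ← L.τ_add, add_comm]

lemma τ_e' (i j : ℕ) (r : ℤ) : L.τ (M n i) (L.e j r) = (v ^ aD n i j)⁻¹ • L.e j r := by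
  rw [L.τ_e, M, zpow_neg, aD_symm]

lemma τ_D (μ : ℕ → ℤ) (j : ℕ) (r : ℤ) (x : B) :
    L.τ μ (L.D j r x) = v ^ μ j • L.D j r (L.τ μ x) := by
  simp only [D_apply, map_sub, map_mul, L.τ_e, L.τ_comm μ, mul_smul_comm, smul_mul_assoc,
    smul_sub]

lemma D_D (l j : ℕ) (t r : ℤ) (x : B) :
    L.D l t (L.D j r x) = x * L.e j r * L.e l t - L.e j r * L.τ (M n j) x * L.e l t
      - (v ^ aD n j l)⁻¹ • (L.e l t * L.τ (M n l) x * L.e j r)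
      + (v ^ aD n j l)⁻¹ • (L.e l t * L.e j r * L.τ (M n j) (L.τ (M n l) x)) := by
  rw [L.D_apply l, L.D_apply j, map_sub, map_mul, map_mul, L.τ_e', L.τ_comm (M n l) (M n j),
    aD_symm n l j]
  simp only [sub_mul, mul_sub, mul_smul_comm, smul_mul_assoc, mul_assoc]
  module

/-- exchange relation between the twisted derivations. -/
lemma D_exchange (l j : ℕ) (t r : ℤ) (x : B) (hl : 1 ≤ l) (hl' : l ≤ n) (hj : 1 ≤ j)
    (hj' : j ≤ n) :
    L.D l t (L.D j (r + 1) x) - (v ^ aD n j l)⁻¹ • L.D l (t + 1) (L.D j r x)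
      - (v ^ aD n j l)⁻¹ • L.D j (r + 1) (L.D l t x) + L.D j r (L.D l (t + 1) x)
    = (v ^ aD n j l - (v ^ aD n j l)⁻¹) •
      (L.D l (t + 1) (x * L.e j r) + L.D j (r + 1) (x * L.e l t)) := by
  have hw := zpow_ne_zero (aD n j l) L.v_ne
  have h := L.loop j l r t hj hj' hl hl'
  have h1 := congrArg (x * ·) h
  have h2 := congrArg (· * L.τ (M n j) (L.τ (M n l) x)) h
  simp only [D_D, aD_symm n l j, L.τ_comm (M n l) (M n j)]
  simp only [D_apply, map_mul, L.τ_e', aD_symm n l j]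
  generalize v ^ aD n j l = w at *
  simp only [sub_mul, mul_sub, mul_smul_comm, smul_mul_assoc, mul_assoc] at h1 h2 ⊢
  linear_combination (norm := skip) h1 - (w⁻¹ * w⁻¹) • h2
  match_scalars <;> field_simp <;> ring

lemma D_comm (l j : ℕ) (t r : ℤ) (x : B) (hl : 1 ≤ l) (hl' : l ≤ n) (hj : 1 ≤ j)
    (hj' : j ≤ n) (h0 : aD n j l = 0) :
    L.D l t (L.D j r x) = L.D j r (L.D l t x) := by
  rw [D_D, D_D, aD_symm n l j, h0, L.τ_comm (M n l) (M n j)]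
  have h := L.comm j l r t hj hj' hl hl' h0
  simp only [zpow_zero, inv_one, one_smul, mul_assoc x, h]
  abel

lemma D_e_eq_zero (l j : ℕ) (t r : ℤ) (hl : 1 ≤ l) (hl' : l ≤ n) (hj : 1 ≤ j)
    (hj' : j ≤ n) (h0 : aD n j l = 0) : L.D l t (L.e j r) = 0 := by
  rw [D_apply, L.τ_e', aD_symm, h0, L.comm j l r t hj hj' hl hl' h0]
  simp

lemma two_q_ne (L : LoopAlg v n B) : v + v⁻¹ ≠ 0 := by
  have h := L.v_ne
  have : v + v⁻¹ = (v ^ 2 + 1) / v := by field_simp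
  rw [this]
  exact div_ne_zero L.v_add h

lemma kap_ne (L : LoopAlg v n B) : v - v⁻¹ ≠ 0 := by
  have h := L.v_ne
  have : v - v⁻¹ = (v ^ 2 - 1) / v := by field_simp
  rw [this]
  exact div_ne_zero L.v_sub h

lemma serre' (i j : ℕ) (r t : ℤ) (hi : 1 ≤ i) (hi' : i ≤ n) (hj : 1 ≤ j)
    (hj' : j ≤ n) (h0 : aD n i j = -1) :
    L.e i r * L.e i r * L.e j t - (v + v⁻¹) • (L.e i r * L.e j t * L.e i r)
      + L.e j t * L.e i r * L.e i r = 0 := by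
  have h := L.serre i j r r t hi hi' hj hj' h0
  rw [← two_smul F, smul_eq_zero] at h
  exact h.resolve_left two_ne_zero

lemma D_serre (i j : ℕ) (r t : ℤ) (x : B) (hi : 1 ≤ i) (hi' : i ≤ n) (hj : 1 ≤ j)
    (hj' : j ≤ n) (h0 : aD n i j = -1) :
    L.D i r (L.D i r (L.D j t x)) - (v + v⁻¹) • L.D i r (L.D j t (L.D i r x))
      + L.D j t (L.D i r (L.D i r x)) = 0 := by
  have h := L.serre' i j r t hi hi' hj hj' h0
  have hv := L.v_ne
  have h1 := congrArg (x * ·) h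
  have h2 := congrArg (· * L.τ (M n i) (L.τ (M n i) (L.τ (M n j) x))) h
  have hji : aD n j i = -1 := by rw [aD_symm, h0]
  have e2 : v ^ (2 : ℤ) = v ^ 2 := by norm_cast
  simp only [L.D_apply, map_sub, map_mul, L.τ_e', map_smul, L.τ_comm (M n j) (M n i), h0, hji,
    aD_self, e2, zpow_neg_one]
  simp only [sub_mul, mul_sub, mul_smul_comm, smul_mul_assoc, mul_assoc, add_mul, mul_add,
    mul_zero, zero_mul, smul_smul] at h1 h2 ⊢
  linear_combination (norm := skip) h1 - h2
  match_scalars <;> field_simp <;> ring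

end LoopAlg

lemma aD_eq_zero {n i j : ℕ} (h : i ≠ j) (h1 : i + 1 = j → j = n) (h2 : j + 1 = i → i = n)
    (h3 : i + 2 = n → j ≠ n) (h4 : j + 2 = n → i ≠ n) : aD n i j = 0 := by
  unfold aD; split_ifs <;> omega

lemma aD_eq_neg_one {n i j : ℕ} (h : (i + 1 = j ∧ j < n) ∨ (j + 1 = i ∧ i < n) ∨
    (i + 2 = n ∧ j = n) ∨ (j + 2 = n ∧ i = n)) : aD n i j = -1 := by
  unfold aD; split_ifs <;> omega

/-- valid positions in the block of roots starting at `i`. -/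
def Vp (n i p : ℕ) : Prop := p = 0 ∨ (p + 2 * i + 1 ≤ 2 * n ∧ i + 2 ≤ n)

/-- the color `j` moves position `p` to position `p'` in the block of roots starting at `i`. -/
def Edge (n i j p p' : ℕ) : Prop := i + 2 ≤ n ∧ i < j ∧
  ((j + 1 ≤ n ∧ i + p + 1 = j ∧ p' = p + 1) ∨ (j + 1 ≤ n ∧ p + i + j + 1 = 2 * n ∧ p' = p + 1) ∨
    (j = n ∧ p + i + 2 = n ∧ p' = p + 2) ∨ (j = n ∧ p + i + 1 = n ∧ p' = p + 2))

namespace LoopAlg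
variable {F : Type} [Field F] [CharZero F] {v : F}
variable {n : ℕ} {B : Type} [Ring B] [Algebra F B] (L : LoopAlg v n B)

lemma D_D_D_eq_zero_of_left {l j : ℕ} {t r : ℤ} {x : B} (hl : 1 ≤ l) (hl' : l ≤ n) (hj : 1 ≤ j)
    (hj' : j ≤ n) (ha : aD n l j = -1) (h : L.D l t x = 0) :
    L.D l t (L.D l t (L.D j r x)) = 0 := by
  have := L.D_serre l j t r x hl hl' hj hj' ha
  simpa [h] using this

lemma D_D_D_eq_zero_of_mid {l j : ℕ} {t r : ℤ} {x : B} (hl : 1 ≤ l) (hl' : l ≤ n) (hj : 1 ≤ j)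
    (hj' : j ≤ n) (ha : aD n j l = -1) (h : L.D l t x = 0) (h2 : L.D j r (L.D j r x) = 0) :
    L.D j r (L.D l t (L.D j r x)) = 0 := by
  have := L.D_serre j l r t x hj hj' hl hl' ha
  rw [h, h2, map_zero, map_zero, zero_sub, map_zero, add_zero, neg_eq_zero, smul_eq_zero] at this
  exact this.resolve_left L.two_q_ne

lemma D_D_e_eq_zero {l j : ℕ} {t r : ℤ} (hl : 1 ≤ l) (hl' : l ≤ n) (hj : 1 ≤ j)
    (hj' : j ≤ n) (ha : aD n l j = -1) : L.D l t (L.D l t (L.e j r)) = 0 := by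
  have h := L.serre' l j t r hl hl' hj hj' ha
  have hv := L.v_ne
  have e2 : v ^ (2 : ℤ) = v ^ 2 := by norm_cast
  simp only [L.D_apply, map_sub, map_mul, L.τ_e', map_smul, ha, aD_self, e2, zpow_neg_one]
  simp only [sub_mul, mul_sub, mul_smul_comm, smul_mul_assoc, mul_assoc, smul_smul] at h ⊢
  linear_combination (norm := skip) h
  match_scalars <;> field_simp <;> ring

/-- the first half of the block of root vectors starting at color `i`. -/
def lo (t : ℕ → ℤ) (i : ℕ) (s : ℤ) : ℕ → B
  | 0 => L.e i s
  | p + 1 => L.D (i + p + 1) (t (i + p + 1)) (lo t i s p)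

/-- the second half of the block of root vectors starting at color `i`. -/
def hi (t : ℕ → ℤ) (i : ℕ) (s : ℤ) : ℕ → B
  | 0 => L.D n (t n) (L.lo t i s (n - i - 2))
  | q + 1 => L.D (n - 1 - q) (t (n - 1 - q)) (hi t i s q)

/-- the root vectors of the block starting at color `i`, indexed by position. -/
def EE (t : ℕ → ℤ) (i : ℕ) (s : ℤ) (p : ℕ) : B :=
  if p < n - i ∨ p = 0 then L.lo t i s p else L.hi t i s (p - (n - i))

variable (t : ℕ → ℤ) (i : ℕ) (s : ℤ)

lemma lo_zero (hi1 : 1 ≤ i) (hi2 : i + 2 ≤ n) : ∀ p, p + i + 1 ≤ n → ∀ j, i < j → j ≤ n →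
    ¬((j < n ∧ j = i + p + 1) ∨ (j = n ∧ (p + i + 2 = n ∨ p + i + 1 = n))) →
    L.D j (t j) (L.lo t i s p) = 0
  | 0, hp, j, h1, h2, h3 => by
      apply L.D_e_eq_zero <;> first | omega | (apply aD_eq_zero <;> omega)
  | p + 1, hp, j, h1, h2, h3 => by
      rw [lo]
      by_cases c1 : j = i + p + 1
      · rcases p with _ | p
        · rw [← c1, lo]
          apply L.D_D_e_eq_zero <;> first | omega | (apply aD_eq_neg_one; omega)
        · rw [← c1, lo]
          apply L.D_D_D_eq_zero_of_left <;> first | omega | skip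
          · apply aD_eq_neg_one; omega
          · exact lo_zero hi1 hi2 p (by omega) j (by omega) h2 (by omega)
      by_cases c2 : j = i + p
      · obtain ⟨p, rfl⟩ : ∃ q, p = q + 1 := ⟨p - 1, by omega⟩
        rw [lo, show i + p + 1 = j by omega]
        apply L.D_D_D_eq_zero_of_mid <;> first | omega | skip
        · apply aD_eq_neg_one; omega
        · exact lo_zero hi1 hi2 p (by omega) _ (by omega) (by omega) (by omega)
        · have := lo_zero hi1 hi2 (p + 1) (by omega) j (by omega) h2 (by omega)
          rwa [lo, show i + p + 1 = j by omega] at this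
      rw [L.D_comm j] <;> first | omega | skip
      · rw [lo_zero hi1 hi2 p (by omega) j h1 h2 (by omega), map_zero]
      · apply aD_eq_zero <;> omega

lemma lo_top (hi1 : 1 ≤ i) (hi2 : i + 2 ≤ n) :
    L.D n (t n) (L.lo t i s (n - i - 1)) = L.hi t i s 1 := by
  obtain ⟨k, hk⟩ : ∃ k, n = i + 2 + k := ⟨n - i - 2, by omega⟩
  have e1 : n - i - 1 = k + 1 := by omega
  have e2 : n - i - 2 = k := by omega
  have e3 : n - 1 - 0 = i + k + 1 := by omega
  rw [e1, hi, hi, e2, e3, lo]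
  exact L.D_comm _ _ _ _ _ (by omega) le_rfl (by omega) (by omega)
    (by apply aD_eq_zero <;> omega)

lemma hi_zero (hi1 : 1 ≤ i) (hi2 : i + 2 ≤ n) : ∀ q, q + i + 1 ≤ n → ∀ j, i < j → j ≤ n →
    j + q + 1 ≠ n → L.D j (t j) (L.hi t i s q) = 0
  | 0, hq, j, h1, h2, h3 => by
      rw [hi]
      by_cases c1 : n = i + 2
      · rw [show n - i - 2 = 0 by omega, lo]
        obtain rfl : j = n := by omega
        apply L.D_D_e_eq_zero <;> first | omega | (apply aD_eq_neg_one; omega)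
      obtain ⟨k, hk⟩ : ∃ k, n = i + 3 + k := ⟨n - i - 3, by omega⟩
      have e2 : n - i - 2 = k + 1 := by omega
      have z1 : L.D n (t n) (L.lo t i s k) = 0 :=
        L.lo_zero t i s hi1 hi2 k (by omega) n (by omega) le_rfl (by omega)
      by_cases c2 : j = n
      · rw [e2, lo, c2]
        apply L.D_D_D_eq_zero_of_left (ha := ?_) (h := z1) <;>
          first | omega | (apply aD_eq_neg_one; omega)
      by_cases c3 : j = i + k + 1
      · have := L.lo_zero t i s hi1 hi2 (k + 1) (by omega) j (by omega) h2 (by omega)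
        rw [lo, ← c3] at this
        rw [e2, lo, ← c3]
        apply L.D_D_D_eq_zero_of_mid (ha := ?_) (h := z1) (h2 := this) <;>
          first | omega | (apply aD_eq_neg_one; omega)
      rw [L.D_comm j] <;> first | omega | skip
      · rw [L.lo_zero t i s hi1 hi2 _ (by omega) j h1 h2 (by omega), map_zero]
      · apply aD_eq_zero <;> omega
  | 1, hq, j, h1, h2, h3 => by
      have ih := hi_zero hi1 hi2 0 (by omega)
      by_cases c1 : j + 1 = n
      · rw [← L.lo_top t i s hi1 hi2, L.D_comm j, L.lo_zero t i s hi1 hi2, map_zero] <;>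
          first | omega | (apply aD_eq_zero <;> omega)
      rw [hi, L.D_comm j, ih j h1 h2 (by omega), map_zero] <;>
          first | omega | (apply aD_eq_zero <;> omega)
  | q + 2, hq, j, h1, h2, h3 => by
      have ih1 := hi_zero hi1 hi2 (q + 1) (by omega)
      have ih0 := hi_zero hi1 hi2 q (by omega)
      rw [hi]
      by_cases c1 : j = n - 1 - (q + 1)
      · rw [← c1, hi]
        apply L.D_D_D_eq_zero_of_left (ha := ?_) (h := ih0 j h1 h2 (by omega)) <;>
          first | omega | (apply aD_eq_neg_one; omega)
      by_cases c2 : j = n - 1 - q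
      · have := ih1 j h1 h2 (by omega)
        rw [hi, ← c2] at this
        rw [hi, ← c2]
        apply L.D_D_D_eq_zero_of_mid (ha := ?_) (h2 := this)
          (h := ih0 (n - 1 - (q + 1)) (by omega) (by omega) (by omega)) <;>
          first | omega | (apply aD_eq_neg_one; omega)
      by_cases c3 : q = 0 ∧ j = n
      · obtain ⟨rfl, rfl⟩ := c3
        have := ih1 j h1 h2 (by omega)
        simp only [zero_add] at *
        rw [← L.lo_top t i s hi1 hi2] at this ⊢
        apply L.D_D_D_eq_zero_of_mid (ha := ?_) (h2 := this)
          (h := L.lo_zero t i s hi1 hi2 _ (by omega) _ (by omega) (by omega) (by omega)) <;>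
          first | omega | (apply aD_eq_neg_one; omega)
      rw [L.D_comm j, ih1 j h1 h2 (by omega), map_zero] <;>
          first | omega | (apply aD_eq_zero <;> omega)

@[simp] lemma EE_zero : L.EE t i s 0 = L.e i s := by simp [EE, lo]

lemma EE_edge (hi1 : 1 ≤ i) {j p p' : ℕ} (h : Edge n i j p p') :
    L.D j (t j) (L.EE t i s p) = L.EE t i s p' := by
  obtain ⟨h0, h1, ⟨h2, h3, rfl⟩ | ⟨h2, h3, rfl⟩ | ⟨rfl, h3, rfl⟩ | ⟨rfl, h3, rfl⟩⟩ := h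
  · rw [EE, EE, if_pos (by omega), if_pos (by omega), lo, h3]
  · rw [EE, EE, if_neg (by omega), if_neg (by omega)]
    obtain ⟨q, hq⟩ : ∃ q, p = n - i + q := ⟨p - (n - i), by omega⟩
    rw [show p - (n - i) = q by omega, show p + 1 - (n - i) = q + 1 by omega, hi,
      show n - 1 - q = j by omega]
  · rw [EE, EE, if_pos (by omega), if_neg (by omega), show p + 2 - (j - i) = 0 by omega, hi,
      show j - i - 2 = p by omega]
  · rw [EE, EE, if_pos (by omega), if_neg (by omega), show p + 2 - (j - i) = 1 by omega,
      ← L.lo_top t i s hi1 h0, show j - i - 1 = p by omega]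

lemma EE_none (hi1 : 1 ≤ i) {j p : ℕ} (hp : Vp n i p) (hj : i < j) (hj' : j ≤ n)
    (h : ∀ p', ¬Edge n i j p p') : L.D j (t j) (L.EE t i s p) = 0 := by
  by_cases c : i + 2 ≤ n
  · have a1 := h (p + 1)
    have a2 := h (p + 2)
    unfold Edge at a1 a2
    unfold Vp at hp
    unfold EE
    split_ifs with hc
    · exact L.lo_zero t i s hi1 c p (by omega) j hj hj' (by omega)
    · exact L.hi_zero t i s hi1 c _ (by omega) j hj hj' (by omega)
  · obtain rfl : p = 0 := by unfold Vp at hp; omega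
    rw [EE_zero]
    apply L.D_e_eq_zero <;> first | omega | (apply aD_eq_zero <;> omega)

/-- every nonzero position is the target of a tree edge. -/
lemma exists_edge {p' : ℕ} (hp : Vp n i p') (h0 : p' ≠ 0) :
    ∃ j p, Edge n i j p p' ∧ Vp n i p ∧ p < p' ∧ i < j ∧ j ≤ n := by
  unfold Vp at hp
  by_cases c1 : p' + i + 1 ≤ n
  · exact ⟨i + p', p' - 1, by unfold Edge; omega, by unfold Vp; omega, by omega⟩
  by_cases c2 : p' + i = n
  · exact ⟨n, p' - 2, by unfold Edge; omega, by unfold Vp; omega, by omega⟩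
  · exact ⟨2 * n - i - p', p' - 1, by unfold Edge; omega, by unfold Vp; omega, by omega⟩

end LoopAlg

section Rel
variable {F : Type} [Field F] {B : Type} [Ring B] [Algebra F B]

/-- the `v`-commutator of two series. -/
def FF (v : F) (x y : ℤ → B) (s r : ℤ) : B := y s * x r - v • (x r * y s)

/-- relations between the series of two different roots in a block. -/
structure Rp (v : F) (x y : ℤ → B) : Prop where
  anti : ∀ s r, FF v x y s r + FF v x y r s = 0
  shift : ∀ s r, FF v x y (s + 1) r - FF v x y s (r + 1) =
    (v - v⁻¹) • (x (r + 1) * y s + x (s + 1) * y r)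

/-- quadratic relations of the series of one root. -/
def Rq (v : F) (x : ℤ → B) : Prop := ∀ s r,
  x (s + 1) * x r - v ^ 2 • (x s * x (r + 1)) = v ^ 2 • (x r * x (s + 1)) - x (r + 1) * x s

end Rel

namespace LoopAlg
variable {F : Type} [Field F] [CharZero F] {v : F}
variable {n : ℕ} {B : Type} [Ring B] [Algebra F B] (L : LoopAlg v n B)
variable {x y : ℤ → B} {l : ℕ} {t : ℤ}

lemma Rp_D_right (h : Rp v x y) (hx : ∀ s, L.D l t (x s) = 0)
    (hτ : ∀ s, L.τ (M n l) (x s) = x s) : Rp v x (fun s => L.D l t (y s)) := by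
  have key : ∀ s r, FF v x (fun s => L.D l t (y s)) s r = L.D l t (FF v x y s r) := fun s r => by
    simp [FF, L.D_mul, hx, hτ]
  refine ⟨fun s r => ?_, fun s r => ?_⟩
  · rw [key, key, ← map_add, h.anti, map_zero]
  · rw [key, key, ← map_sub, h.shift]
    simp [L.D_mul, hx]

lemma Rp_D_left (h : Rp v x y) (hy : ∀ s, L.D l t (y s) = 0)
    (hτ : ∀ s, L.τ (M n l) (y s) = y s) : Rp v (fun s => L.D l t (x s)) y := by
  have key : ∀ s r, FF v (fun s => L.D l t (x s)) y s r = L.D l t (FF v x y s r) := fun s r => by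
    simp [FF, L.D_mul, hy, hτ]
  refine ⟨fun s r => ?_, fun s r => ?_⟩
  · rw [key, key, ← map_add, h.anti, map_zero]
  · rw [key, key, ← map_sub, h.shift]
    simp [L.D_mul, hy, hτ]

lemma D_D_mul {a b : B} (ha : L.D l t (L.D l t a) = 0) (hb : L.D l t (L.D l t b) = 0)
    (hτ : L.τ (M n l) b = v • b) :
    L.D l t (L.D l t (a * b)) = (v + v⁻¹) • (L.D l t a * L.D l t b) := by
  have hv := L.v_ne
  have : L.τ (M n l) (L.D l t b) = v⁻¹ • L.D l t b := by
    rw [L.τ_D, hτ, map_smul, smul_smul, M, aD_self, zpow_neg, zpow_ofNat]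
    congr 1; field_simp
  simp only [L.D_mul, map_add, ha, hb, hτ, this, mul_smul_comm, map_smul, mul_zero, zero_mul]
  module

lemma Rp_D_both (h : Rp v x y) (hx : ∀ s, L.D l t (L.D l t (x s)) = 0)
    (hy : ∀ s, L.D l t (L.D l t (y s)) = 0)
    (hτx : ∀ s, L.τ (M n l) (x s) = v • x s) (hτy : ∀ s, L.τ (M n l) (y s) = v • y s) :
    Rp v (fun s => L.D l t (x s)) (fun s => L.D l t (y s)) := by
  have hne := L.two_q_ne
  have key : ∀ s r, (v + v⁻¹) • FF v (fun s => L.D l t (x s)) (fun s => L.D l t (y s)) s r =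
      L.D l t (L.D l t (FF v x y s r)) := fun s r => by
    simp only [FF, map_sub, map_smul, L.D_D_mul (hx _) (hy _) (hτy _),
      L.D_D_mul (hy _) (hx _) (hτx _)]
    module
  refine ⟨fun s r => ?_, fun s r => ?_⟩
  · apply smul_right_injective B hne
    simp only [smul_add, key, ← map_add, h.anti, map_zero, smul_zero]
  · apply smul_right_injective B hne
    simp only [smul_sub, key, ← map_sub, h.shift]
    simp only [map_smul, map_add, L.D_D_mul (hx _) (hy _) (hτy _)]
    module

lemma Rq_D (h : Rq v x) (hx : ∀ s, L.D l t (L.D l t (x s)) = 0)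
    (hτx : ∀ s, L.τ (M n l) (x s) = v • x s) : Rq v (fun s => L.D l t (x s)) := by
  have hne := L.two_q_ne
  intro s r
  apply smul_right_injective B hne
  have := congrArg (fun z => L.D l t (L.D l t z)) (h s r)
  simp only [map_sub, map_smul, L.D_D_mul (hx _) (hx _) (hτx _)] at this
  simp only [smul_sub, smul_comm (v + v⁻¹) (v ^ 2)]
  exact this

lemma Rq_e (i : ℕ) (hi : 1 ≤ i) (hi' : i ≤ n) : Rq v (L.e i) := by
  intro s r
  have := L.loop i i s r hi hi' hi hi'
  rw [aD_self] at this
  exact_mod_cast this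

lemma Rp_e (i j : ℕ) (t : ℤ) (hi : 1 ≤ i) (hi' : i ≤ n) (hj : 1 ≤ j) (hj' : j ≤ n)
    (ha : aD n i j = -1) : Rp v (L.e i) (fun s => L.D j t (L.e i s)) := by
  have hv := L.v_ne
  have hji : aD n j i = -1 := by rw [aD_symm, ha]
  have hanti : ∀ s r, FF v (L.e i) (fun s => L.D j t (L.e i s)) s r
      + FF v (L.e i) (fun s => L.D j t (L.e i s)) r s = 0 := fun s r => by
    have h := L.serre i j r s t hi hi' hj hj' ha
    simp only [FF, L.D_apply, L.τ_e', hji, zpow_neg_one, inv_inv]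
    simp only [sub_mul, mul_sub, mul_smul_comm, smul_mul_assoc, mul_assoc] at h ⊢
    linear_combination (norm := skip) (-v) • h
    match_scalars <;> field_simp <;> ring
  refine ⟨hanti, fun s r => ?_⟩
  have h1 := congrArg (L.D j t) (L.Rq_e i hi hi' s r)
  have h2 := hanti (s + 1) r
  have h3 := hanti s (r + 1)
  have hne := L.v_add
  simp only [map_sub, map_smul, L.D_mul, L.τ_e', hji, zpow_neg_one, inv_inv, FF] at h1 h2 h3 ⊢
  generalize L.D j t (L.e i s) = y0 at *
  generalize L.D j t (L.e i r) = y1 at *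
  generalize L.D j t (L.e i (s + 1)) = y2 at *
  generalize L.D j t (L.e i (r + 1)) = y3 at *
  simp only [mul_smul_comm] at h1 h2 h3 ⊢
  linear_combination (norm := skip) (v + v ^ 3)⁻¹ • h1 + (v ^ 2 * (v ^ 2 + 1)⁻¹) • h2
    - (v ^ 2 + 1)⁻¹ • h3
  rw [show v + v ^ 3 = v * (v ^ 2 + 1) by ring]
  match_scalars <;> field_simp <;> ring

end LoopAlg

/-- the weight pairing of position `p` of the block of `i` with the color `l`. -/
def cw (n i l p : ℕ) : ℤ :=
  if (l < n ∧ (i + p + 1 = l ∨ p + i + l + 1 = 2 * n)) ∨ (l = n ∧ (p + i + 2 = n ∨ p + i + 1 = n))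
  then 1
  else if (l < n ∧ (i + p = l ∨ p + i + l = 2 * n)) ∨ (l = n ∧ (p + i = n ∨ p + i = n + 1))
  then -1 else 0

lemma cw_edge {n i l j p p' : ℕ} (hl : i < l) (hl' : l ≤ n) (h : Edge n i j p p') :
    cw n i l p' = cw n i l p - aD n j l := by
  obtain ⟨h0, h1, ⟨h2, h3, rfl⟩ | ⟨h2, h3, rfl⟩ | ⟨h2, h3, rfl⟩ | ⟨h2, h3, rfl⟩⟩ := h
  all_goals
    by_cases hln : l = n
    · subst hln
      simp only [cw, aD, lt_irrefl, false_and, true_and, false_or, and_true]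
      split_ifs <;> omega
    · have : l < n := by omega
      simp only [cw, aD, hln, this, false_and, true_and, or_false, and_false,
        false_or]
      split_ifs <;> omega

lemma cw_source {n i l p : ℕ} (hi : i + 2 ≤ n) (hl : i < l) (h : cw n i l p = 1) :
    ∃ p', Edge n i l p p' := by
  unfold cw at h
  split_ifs at h with h1
  · by_cases h2 : l = n
    · exact ⟨p + 2, by unfold Edge; omega⟩
    · exact ⟨p + 1, by unfold Edge; omega⟩
  · simp at h

lemma cw_target {n i l p : ℕ} (hi : i + 2 ≤ n) (hl : i < l) (h : cw n i l p = -1) :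
    ∃ q, Edge n i l q p := by
  unfold cw at h
  split_ifs at h with h1 h2
  · by_cases h3 : l = n
    · exact ⟨p - 2, by unfold Edge; omega⟩
    · exact ⟨p - 1, by unfold Edge; omega⟩

lemma cw_cases (n i l p : ℕ) : cw n i l p = 1 ∨ cw n i l p = -1 ∨ cw n i l p = 0 := by
  unfold cw; split_ifs <;> simp

lemma cw_of_source {n i l p p' : ℕ} (h : Edge n i l p p') : cw n i l p = 1 := by
  unfold Edge at h
  unfold cw
  split_ifs <;> omega

lemma cw_of_target {n i l p p' : ℕ} (h : Edge n i l p p') : cw n i l p' = -1 := by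
  unfold Edge at h
  unfold cw
  split_ifs <;> omega

namespace LoopAlg
variable {F : Type} [Field F] [CharZero F] {v : F}
variable {n : ℕ} {B : Type} [Ring B] [Algebra F B] (L : LoopAlg v n B)
variable (t : ℕ → ℤ) (i : ℕ)

lemma τ_EE (hi : 1 ≤ i) (μ : ℕ → ℤ) : ∀ p, Vp n i p → ∃ k : ℤ, ∀ s,
    L.τ μ (L.EE t i s p) = v ^ k • L.EE t i s p := by
  intro p
  induction p using Nat.strong_induction_on with
  | _ p ih =>
    intro hp
    by_cases h0 : p = 0
    · subst h0
      exact ⟨μ i, fun s => by rw [EE_zero, L.τ_e]⟩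
    · obtain ⟨j, q, he, hq, hlt, -, -⟩ := exists_edge i hp h0
      obtain ⟨k, hk⟩ := ih q hlt hq
      refine ⟨μ j + k, fun s => ?_⟩
      rw [← L.EE_edge t i s hi he, L.τ_D, hk, map_smul, smul_smul, zpow_add₀ L.v_ne]

lemma τ_EE_cw (hi : 1 ≤ i) {l : ℕ} (hl : i < l) (hl' : l ≤ n) (hn : i + 2 ≤ n) :
    ∀ p, Vp n i p → ∀ s, L.τ (M n l) (L.EE t i s p) = v ^ cw n i l p • L.EE t i s p := by
  intro p
  induction p using Nat.strong_induction_on with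
  | _ p ih =>
    intro hp s
    by_cases h0 : p = 0
    · subst h0
      rw [EE_zero, L.τ_e, M]
      congr 2
      unfold aD cw
      split_ifs <;> omega
    · obtain ⟨j, q, he, hq, hlt, -, -⟩ := exists_edge i hp h0
      rw [← L.EE_edge t i s hi he, L.τ_D, ih q hlt hq, map_smul, smul_smul,
        cw_edge hl hl' he, ← zpow_add₀ L.v_ne, M]
      congr 2; ring

lemma D_EE_of_cw (hi : 1 ≤ i) {l p : ℕ} (hp : Vp n i p) (hl : i < l) (hl' : l ≤ n)
    (h : cw n i l p ≠ 1) (s : ℤ) : L.D l (t l) (L.EE t i s p) = 0 :=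
  L.EE_none t i s hi hp hl hl' fun _ he => h (cw_of_source he)

lemma D_D_EE (hi : 1 ≤ i) {l p : ℕ} (hp : Vp n i p) (hl : i < l) (hl' : l ≤ n)
    (s : ℤ) : L.D l (t l) (L.D l (t l) (L.EE t i s p)) = 0 := by
  by_cases h : ∃ p', Edge n i l p p'
  · obtain ⟨p', he⟩ := h
    rw [L.EE_edge t i s hi he]
    refine L.D_EE_of_cw t i hi ?_ hl hl' (by rw [cw_of_target he]; decide) s
    unfold Edge at he; unfold Vp at *; omega
  · push Not at h
    rw [L.EE_none t i s hi hp hl hl' h, map_zero]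

lemma Rq_EE (hi : 1 ≤ i) (hi' : i ≤ n) : ∀ p, Vp n i p → Rq v (fun s => L.EE t i s p) := by
  intro p
  induction p using Nat.strong_induction_on with
  | _ p ih =>
    intro hp
    by_cases h0 : p = 0
    · subst h0
      simp only [EE_zero]
      exact L.Rq_e i hi hi'
    · obtain ⟨j, q, he, hq, hlt, hj, hj'⟩ := exists_edge i hp h0
      simp only [← L.EE_edge t i _ hi he]
      refine L.Rq_D (ih q hlt hq) (L.D_D_EE t i hi hq hj hj') fun s => ?_
      rw [L.τ_EE_cw t i hi hj hj' he.1 q hq, cw_of_source he, zpow_one]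

lemma Rp_EE (hi : 1 ≤ i) (hi' : i + 2 ≤ n) : ∀ N a b, a + b = N → a < b → Vp n i a → Vp n i b →
    a + b + 1 + 2 * i ≠ 2 * n → Rp v (fun s => L.EE t i s a) (fun s => L.EE t i s b) := by
  intro N
  induction N using Nat.strong_induction_on with
  | _ N ih =>
    intro a b hN hab ha hb hd
    by_cases h0 : a = 0
    · subst h0
      obtain ⟨j, q, he, hq, hlt, hj, hj'⟩ := exists_edge i hb (by omega)
      simp only [← L.EE_edge t i _ hi he]
      by_cases hq0 : q = 0
      · subst hq0
        simp only [EE_zero]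
        exact L.Rp_e i j _ hi (by omega) (by omega) hj'
          (by unfold Edge at he; apply aD_eq_neg_one; omega)
      · have hc : cw n i j 0 = 0 := by
          unfold Edge at he; unfold Vp at *; unfold cw; split_ifs <;> omega
        refine L.Rp_D_right (ih q (by omega) 0 q (by omega) (by omega) ha hq
          (by unfold Vp at *; omega)) (L.D_EE_of_cw t i hi ha hj hj' (by omega)) fun s => ?_
        rw [L.τ_EE_cw t i hi hj hj' hi' _ ha, hc, zpow_zero, one_smul]
    · obtain ⟨l, q, he, hq, hlt, hl, hl'⟩ := exists_edge i ha h0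
      simp only [← L.EE_edge t i _ hi he]
      by_cases h1 : ∃ q', Edge n i l q' b
      · obtain ⟨q', he'⟩ := h1
        have hq' : Vp n i q' := by unfold Edge at he'; unfold Vp at *; omega
        simp only [← L.EE_edge t i _ hi he']
        refine L.Rp_D_both (ih (q + q') ?_ q q' rfl ?_ hq hq' ?_) (L.D_D_EE t i hi hq hl hl')
          (L.D_D_EE t i hi hq' hl hl') (fun s => ?_) (fun s => ?_)
        · unfold Edge at he he'; omega
        · unfold Edge at he he'; omega
        · unfold Edge at he he'; omega
        · rw [L.τ_EE_cw t i hi hl hl' hi' _ hq, cw_of_source he, zpow_one]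
        · rw [L.τ_EE_cw t i hi hl hl' hi' _ hq', cw_of_source he', zpow_one]
      · have hc : cw n i l b = 0 := by
          rcases cw_cases n i l b with h | h | h
          · obtain ⟨b', he'⟩ := cw_source hi' hl h
            unfold Edge at he he'; unfold Vp at *; omega
          · exact absurd (cw_target hi' hl h) h1
          · exact h
        have hqb : q + b + 1 + 2 * i ≠ 2 * n := fun h => by
          refine h1 ?_
          by_cases hln : l = n
          · exact ⟨b - 2, by unfold Edge at *; unfold Vp at *; omega⟩
          · exact ⟨b - 1, by unfold Edge at *; unfold Vp at *; omega⟩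
        refine L.Rp_D_left (ih (q + b) (by omega) q b rfl (by omega) hq hb hqb)
          (L.D_EE_of_cw t i hi hb hl hl' (by omega)) fun s => ?_
        rw [L.τ_EE_cw t i hi hl hl' hi' _ hb, hc, zpow_zero, one_smul]

end LoopAlg

section RR
variable {F : Type} [Field F]

/-- the ring of Laurent polynomials in `v`. -/
abbrev RR (v : F) : Subring F := Subring.closure {v, v⁻¹}

lemma v_mem (v : F) : v ∈ RR v := Subring.subset_closure (by simp)
lemma v_inv_mem (v : F) : v⁻¹ ∈ RR v := Subring.subset_closure (by simp)

lemma zpow_mem_RR (v : F) (k : ℤ) : v ^ k ∈ RR v := by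
  cases k with
  | ofNat a => simpa using pow_mem (v_mem v) a
  | negSucc a => simpa [zpow_negSucc, ← inv_pow] using pow_mem (v_inv_mem v) (a + 1)

lemma kap_mem_RR (v : F) : v - v⁻¹ ∈ RR v := sub_mem (v_mem v) (v_inv_mem v)

lemma zpow_sub_zpow_neg_mem (v : F) (hv : v ≠ 0) (k : ℤ) :
    ∃ c ∈ RR v, v ^ k - v ^ (-k) = c * (v - v⁻¹) := by
  induction k using Int.induction_on with
  | zero => exact ⟨0, zero_mem _, by simp⟩
  | succ k ih =>
    obtain ⟨c, hc, h⟩ := ih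
    refine ⟨v * c + v ^ (-k : ℤ), add_mem (mul_mem (v_mem v) hc) (zpow_mem_RR v _), ?_⟩
    have e1 : v ^ ((k : ℤ) + 1) = v ^ (k : ℤ) * v := zpow_add_one₀ hv _
    have e2 : v ^ (-((k : ℤ) + 1)) = v ^ (-(k : ℤ)) * v⁻¹ := by
      rw [neg_add, zpow_add₀ hv, zpow_neg_one]
    rw [e1, e2]
    linear_combination v * h
  | pred k ih =>
    obtain ⟨c, hc, h⟩ := ih
    refine ⟨v⁻¹ * c - v ^ (k : ℤ), sub_mem (mul_mem (v_inv_mem v) hc) (zpow_mem_RR v _), ?_⟩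
    have e1 : v ^ (-(k : ℤ) - 1) = v ^ (-(k : ℤ)) * v⁻¹ := zpow_sub_one₀ hv _
    have e2 : v ^ (-(-(k : ℤ) - 1)) = v ^ (k : ℤ) * v := by
      rw [show -(-(k : ℤ) - 1) = k + 1 by ring, zpow_add_one₀ hv]
    rw [neg_neg] at h
    rw [e1, e2]
    linear_combination v⁻¹ * h

variable {v : F} {B : Type} [Ring B] [Algebra F B]

lemma smulR {N : Submodule (RR v) B} {c : F} (hc : c ∈ RR v) {x : B} (hx : x ∈ N) : c • x ∈ N :=
  N.smul_mem ⟨c, hc⟩ hx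

lemma smulP {N : Subalgebra (RR v) B} {c : F} (hc : c ∈ RR v) {x : B} (hx : x ∈ N) : c • x ∈ N :=
  N.smul_mem hx ⟨c, hc⟩

/-- congruence modulo `N` up to a power of `v`. -/
def Cong (v : F) (N : Submodule (RR v) B) (a b : B) : Prop := ∃ k : ℤ, a - v ^ k • b ∈ N

variable {N : Submodule (RR v) B}

lemma Cong.refl (a : B) : Cong v N a a := ⟨0, by simp⟩

lemma Cong.mem {a b : B} (h : Cong v N a b) (hb : b ∈ N) : a ∈ N := by
  obtain ⟨k, h⟩ := h
  simpa using add_mem h (smulR (zpow_mem_RR v k) hb)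

lemma Cong.symm {a b : B} (hv : v ≠ 0) (h : Cong v N a b) : Cong v N b a := by
  obtain ⟨k, h⟩ := h
  refine ⟨-k, ?_⟩
  have := smulR (zpow_mem_RR v (-k)) h
  rw [smul_sub, smul_smul, ← zpow_add₀ hv, neg_add_cancel, zpow_zero, one_smul] at this
  simpa using neg_mem this

lemma Cong.trans {a b c : B} (hv : v ≠ 0) (h : Cong v N a b) (h' : Cong v N b c) :
    Cong v N a c := by
  obtain ⟨k, h⟩ := h
  obtain ⟨k', h'⟩ := h'
  refine ⟨k + k', ?_⟩
  have := add_mem h (smulR (zpow_mem_RR v k) h')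
  rw [smul_sub, smul_smul, ← zpow_add₀ hv] at this
  simpa using this

lemma Cong.mono {N' : Submodule (RR v) B} (hN : N ≤ N') {a b : B} (h : Cong v N a b) :
    Cong v N' a b := ⟨h.choose, hN h.choose_spec⟩

lemma Cong.map {N' : Submodule (RR v) B} (f : B →ₗ[F] B) (hf : ∀ x ∈ N, f x ∈ N') {a b : B}
    (h : Cong v N a b) : Cong v N' (f a) (f b) := by
  obtain ⟨k, h⟩ := h
  exact ⟨k, by simpa using hf _ h⟩

lemma cong_of_step (hv : v ≠ 0) (f : ℤ → ℤ → B)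
    (h : ∀ r s, Cong v N (f (r + 1) s) (f r (s + 1))) :
    ∀ r s k, Cong v N (f r s) (f (r - k) (s + k)) := by
  intro r s k
  induction k using Int.induction_on with
  | zero => simpa using Cong.refl _
  | succ k ih =>
    refine ih.trans hv ?_
    have := h (r - (k + 1)) (s + k)
    rwa [show r - (k + 1 : ℤ) + 1 = r - k by ring, add_assoc] at this
  | pred k ih =>
    refine ih.trans hv ?_
    have := (h (r - -(k : ℤ)) (s + (-(k : ℤ) - 1))).symm hv
    rwa [show s + (-(k : ℤ) - 1) + 1 = s + -k by ring,
      show r - -(k : ℤ) + 1 = r - (-(k : ℤ) - 1) by ring] at this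

/-- span of the products of two series. -/
def sp (v : F) (x y : ℤ → B) : Submodule (RR v) B :=
  Submodule.span _ (Set.range fun p : ℤ × ℤ => x p.1 * y p.2)

lemma mem_sp (x y : ℤ → B) (s r : ℤ) : x s * y r ∈ sp v x y :=
  Submodule.subset_span ⟨(s, r), rfl⟩

/-- the submodule `c • N`. -/
def scl (c : F) (N : Submodule (RR v) B) : Submodule (RR v) B where
  carrier := {x | ∃ y ∈ N, x = c • y}
  add_mem' := by
    rintro _ _ ⟨y, hy, rfl⟩ ⟨z, hz, rfl⟩
    exact ⟨y + z, add_mem hy hz, (smul_add _ _ _).symm⟩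
  zero_mem' := ⟨0, zero_mem _, by simp⟩
  smul_mem' := by
    rintro d _ ⟨y, hy, rfl⟩
    exact ⟨(d : F) • y, N.smul_mem d hy, by
      change (d : F) • c • y = _
      rw [smul_comm]⟩

lemma smul_mem_scl {c : F} {x : B} (hx : x ∈ N) : c • x ∈ scl c N := ⟨x, hx, rfl⟩

lemma mem_of_scl {c : F} (hc : c ∈ RR v) {x : B} (hx : x ∈ scl c N) : x ∈ N := by
  obtain ⟨y, hy, rfl⟩ := hx
  exact smulR hc hy

lemma mem_of_steps (hv : v ≠ 0) (f : ℤ → ℤ → B) (h : ∀ s r, f (s + 1) r - f s (r + 1) ∈ N)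
    (h0 : ∀ s, f s s ∈ N) (h1 : ∀ s, f (s + 1) s ∈ N) (s r : ℤ) : f s r ∈ N := by
  have key := cong_of_step hv f (fun s r => ⟨0, by simpa using h s r⟩) s r
  rcases Int.even_or_odd' (s + r) with ⟨k, hk | hk⟩
  · refine (key (s - k)).mem ?_
    rw [show s - (s - k) = k by ring, show r + (s - k) = k by linarith]
    exact h0 k
  · refine (key (s - (k + 1))).mem ?_
    rw [show s - (s - (k + 1)) = k + 1 by ring, show r + (s - (k + 1)) = k by linarith]
    exact h1 k

variable [CharZero F]

lemma Rp.FF_mem (hv : v ≠ 0) {x y : ℤ → B} (h : Rp v x y) (s r : ℤ) :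
    FF v x y s r ∈ scl (v - v⁻¹) (sp v x y) := by
  have hss : ∀ s, FF v x y s s = 0 := fun s => by
    have := h.anti s s
    rw [← two_smul F, smul_eq_zero] at this
    exact this.resolve_left two_ne_zero
  refine mem_of_steps hv _ (fun s r => ?_) (fun s => ?_) (fun s => ?_) s r
  · rw [h.shift]
    exact smul_mem_scl (add_mem (mem_sp x y _ _) (mem_sp x y _ _))
  · rw [hss]; exact zero_mem _
  · have h1 := h.shift s s
    have h2 := h.anti (s + 1) s
    have h3 : FF v x y (s + 1) s = (v - v⁻¹) • (x (s + 1) * y s) := by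
      apply smul_right_injective B (two_ne_zero (α := F))
      simp only
      linear_combination (norm := module) h1 + h2
    rw [h3]
    exact smul_mem_scl (mem_sp x y _ _)

lemma Rp.FF_self {x y : ℤ → B} (h : Rp v x y) (s : ℤ) : y s * x s = v • (x s * y s) := by
  have := h.anti s s
  rw [← two_smul F, smul_eq_zero] at this
  exact sub_eq_zero.1 (this.resolve_left two_ne_zero)

lemma Rp.mul_mem (hv : v ≠ 0) {x y : ℤ → B} (h : Rp v x y) (s r : ℤ) :
    y s * x r ∈ sp v x y := by
  have := add_mem (mem_of_scl (kap_mem_RR v) (h.FF_mem hv s r))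
    (smulR (v_mem v) (mem_sp (v := v) x y r s))
  simpa [FF] using this

/-- span of the products `x s' * x r'` with `r ≤ s' ≤ r'` and `s' < s`. -/
def sqs (v : F) (x : ℤ → B) (r s : ℤ) : Submodule (RR v) B :=
  Submodule.span _ {z | ∃ s' r', r ≤ s' ∧ s' ≤ r' ∧ s' < s ∧ z = x s' * x r'}

lemma Rq.mul_succ {x : ℤ → B} (h : Rq v x) (u : ℤ) :
    x (u + 1) * x u = v ^ 2 • (x u * x (u + 1)) := by
  apply smul_right_injective B (two_ne_zero (α := F))
  simp only
  linear_combination (norm := module) h u u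

lemma Rq.mul_mem {x : ℤ → B} (h : Rq v x) :
    ∀ k : ℕ, ∀ s r : ℤ, s - r = k + 1 → x s * x r ∈ sqs v x r s := by
  intro k
  induction k using Nat.strong_induction_on with
  | _ k ih =>
    intro s r hk
    have gen : ∀ s' r' : ℤ, r ≤ s' → s' ≤ r' → s' < s → x s' * x r' ∈ sqs v x r s :=
      fun s' r' a b c => Submodule.subset_span ⟨s', r', a, b, c, rfl⟩
    obtain ⟨u, rfl⟩ : ∃ u, s = u + 1 := ⟨s - 1, by ring⟩
    have h2 : v ^ 2 ∈ RR v := pow_mem (v_mem v) 2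
    by_cases hu : u = r
    · subst hu
      rw [h.mul_succ]
      exact smulR h2 (gen _ _ le_rfl (by omega) (by omega))
    · have h1 := h u r
      have : x (u + 1) * x r = v ^ 2 • (x u * x (r + 1)) + v ^ 2 • (x r * x (u + 1))
          - x (r + 1) * x u := by
        linear_combination (norm := module) h1
      rw [this]
      refine sub_mem (add_mem (smulR h2 ?_) (smulR h2 (gen _ _ le_rfl (by omega) (by omega))))
        (gen _ _ (by omega) (by omega) (by omega))
      by_cases hr : u = r + 1
      · exact gen _ _ (by omega) (by omega) (by omega)
      · refine Submodule.span_mono ?_ (ih (k - 2) (by omega) u (r + 1) (by omega))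
        rintro _ ⟨s', r', a, b, c, rfl⟩
        exact ⟨s', r', by omega, b, by omega, rfl⟩

lemma Rq.comm_mem (hv : v ≠ 0) {x : ℤ → B} (h : Rq v x) (s r : ℤ) :
    x s * x r - x r * x s ∈ scl (v - v⁻¹) (sp v x x) := by
  have e : ∀ a : B, (v ^ 2 - 1) • a = (v - v⁻¹) • v • a := fun a => by
    rw [smul_smul]; congr 1; field_simp
  have hm : ∀ s r, (v ^ 2 - 1) • (x s * x r) ∈ scl (v - v⁻¹) (sp v x x) := fun s r => by
    rw [e]
    exact smul_mem_scl (smulR (v_mem v) (mem_sp x x s r))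
  refine mem_of_steps hv (fun s r => x s * x r - x r * x s) (fun s r => ?_) (fun s => ?_)
    (fun s => ?_) s r
  · have : x (s + 1) * x r - x r * x (s + 1) - (x s * x (r + 1) - x (r + 1) * x s) =
        (v ^ 2 - 1) • (x r * x (s + 1)) + (v ^ 2 - 1) • (x s * x (r + 1)) := by
      linear_combination (norm := module) h s r
    simp only [this]
    exact add_mem (hm _ _) (hm _ _)
  · rw [sub_self]; exact zero_mem _
  · rw [h.mul_succ]
    have := hm s (s + 1)
    rwa [sub_smul, one_smul] at this
end RR

namespace LoopAlg
variable {F : Type} [Field F] [CharZero F] {v : F}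
variable {n : ℕ} {B : Type} [Ring B] [Algebra F B] (L : LoopAlg v n B)

/-- the normalized root vectors for the trivial decomposition off the block color. -/
def XX (i p : ℕ) (s : ℤ) : B := (v - v⁻¹) • L.EE (fun _ => 0) i s p

/-- the integral subalgebra generated by the blocks `≥ i`. -/
def PP (i : ℕ) : Subalgebra (RR v) B :=
  Algebra.adjoin (RR v) {z | ∃ i' p s, i ≤ i' ∧ i' ≤ n ∧ Vp n i' p ∧ z = L.XX i' p s}

/-- the filtered piece of `Σ 𝓔_q P'` spanned by positions `q < p`. -/
def QQ (i : ℕ) (p : ℕ) : Submodule (RR v) B :=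
  Submodule.span _ {z | ∃ q s y, Vp n i q ∧ q < p ∧ y ∈ L.PP (i + 1) ∧ z = L.XX i q s * y}

/-- the induction hypothesis for straightening block `i`. -/
structure Stable (i : ℕ) : Prop where
  pos : 1 ≤ i
  le : i ≤ n
  D_mem : ∀ j r x, i < j → j ≤ n → x ∈ L.PP (i + 1) → L.D j r x ∈ L.PP (i + 1)

lemma XX_mem {i i' p : ℕ} (s : ℤ) (h : i ≤ i') (h' : i' ≤ n) (hp : Vp n i' p) :
    L.XX i' p s ∈ L.PP i := Algebra.subset_adjoin ⟨i', p, s, h, h', hp, rfl⟩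

lemma PP_mono {i i' : ℕ} (h : i ≤ i') : L.PP i' ≤ L.PP i :=
  Algebra.adjoin_mono fun _ ⟨a, p, s, h1, h2, h3, h4⟩ => ⟨a, p, s, h.trans h1, h2, h3, h4⟩

lemma XX_zero (i : ℕ) (s : ℤ) : L.XX i 0 s = (v - v⁻¹) • L.e i s := by rw [XX, EE_zero]

lemma e_mem {i j : ℕ} (r : ℤ) (h : i ≤ j) (h' : j ≤ n) : (v - v⁻¹) • L.e j r ∈ L.PP i := by
  rw [← XX_zero]
  exact L.XX_mem r h h' (Or.inl rfl)

lemma XX_edge {i j p p' : ℕ} (hi : 1 ≤ i) (h : Edge n i j p p') (s : ℤ) :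
    L.D j 0 (L.XX i p s) = L.XX i p' s := by
  rw [XX, map_smul, L.EE_edge (fun _ => 0) i s hi h, XX]

lemma D_XX_eq_zero {i j p : ℕ} (hi : 1 ≤ i) (hp : Vp n i p) (hj : i < j) (hj' : j ≤ n)
    (h : ∀ p', ¬Edge n i j p p') (s : ℤ) : L.D j 0 (L.XX i p s) = 0 := by
  rw [XX, map_smul, L.EE_none (fun _ => 0) i s hi hp hj hj' h, smul_zero]

lemma D_D_XX_eq_zero {i j p : ℕ} (hi : 1 ≤ i) (hp : Vp n i p) (hj : i < j) (hj' : j ≤ n) (s : ℤ) :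
    L.D j 0 (L.D j 0 (L.XX i p s)) = 0 := by
  rw [XX, map_smul, map_smul, L.D_D_EE (fun _ => 0) i hi hp hj hj', smul_zero]

lemma τ_XX {i p : ℕ} (hi : 1 ≤ i) (hp : Vp n i p) (μ : ℕ → ℤ) :
    ∃ k : ℤ, ∀ s, L.τ μ (L.XX i p s) = v ^ k • L.XX i p s := by
  obtain ⟨k, hk⟩ := L.τ_EE (fun _ => 0) i hi μ p hp
  exact ⟨k, fun s => by rw [XX, map_smul, hk, smul_comm]⟩

lemma τ_PP {i : ℕ} (hi : 1 ≤ i) (μ : ℕ → ℤ) {x : B} (hx : x ∈ L.PP i) : L.τ μ x ∈ L.PP i := by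
  induction hx using Algebra.adjoin_induction with
  | mem x h =>
    obtain ⟨i', p, s, h1, h2, h3, rfl⟩ := h
    obtain ⟨k, hk⟩ := L.τ_XX (hi.trans h1) h3 μ
    rw [hk]
    exact smulP (zpow_mem_RR v k) (L.XX_mem s h1 h2 h3)
  | algebraMap r =>
    have : L.τ μ (algebraMap (RR v) B r) = algebraMap (RR v) B r :=
      (L.τ μ).commutes (r : F)
    rw [this]
    exact Subalgebra.algebraMap_mem _ _
  | add x y _ _ hx hy => rw [map_add]; exact add_mem hx hy
  | mul x y _ _ hx hy => rw [map_mul]; exact mul_mem hx hy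

lemma QQ_mono {i p p' : ℕ} (h : p ≤ p') : L.QQ i p ≤ L.QQ i p' :=
  Submodule.span_mono fun _ ⟨q, s, y, h1, h2, h3⟩ => ⟨q, s, y, h1, h2.trans_le h, h3⟩

lemma mem_QQ {i p q : ℕ} (s : ℤ) {y : B} (hq : Vp n i q) (h : q < p) (hy : y ∈ L.PP (i + 1)) :
    L.XX i q s * y ∈ L.QQ i p := Submodule.subset_span ⟨q, s, y, hq, h, hy, rfl⟩

lemma mem_QQ' {i p q : ℕ} (s : ℤ) (hq : Vp n i q) (h : q < p) : L.XX i q s ∈ L.QQ i p := by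
  simpa using L.mem_QQ s hq h (one_mem _)

lemma QQ_mul {i p : ℕ} {x y : B} (hx : x ∈ L.QQ i p) (hy : y ∈ L.PP (i + 1)) :
    x * y ∈ L.QQ i p := by
  induction hx using Submodule.span_induction with
  | mem x h =>
    obtain ⟨q, s, z, h1, h2, h3, rfl⟩ := h
    rw [mul_assoc]
    exact L.mem_QQ s h1 h2 (mul_mem h3 hy)
  | zero => rw [zero_mul]; exact zero_mem _
  | add a b _ _ ha hb => rw [add_mul]; exact add_mem ha hb
  | smul c a _ ha =>
    have : (c • a) * y = c • (a * y) := smul_mul_assoc _ _ _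
    rw [this]; exact Submodule.smul_mem _ _ ha

lemma QQ_le_PP {i p : ℕ} (hi : i ≤ n) : L.QQ i p ≤ Subalgebra.toSubmodule (L.PP i) := by
  rw [QQ, Submodule.span_le]
  rintro _ ⟨q, s, y, h1, h2, h3, rfl⟩
  exact (L.PP i).mul_mem (L.XX_mem s le_rfl hi h1) (L.PP_mono (Nat.le_succ i) h3)

lemma τ_QQ {i p : ℕ} (hi : 1 ≤ i) (μ : ℕ → ℤ) {x : B} (hx : x ∈ L.QQ i p) :
    L.τ μ x ∈ L.QQ i p := by
  induction hx using Submodule.span_induction with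
  | mem x h =>
    obtain ⟨q, s, z, h1, h2, h3, rfl⟩ := h
    obtain ⟨k, hk⟩ := L.τ_XX hi h1 μ
    rw [map_mul, hk, smul_mul_assoc]
    exact smulR (zpow_mem_RR v k) (L.mem_QQ s h1 h2 (L.τ_PP (by omega) μ h3))
  | zero => rw [map_zero]; exact zero_mem _
  | add a b _ _ ha hb => rw [map_add]; exact add_mem ha hb
  | smul c a _ ha =>
    have : L.τ μ (c • a) = c • L.τ μ a := map_smul (L.τ μ) (c : F) a
    rw [this]; exact Submodule.smul_mem _ _ ha

lemma D_QQ {i p p' : ℕ} (S : L.Stable i) {j : ℕ} {r : ℤ} (hj : i < j) (hj' : j ≤ n) (hp : p ≤ p')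
    (h : ∀ q s, Vp n i q → q < p → L.D j r (L.XX i q s) ∈ L.QQ i p') {x : B}
    (hx : x ∈ L.QQ i p) : L.D j r x ∈ L.QQ i p' := by
  induction hx using Submodule.span_induction with
  | mem x hx =>
    obtain ⟨q, s, z, h1, h2, h3, rfl⟩ := hx
    rw [L.D_mul]
    exact add_mem (L.mem_QQ s h1 (h2.trans_le hp) (S.D_mem j r z hj hj' h3))
      (L.QQ_mul (h q s h1 h2) (L.τ_PP (by omega) _ h3))
  | zero => rw [map_zero]; exact zero_mem _
  | add a b _ _ ha hb => rw [map_add]; exact add_mem ha hb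
  | smul c a _ ha =>
    have : L.D j r (c • a) = c • L.D j r a := map_smul (L.D j r) (c : F) a
    rw [this]; exact Submodule.smul_mem _ _ ha

/-- the shift property at position `p`. -/
def Shift (i p : ℕ) : Prop := ∀ j, i < j → j ≤ n → ∀ r s,
  Cong v (L.QQ i (p + 1)) (L.D j r (L.XX i p s)) (L.D j 0 (L.XX i p (s + r)))

lemma shift_zero {i : ℕ} (S : L.Stable i) : L.Shift i 0 := by
  intro j hj hj' r s
  have hi := S.pos
  have hv := L.v_ne
  have := cong_of_step hv (N := L.QQ i (0 + 1)) (fun r s => L.D j r (L.XX i 0 s))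
    (fun r s => ?_) r s r
  · rwa [sub_self] at this
  simp only [XX_zero, map_smul]
  by_cases h0 : aD n i j = 0
  · rw [L.D_e_eq_zero _ _ _ _ (by omega) hj' hi S.le h0,
      L.D_e_eq_zero _ _ _ _ (by omega) hj' hi S.le h0]
    exact Cong.refl _
  have h1 : aD n i j = -1 := by unfold aD at *; split_ifs at * <;> omega
  have h2 : aD n j i = -1 := by rw [aD_symm, h1]
  refine ⟨-1, ?_⟩
  have e : (v - v⁻¹) • L.D j (r + 1) (L.e i s) -
      v ^ (-1 : ℤ) • (v - v⁻¹) • L.D j r (L.e i (s + 1)) =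
      L.XX i 0 (s + 1) * ((v - v⁻¹) • L.e j r) := by
    have h := L.loop i j s r hi S.le (by omega) hj'
    simp only [L.D_apply, L.τ_e', XX_zero, h1, h2, zpow_neg_one, inv_inv] at h ⊢
    simp only [smul_mul_assoc, mul_smul_comm] at h ⊢
    linear_combination (norm := skip) (-v * (v - v⁻¹)) • h
    match_scalars <;> field_simp <;> ring
  rw [e]
  exact L.mem_QQ _ (Or.inl rfl) (by omega) (L.e_mem r (by omega) hj')

/-- consequence of the shift property below `q` for a derivation whose targets are bounded. -/
lemma D_QQ_of_shift {i q p : ℕ} (S : L.Stable i) (hsh : ∀ q' < q, Vp n i q' → L.Shift i q')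
    (hq : q ≤ p) {j : ℕ} {r : ℤ} (hj : i < j) (hj' : j ≤ n)
    (h : ∀ q' q'', Vp n i q' → q' < q → Edge n i j q' q'' → q'' < p) {x : B}
    (hx : x ∈ L.QQ i q) : L.D j r x ∈ L.QQ i p := by
  refine L.D_QQ S hj hj' hq (fun q' s h1 h2 => ?_) hx
  refine ((hsh q' h2 h1 j hj hj' r s).mono (L.QQ_mono (by omega))).mem ?_
  by_cases he : ∃ q'', Edge n i j q' q''
  · obtain ⟨q'', he⟩ := he
    rw [L.XX_edge S.pos he]
    refine L.mem_QQ' _ ?_ (h q' q'' h1 h2 he)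
    unfold Edge at he; unfold Vp at *; omega
  · push Not at he
    rw [L.D_XX_eq_zero S.pos h1 hj hj' he]
    exact zero_mem _

lemma shift_all {i : ℕ} (S : L.Stable i) : ∀ p, Vp n i p → L.Shift i p := by
  intro p
  induction p using Nat.strong_induction_on with
  | _ p ih =>
  intro hp
  by_cases h0 : p = 0
  · subst h0; exact L.shift_zero S
  obtain ⟨l, q, he, hq, hlt, hl, hl'⟩ := exists_edge i hp h0
  have hi := S.pos
  have hv := L.v_ne
  have hX : ∀ s, L.XX i p s = L.D l 0 (L.XX i q s) := fun s => (L.XX_edge hi he s).symm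
  have hsh : ∀ q' < q + 1, Vp n i q' → L.Shift i q' := fun q' h1 h2 => ih q' (by omega) h2
  have hDl : ∀ r x, x ∈ L.QQ i (q + 1) → L.D l r x ∈ L.QQ i (p + 1) := fun r x hx =>
    L.D_QQ_of_shift S hsh (by omega) hl hl' (fun q' q'' h1 h2 h3 => by
      unfold Edge at he h3; omega) hx
  have hqq : ∀ s, L.XX i q s ∈ L.QQ i (q + 1) := fun s => L.mem_QQ' s hq (by omega)
  have hkr : ∀ j, i < j → j ≤ n → ∀ r s,
      L.XX i q s * ((v - v⁻¹) • L.e j r) ∈ L.QQ i (q + 1) := fun j h1 h2 r s =>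
    L.mem_QQ s hq (by omega) (L.e_mem r (by omega) h2)
  have hDl1 : ∀ r s, Cong v (L.QQ i (q + 1)) (L.D l r (L.XX i q s)) (L.XX i p (s + r)) :=
    fun r s => by rw [hX]; exact hsh q (by omega) hq l hl hl' r s
  intro j hj hj' r s
  by_cases hjl : j ≠ l ∧ aD n j l = 0
  · rw [hX, hX, ← L.D_comm l j _ _ _ (by omega) hl' (by omega) hj' hjl.2,
      ← L.D_comm l j _ _ _ (by omega) hl' (by omega) hj' hjl.2]
    exact (hsh q (by omega) hq j hj hj' r s).map _ (hDl 0)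
  · have hshift : ∀ r s, Cong v (L.QQ i (p + 1)) (L.D j (r + 1) (L.XX i p s))
        (L.D j r (L.XX i p (s + 1))) := by
      clear r s
      by_cases hjl' : j = l
      · subst hjl'
        have hz : ∀ s, L.D j 0 (L.XX i p s) = 0 := fun s => by
          rw [hX, L.D_D_XX_eq_zero hi hq hl hl']
        have hone : ∀ s, L.D j 1 (L.XX i p s) ∈ L.QQ i (p + 1) := fun s => by
          have h := L.D_exchange j j 0 0 (L.XX i q s) (by omega) hl' (by omega) hl'
          have hc := (hDl1 1 s).map _ (hDl 0)
          rw [hz] at hc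
          have hc := hc.mem (zero_mem _)
          have hk := smulR (add_mem (v_mem v) (v_inv_mem v)) (hDl 1 _ (hkr j hl hl' 0 s))
          have e : L.D j 1 (L.XX i p s) = v ^ 2 • L.D j 0 (L.D j 1 (L.XX i q s)) -
              v ^ 2 • ((v + v⁻¹) • L.D j 1 (L.XX i q s * ((v - v⁻¹) • L.e j 0))) := by
            apply smul_right_injective B (two_ne_zero (α := F))
            simp only [zero_add, aD_self, zpow_ofNat] at h ⊢
            rw [hX, mul_smul_comm, map_smul]
            linear_combination (norm := skip) (-v ^ 2) • h
            match_scalars <;> field_simp <;> ring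
          rw [e]
          exact sub_mem (smulR (pow_mem (v_mem v) 2) hc) (smulR (pow_mem (v_mem v) 2) hk)
        intro r s
        have h := L.D_exchange j j 0 r (L.XX i q s) (by omega) hl' (by omega) hl'
        have hc := (hDl1 (r + 1) s).map _ (hDl 0)
        rw [hz] at hc
        have hc := hc.mem (zero_mem _)
        have hc1 := ((hDl1 r s).map _ (hDl 1)).mem (hone _)
        have hk1 := smulR (add_mem (v_mem v) (v_inv_mem v)) (hDl 1 _ (hkr j hl hl' r s))
        have hk2 := smulR (add_mem (v_mem v) (v_inv_mem v)) (hDl (r + 1) _ (hkr j hl hl' 0 s))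
        have c1 : Cong v (L.QQ i (p + 1)) (L.D j (r + 1) (L.XX i p s))
            (L.D j r (L.D j 1 (L.XX i q s))) := by
          refine ⟨2, ?_⟩
          have e : L.D j (r + 1) (L.XX i p s) - v ^ (2 : ℤ) • L.D j r (L.D j 1 (L.XX i q s)) =
              v ^ 2 • L.D j 0 (L.D j (r + 1) (L.XX i q s)) - L.D j 1 (L.D j r (L.XX i q s)) -
              v ^ 2 • ((v + v⁻¹) • L.D j 1 (L.XX i q s * ((v - v⁻¹) • L.e j r))) -
              v ^ 2 • ((v + v⁻¹) • L.D j (r + 1) (L.XX i q s * ((v - v⁻¹) • L.e j 0))) := by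
            simp only [zero_add, aD_self, zpow_ofNat] at h ⊢
            rw [hX, mul_smul_comm, mul_smul_comm, map_smul, map_smul]
            linear_combination (norm := skip) (-v ^ 2) • h
            match_scalars <;> field_simp <;> ring
          rw [e]
          have h2 := pow_mem (v_mem v) 2
          exact sub_mem (sub_mem (sub_mem (smulR h2 hc) hc1) (smulR h2 hk1)) (smulR h2 hk2)
        exact c1.trans hv ((hDl1 1 s).map _ (hDl r))
      · have ha : aD n j l = -1 := by
          have := fun h => hjl ⟨hjl', h⟩
          unfold aD at *; split_ifs at * <;> omega
        have hDj : ∀ r x, x ∈ L.QQ i (q + 1) → L.D j r x ∈ L.QQ i (p + 1) := fun r x hx =>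
          L.D_QQ_of_shift S hsh (by omega) hj hj' (fun q' q'' h1 h2 h3 => by
            have : (j + 1 = l ∧ l < n) ∨ (l + 1 = j ∧ j < n) ∨ (j + 2 = n ∧ l = n) ∨
                (l + 2 = n ∧ j = n) := by
              unfold aD at ha; split_ifs at ha <;> omega
            unfold Edge at he h3; omega) hx
        have hDq : ∀ r s, L.D j r (L.XX i q s) ∈ L.QQ i (q + 1) := fun r s => by
          refine (hsh q (by omega) hq j hj hj' r s).mem ?_
          rw [L.D_XX_eq_zero hi hq hj hj']
          · exact zero_mem _
          · intro p' he'
            have c1 := cw_of_source he'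
            have c2 := cw_edge hj hj' he
            rw [c1, aD_symm, ha] at c2
            rcases cw_cases n i j p with h | h | h <;> omega
        intro r s
        have h := L.D_exchange l j 0 r (L.XX i q s) (by omega) hl' (by omega) hj'
        have hc1 := hDl 0 _ (hDq (r + 1) s)
        have hc2 := hDl 1 _ (hDq r s)
        have hk1 := hDl 1 _ (hkr j hj hj' r s)
        have hk2 := hDj (r + 1) _ (hkr l hl hl' 0 s)
        have c1 : Cong v (L.QQ i (p + 1)) (L.D j (r + 1) (L.XX i p s))
            (L.D j r (L.D l 1 (L.XX i q s))) := by
          refine ⟨-1, ?_⟩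
          have e : L.D j (r + 1) (L.XX i p s) - v ^ (-1 : ℤ) • L.D j r (L.D l 1 (L.XX i q s)) =
              v⁻¹ • L.D l 0 (L.D j (r + 1) (L.XX i q s)) - L.D l 1 (L.D j r (L.XX i q s)) +
              v⁻¹ • L.D l 1 (L.XX i q s * ((v - v⁻¹) • L.e j r)) +
              v⁻¹ • L.D j (r + 1) (L.XX i q s * ((v - v⁻¹) • L.e l 0)) := by
            simp only [zero_add, ha, zpow_neg_one, inv_inv] at h ⊢
            rw [hX, mul_smul_comm, mul_smul_comm, map_smul, map_smul]
            linear_combination (norm := skip) (-v⁻¹) • h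
            match_scalars <;> field_simp <;> ring
          rw [e]
          have h2 := v_inv_mem v
          exact add_mem (add_mem (sub_mem (smulR h2 hc1) hc2) (smulR h2 hk1)) (smulR h2 hk2)
        exact c1.trans hv ((hDl1 1 s).map _ (hDj r))
    have := cong_of_step hv (N := L.QQ i (p + 1)) (fun r s => L.D j r (L.XX i p s)) hshift r s r
    rwa [sub_self] at this

end LoopAlg

namespace LoopAlg
variable {F : Type} [Field F] [CharZero F] {v : F}
variable {n : ℕ} {B : Type} [Ring B] [Algebra F B] (L : LoopAlg v n B)

lemma Edge_lt {n i j p p' : ℕ} (h : Edge n i j p p') : p < p' ∧ i < j ∧ j ≤ n ∧ i + 2 ≤ n := by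
  unfold Edge at h; omega

/-- the left span of block `i` with coefficients on the right in the later blocks. -/
abbrev Q (i : ℕ) : Submodule (RR v) B := L.QQ i (2 * n)

lemma D_Q {i : ℕ} (S : L.Stable i) {j : ℕ} {r : ℤ} (hj : i < j) (hj' : j ≤ n) {x : B}
    (hx : x ∈ L.Q i) : L.D j r x ∈ L.Q i :=
  L.D_QQ_of_shift S (fun q _ h => L.shift_all S q h) le_rfl hj hj'
    (fun q' q'' _ _ h3 => by have := S.pos; unfold Edge at h3; omega) hx

/-- the weight shift attached to a word. -/
def Mw (n : ℕ) (w : List ℕ) (c : ℕ) : ℤ := (w.map fun d => M n d c).sum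

lemma DD_D' {g : B} {μ : ℕ → ℤ} {j : ℕ} (hg : L.τ (M n j) g = v • g) (hμ : v ^ μ j = v) (x : B) :
    L.DD (L.D j 0 g) (μ + M n j) x = L.D j 0 (L.DD g μ x) - v⁻¹ • L.DD g μ (L.D j 0 x) -
      L.D j 0 x * ((v - v⁻¹) • g) := by
  have hv := L.v_ne
  simp only [DD_apply, D_apply, map_sub, map_mul, L.τ_e, hμ, hg, L.τ_add,
    L.τ_comm (M n j) μ]
  simp only [sub_mul, mul_sub, mul_smul_comm, smul_mul_assoc, mul_assoc]
  match_scalars <;> field_simp <;> ring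

lemma exists_word {i : ℕ} (hi : 1 ≤ i) (hin : i ≤ n) (N : Submodule (RR v) B)
    (hD : ∀ j r x, i ≤ j → j ≤ n → x ∈ N → L.D j r x ∈ N)
    (hmul : ∀ x y, x ∈ N → y ∈ L.PP i → x * y ∈ N) :
    ∀ p, Vp n i p → ∃ w : List ℕ, (∀ d ∈ w, i ≤ d ∧ d ≤ n) ∧
      (∀ ν s, L.τ ν (L.EE (fun _ => 0) i s p) =
        v ^ (w.map ν).sum • L.EE (fun _ => 0) i s p) ∧
      ∀ s x, x ∈ N → L.DD (L.EE (fun _ => 0) i s p) (Mw n w) x ∈ N := by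
  intro p
  induction p using Nat.strong_induction_on with
  | _ p ih =>
  intro hp
  by_cases h0 : p = 0
  · subst h0
    refine ⟨[i], by simpa using hin, fun ν s => ?_, fun s x hx => ?_⟩
    · rw [EE_zero, L.τ_e]; simp
    · have : Mw n [i] = M n i := by ext c; simp [Mw]
      rw [EE_zero, this]
      exact hD i s x le_rfl hin hx
  obtain ⟨j, q, he, hq, hlt, hj, hj'⟩ := exists_edge i hp h0
  obtain ⟨w, h1, h2, h3⟩ := ih q hlt hq
  have hE : ∀ s, L.EE (fun _ => 0) i s p = L.D j 0 (L.EE (fun _ => 0) i s q) := fun s =>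
    (L.EE_edge (fun _ => 0) i s hi he).symm
  have hτ : ∀ s, L.τ (M n j) (L.EE (fun _ => 0) i s q) = v • L.EE (fun _ => 0) i s q := fun s => by
    rw [L.τ_EE_cw _ i hi hj hj' he.1 q hq, cw_of_source he, zpow_one]
  refine ⟨w ++ [j], ?_, fun ν s => ?_, fun s x hx => ?_⟩
  · intro d hd
    rcases List.mem_append.1 hd with h | h
    · exact h1 d h
    · rw [List.mem_singleton] at h; subst h; exact ⟨hj.le, hj'⟩
  · rw [hE, L.τ_D, h2, map_smul, smul_smul, ← zpow_add₀ L.v_ne, List.map_append, List.sum_append]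
    simp [add_comm]
  · by_cases hz : L.EE (fun _ => 0) i s p = 0
    · rw [hz, DD_apply]; simp
    have hne : L.EE (fun _ => 0) i s q ≠ 0 := fun h => hz (by rw [hE, h, map_zero])
    have hμ : v ^ Mw n w j = v := by
      have e1 := h2 (M n j) s
      rw [hτ] at e1
      have e2 : (v - v ^ (w.map (M n j)).sum) • L.EE (fun _ => 0) i s q = 0 := by
        rw [sub_smul, e1, sub_self]
      have e3 := (smul_eq_zero.1 e2).resolve_right hne
      have e4 : Mw n w j = (w.map (M n j)).sum := by
        unfold Mw; congr 1; apply List.map_congr_left; intro d _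
        simp [M, aD_symm n j d]
      rw [e4, ← sub_eq_zero.1 e3]
    have hM : L.τ (Mw n (w ++ [j])) = L.τ (Mw n w + M n j) := by
      congr 1; ext c; simp [Mw]
    have e := L.DD_D' (hτ s) hμ x
    rw [hE]
    have e' : L.DD (L.D j 0 (L.EE (fun _ => 0) i s q)) (Mw n (w ++ [j])) x =
      L.DD (L.D j 0 (L.EE (fun _ => 0) i s q)) (Mw n w + M n j) x := by
      rw [DD_apply, DD_apply, hM]
    rw [e', e]
    refine sub_mem (sub_mem (hD j 0 _ hj.le hj' (h3 s x hx))
      (smulR (v_inv_mem v) (h3 s _ (hD j 0 _ hj.le hj' hx)))) ?_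
    exact hmul _ _ (hD j 0 _ hj.le hj' hx) (L.XX_mem s le_rfl hin hq)

end LoopAlg

namespace LoopAlg
variable {F : Type} [Field F] [CharZero F] {v : F}
variable {n : ℕ} {B : Type} [Ring B] [Algebra F B] (L : LoopAlg v n B)

lemma exists_word_Q {i i' : ℕ} (S : L.Stable i) (hi : i < i') (hin : i' ≤ n) {p : ℕ}
    (hp : Vp n i' p) : ∃ w : List ℕ, (∀ d ∈ w, i' ≤ d ∧ d ≤ n) ∧
      (∀ ν s, L.τ ν (L.EE (fun _ => 0) i' s p) =
        v ^ (w.map ν).sum • L.EE (fun _ => 0) i' s p) ∧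
      ∀ s x, x ∈ L.Q i → L.DD (L.EE (fun _ => 0) i' s p) (Mw n w) x ∈ L.Q i :=
  L.exists_word (by omega) hin (L.Q i) (fun j r x h1 h2 h3 => L.D_Q S (by omega) h2 h3)
    (fun x y hx hy => L.QQ_mul hx (L.PP_mono (by omega) hy)) p hp

lemma PP_mul_Q {i : ℕ} (S : L.Stable i) {y : B} (hy : y ∈ L.PP (i + 1)) :
    ∀ x ∈ L.Q i, y * x ∈ L.Q i := by
  induction hy using Algebra.adjoin_induction with
  | mem y h =>
    obtain ⟨i', p, s, h1, h2, h3, rfl⟩ := h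
    obtain ⟨w, -, -, hw⟩ := L.exists_word_Q S (by omega) h2 h3
    intro x hx
    have hz := L.τ_QQ S.pos (-Mw n w) hx
    have e : L.τ (Mw n w) (L.τ (-Mw n w) x) = x := by
      rw [← L.τ_add, add_neg_cancel, L.τ_zero]
    have e2 : L.XX i' p s * x = L.τ (-Mw n w) x * L.XX i' p s -
        (v - v⁻¹) • L.DD (L.EE (fun _ => 0) i' s p) (Mw n w) (L.τ (-Mw n w) x) := by
      rw [DD_apply, e, XX, smul_mul_assoc, mul_smul_comm, smul_sub]; abel
    rw [e2]
    exact sub_mem (L.QQ_mul hz (L.XX_mem s h1 h2 h3)) (smulR (kap_mem_RR v) (hw s _ hz))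
  | algebraMap r =>
    intro x hx
    rw [← Algebra.smul_def]
    exact Submodule.smul_mem _ _ hx
  | add a b _ _ ha hb => intro x hx; rw [add_mul]; exact add_mem (ha x hx) (hb x hx)
  | mul a b _ _ ha hb => intro x hx; rw [mul_assoc]; exact ha _ (hb x hx)

/-- products whose leading block position is smaller than `b`. -/
def FQ (i b : ℕ) : Submodule (RR v) B :=
  Submodule.span _ {z | ∃ c s y, Vp n i c ∧ c < b ∧ y ∈ L.Q i ∧ z = L.XX i c s * y}

lemma FQ_mono {i p p' : ℕ} (h : p ≤ p') : L.FQ i p ≤ L.FQ i p' :=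
  Submodule.span_mono fun _ ⟨q, s, y, h1, h2, h3⟩ => ⟨q, s, y, h1, h2.trans_le h, h3⟩

lemma mem_FQ {i b c : ℕ} (s : ℤ) {y : B} (hc : Vp n i c) (h : c < b) (hy : y ∈ L.Q i) :
    L.XX i c s * y ∈ L.FQ i b := Submodule.subset_span ⟨c, s, y, hc, h, hy, rfl⟩

lemma FQ_mul {i b : ℕ} {x y : B} (hx : x ∈ L.FQ i b) (hy : y ∈ L.PP (i + 1)) :
    x * y ∈ L.FQ i b := by
  induction hx using Submodule.span_induction with
  | mem x h =>
    obtain ⟨q, s, z, h1, h2, h3, rfl⟩ := h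
    rw [mul_assoc]
    exact L.mem_FQ s h1 h2 (L.QQ_mul h3 hy)
  | zero => rw [zero_mul]; exact zero_mem _
  | add a b _ _ ha hb => rw [add_mul]; exact add_mem ha hb
  | smul c a _ ha =>
    have : (c • a) * y = c • (a * y) := smul_mul_assoc _ _ _
    rw [this]; exact Submodule.smul_mem _ _ ha

lemma Vp_lt {n i p : ℕ} (hi : 1 ≤ i) (hin : i ≤ n) (hp : Vp n i p) : p < 2 * n := by
  unfold Vp at hp; omega

lemma XX_mem_Q {i p : ℕ} (hi : 1 ≤ i) (hin : i ≤ n) (hp : Vp n i p) (s : ℤ) :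
    L.XX i p s ∈ L.Q i := L.mem_QQ' s hp (Vp_lt hi hin hp)

lemma QQ_mul_Q {i b : ℕ} (S : L.Stable i) {x y : B} (hx : x ∈ L.QQ i b) (hy : y ∈ L.Q i) :
    x * y ∈ L.FQ i b := by
  induction hx using Submodule.span_induction with
  | mem x h =>
    obtain ⟨q, s, z, h1, h2, h3, rfl⟩ := h
    rw [mul_assoc]
    exact L.mem_FQ s h1 h2 (L.PP_mul_Q S h3 y hy)
  | zero => rw [zero_mul]; exact zero_mem _
  | add a b _ _ ha hb => rw [add_mul]; exact add_mem ha hb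
  | smul c a _ ha =>
    have : (c • a) * y = c • (a * y) := smul_mul_assoc _ _ _
    rw [this]; exact Submodule.smul_mem _ _ ha

lemma sp_EE_FQ {i a b c : ℕ} (hi : 1 ≤ i) (hin : i ≤ n) (ha : Vp n i a) (hb : Vp n i b)
    (hac : a < c) {z : B}
    (hz : z ∈ sp v (fun s => L.EE (fun _ => 0) i s a) (fun s => L.EE (fun _ => 0) i s b)) :
    (v - v⁻¹) • (v - v⁻¹) • z ∈ L.FQ i c := by
  induction hz using Submodule.span_induction with
  | mem z h =>
    obtain ⟨⟨s, r⟩, rfl⟩ := h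
    have := L.mem_FQ s ha hac (L.XX_mem_Q hi hin hb r)
    simpa only [XX, smul_mul_assoc, mul_smul_comm] using this
  | zero => simp
  | add a b _ _ ha hb => rw [smul_add, smul_add]; exact add_mem ha hb
  | smul c a _ ha =>
    have : (v - v⁻¹) • (v - v⁻¹) • c • a = c • (v - v⁻¹) • (v - v⁻¹) • a := by
      change (v - v⁻¹) • (v - v⁻¹) • (c : F) • a = (c : F) • (v - v⁻¹) • (v - v⁻¹) • a
      rw [smul_comm, smul_comm (v - v⁻¹) (c : F) a, smul_comm (v - v⁻¹) (c : F)]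
    rw [this]; exact Submodule.smul_mem _ _ ha

lemma XX_mul_nondual {i a b : ℕ} (hi : 1 ≤ i) (hin : i ≤ n) (ha : Vp n i a) (hb : Vp n i b)
    (hab : a < b) (hd : a + b + 1 + 2 * i ≠ 2 * n) (s r : ℤ) :
    L.XX i b s * L.XX i a r ∈ L.FQ i b := by
  have hi2 : i + 2 ≤ n := by unfold Vp at hb; omega
  have h := (L.Rp_EE (fun _ => 0) i hi hi2 _ a b rfl hab ha hb hd).mul_mem L.v_ne s r
  have := L.sp_EE_FQ hi hin ha hb hab h
  simpa only [XX, smul_mul_assoc, mul_smul_comm] using this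

lemma XX_mul_QQ_of_nondual {i b c : ℕ} (hi : 1 ≤ i) (hin : i ≤ n) (hb : Vp n i b)
    (hd : c + b + 2 * i < 2 * n) (hcb : c ≤ b) (s : ℤ) {x : B} (hx : x ∈ L.QQ i c) :
    L.XX i b s * x ∈ L.FQ i b := by
  induction hx using Submodule.span_induction with
  | mem x h =>
    obtain ⟨q, r, z, h1, h2, h3, rfl⟩ := h
    rw [← mul_assoc]
    exact L.FQ_mul (L.XX_mul_nondual hi hin h1 hb (by omega) (by omega) s r) h3
  | zero => rw [mul_zero]; exact zero_mem _
  | add a b _ _ ha hb => rw [mul_add]; exact add_mem ha hb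
  | smul c a _ ha =>
    have (y : B) : y * (c • a) = c • (y * a) := mul_smul_comm _ _ _
    rw [this]; exact Submodule.smul_mem _ _ ha

end LoopAlg

namespace LoopAlg
variable {F : Type} [Field F] [CharZero F] {v : F}
variable {n : ℕ} {B : Type} [Ring B] [Algebra F B] (L : LoopAlg v n B)

lemma lo_congr {t t' : ℕ → ℤ} {i : ℕ} (s : ℤ) : ∀ p, (∀ c, c ≤ i + p → t c = t' c) →
    L.lo t i s p = L.lo t' i s p
  | 0, _ => rfl
  | p + 1, h => by
    rw [lo, lo, lo_congr s p fun c hc => h c (by omega), h _ (by omega)]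

/-- the middle pair of a block commutes for arbitrary shifts on the color `n - 1`. -/
lemma mid_comm {i : ℕ} (hi : 1 ≤ i) (hi2 : i + 2 ≤ n) (s p : ℤ) :
    L.D (n - 1) p (L.EE (fun _ => 0) i s (n - i - 2)) * L.EE (fun _ => 0) i s (n - i) =
      L.EE (fun _ => 0) i s (n - i) * L.D (n - 1) p (L.EE (fun _ => 0) i s (n - i - 2)) := by
  have hv := L.v_ne
  set t : ℕ → ℤ := fun c => if c = n - 1 then p else 0 with ht
  have hz : L.EE (fun _ => 0) i s (n - i - 2) = L.EE t i s (n - i - 2) := by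
    have h : n - i - 2 < n - i ∨ n - i - 2 = 0 := by omega
    rw [EE, EE, if_pos h, if_pos h]
    exact L.lo_congr s _ fun c hc => by simp [ht]; omega
  have eB : Edge n i n (n - i - 2) (n - i) := by unfold Edge; omega
  have eA : Edge n i (n - 1) (n - i - 2) (n - i - 1) := by unfold Edge; omega
  have tn : t n = 0 := by simp [ht]; omega
  have tn1 : t (n - 1) = p := by simp [ht]
  have hB : L.EE (fun _ => 0) i s (n - i) = L.EE t i s (n - i) := by
    rw [← L.EE_edge (fun _ => 0) i s hi eB, ← L.EE_edge t i s hi eB, hz, tn]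
  have hA : L.D (n - 1) p (L.EE t i s (n - i - 2)) = L.EE t i s (n - i - 1) := by
    rw [← L.EE_edge t i s hi eA, tn1]
  rw [hz, hB, hA]
  have V0 : Vp n i (n - i - 2) := by unfold Vp; omega
  have V1 : Vp n i (n - i - 1) := by unfold Vp; omega
  have V2 : Vp n i (n - i) := by unfold Vp; omega
  have hAz := (L.Rp_EE t i hi hi2 _ (n - i - 2) (n - i - 1) rfl (by omega) V0 V1 (by omega)).FF_self s
  have hBz := (L.Rp_EE t i hi hi2 _ (n - i - 2) (n - i) rfl (by omega) V0 V2 (by omega)).FF_self s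
  have dBz : L.D n 0 (L.EE t i s (n - i - 2)) = L.EE t i s (n - i) := by
    rw [← L.EE_edge t i s hi eB, tn]
  have dCA : L.D n 0 (L.EE t i s (n - i - 1)) = L.D (n - 1) p (L.EE t i s (n - i)) := by
    rw [← hA, ← dBz]
    apply L.D_comm <;> first | omega | (apply aD_eq_zero <;> omega)
  have dB : L.D n 0 (L.EE t i s (n - i)) = 0 := by
    have := L.D_EE_of_cw t i hi V2 (l := n) (by omega) le_rfl (by unfold cw; split_ifs <;> omega) s
    rwa [tn] at this
  have dA : L.D (n - 1) p (L.EE t i s (n - i - 1)) = 0 := by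
    have := L.D_EE_of_cw t i hi V1 (l := n - 1) (by omega) (by omega)
      (by unfold cw; split_ifs <;> omega) s
    rwa [tn1] at this
  have τnz := L.τ_EE_cw t i hi (l := n) (by omega) le_rfl hi2 _ V0 s
  have τnA := L.τ_EE_cw t i hi (l := n) (by omega) le_rfl hi2 _ V1 s
  have τmz := L.τ_EE_cw t i hi (l := n - 1) (by omega) (by omega) hi2 _ V0 s
  have τmB := L.τ_EE_cw t i hi (l := n - 1) (by omega) (by omega) hi2 _ V2 s
  rw [show cw n i n (n - i - 2) = 1 by unfold cw; split_ifs <;> omega, zpow_one] at τnz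
  rw [show cw n i n (n - i - 1) = 1 by unfold cw; split_ifs <;> omega, zpow_one] at τnA
  rw [show cw n i (n - 1) (n - i - 2) = 1 by unfold cw; split_ifs <;> omega, zpow_one] at τmz
  rw [show cw n i (n - 1) (n - i) = 1 by unfold cw; split_ifs <;> omega, zpow_one] at τmB
  have h1 := congrArg (L.D n 0) hAz
  have h2 := congrArg (L.D (n - 1) p) hBz
  simp only [map_smul, L.D_mul, dBz, dCA, hA, τnz, τnA, τmz, τmB] at h1 h2
  generalize L.EE t i s (n - i - 1) = a at *
  generalize L.EE t i s (n - i) = b at *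
  generalize L.EE t i s (n - i - 2) = z at *
  have h3 : (1 + v ^ 2) • (a * b - b * a) = 0 := by
    linear_combination (norm := skip) h1 - h2
    simp only [mul_smul_comm, zero_add]
    match_scalars <;> field_simp <;> ring
  have h4 := (smul_eq_zero.1 h3).resolve_left (by rw [add_comm]; exact L.v_add)
  exact sub_eq_zero.1 h4

/-- the commutator of two root vectors of the same block. -/
def KM (i a b : ℕ) (s r : ℤ) : B := L.EE (fun _ => 0) i s b * L.EE (fun _ => 0) i r a -
  L.EE (fun _ => 0) i r a * L.EE (fun _ => 0) i s b

lemma mid_decomp {i : ℕ} (S : L.Stable i) (hi2 : i + 2 ≤ n) (s r : ℤ) : ∃ k : ℤ, ∃ q ∈ L.QQ i (n - i - 1),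
    L.XX i (n - i) s * (v ^ k • L.XX i (n - i - 1) r + q) =
      (v ^ k • L.XX i (n - i - 1) r + q) * L.XX i (n - i) s ∧
    ∀ μ : ℕ → ℤ, ∀ c : ℤ, (∀ r, L.τ μ (L.XX i (n - i - 2) r) = v ^ c • L.XX i (n - i - 2) r) →
      L.τ μ q = v ^ (c + μ (n - 1)) • q := by
  have hi := S.pos
  have V0 : Vp n i (n - i - 2) := by unfold Vp; omega
  have eA : Edge n i (n - 1) (n - i - 2) (n - i - 1) := by unfold Edge; omega
  obtain ⟨k, hk⟩ := L.shift_all S _ V0 (n - 1) (by omega) (by omega) (r - s) s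
  rw [L.XX_edge hi eA, show s + (r - s) = r by ring,
    show n - i - 2 + 1 = n - i - 1 by omega] at hk
  refine ⟨k, _, hk, ?_, fun μ c hc => ?_⟩
  · have h := L.mid_comm hi hi2 s (r - s)
    rw [add_sub_cancel]
    simp only [XX, map_smul, smul_mul_assoc, mul_smul_comm]
    rw [h]
  · rw [← L.XX_edge hi eA, map_sub, map_smul, L.τ_D, L.τ_D, hc, hc, map_smul, map_smul,
      zpow_add₀ L.v_ne]
    module

lemma KM_smul (i a b : ℕ) (s r : ℤ) : (v - v⁻¹) • (v - v⁻¹) • L.KM i a b s r =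
    L.XX i b s * L.XX i a r - L.XX i a r * L.XX i b s := by
  simp only [KM, XX, smul_mul_assoc, mul_smul_comm, smul_sub]

lemma KM_mid_FQ {i : ℕ} (S : L.Stable i) (hi2 : i + 2 ≤ n) (s r : ℤ) :
    (v - v⁻¹) • (v - v⁻¹) • L.KM i (n - i - 1) (n - i) s r ∈ L.FQ i (n - i) := by
  have hi := S.pos
  obtain ⟨k, q, hq, hc, -⟩ := L.mid_decomp S hi2 s r
  have V2 : Vp n i (n - i) := by unfold Vp; omega
  have e : (v - v⁻¹) • (v - v⁻¹) • L.KM i (n - i - 1) (n - i) s r =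
      v ^ (-k) • (q * L.XX i (n - i) s - L.XX i (n - i) s * q) := by
    have : L.XX i (n - i) s * q - q * L.XX i (n - i) s = v ^ k • (L.XX i (n - i - 1) r *
        L.XX i (n - i) s - L.XX i (n - i) s * L.XX i (n - i - 1) r) := by
      simp only [mul_add, add_mul, mul_smul_comm, smul_mul_assoc] at hc
      rw [smul_sub, sub_eq_sub_iff_add_eq_add, add_comm, hc, add_comm]
    rw [← neg_sub (L.XX i (n - i) s * q), this, KM_smul, smul_neg, smul_smul,
      ← zpow_add₀ L.v_ne, neg_add_cancel, zpow_zero, one_smul, neg_sub]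
  rw [e]
  refine smulR (zpow_mem_RR v _) (sub_mem ?_ ?_)
  · exact L.FQ_mono (by omega) (L.QQ_mul_Q S hq (L.XX_mem_Q hi S.le V2 s))
  · exact L.XX_mul_QQ_of_nondual hi S.le V2 (by omega) (by omega) s hq

/-- the weight pairing with the middle root of a block, off the block color. -/
def midW (n i c : ℕ) : ℤ := if c = i then 1 else if c = n then 1 else if c = n - 1 then -1 else 0

lemma τ_midW {i : ℕ} (hi : 1 ≤ i) (hi2 : i + 2 ≤ n) : ∀ c, c + 2 ≤ n - i → ∀ s,
    L.τ (midW n i) (L.XX i c s) = v ^ (1 : ℤ) • L.XX i c s := by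
  intro c
  induction c with
  | zero => intro _ s; rw [XX_zero, map_smul, L.τ_e, smul_comm]; simp [midW]
  | succ c ih =>
    intro h s
    have he : Edge n i (i + c + 1) c (c + 1) := by unfold Edge; omega
    rw [← L.XX_edge hi he, L.τ_D, ih (by omega), map_smul,
      show midW n i (i + c + 1) = 0 by unfold midW; split_ifs <;> omega, zpow_zero, one_smul]

lemma theta_mem {i : ℕ} (S : L.Stable i) (hi2 : i + 2 ≤ n) (s : ℤ) {y : B}
    (hy : y ∈ L.PP (i + 1)) :
    L.EE (fun _ => 0) i s (n - i) * y - L.τ (midW n i) y * L.EE (fun _ => 0) i s (n - i) ∈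
      L.PP i := by
  have hi := S.pos
  have V2 : Vp n i (n - i) := by unfold Vp; omega
  induction hy using Algebra.adjoin_induction with
  | mem y h =>
    obtain ⟨i', p, r, h1, h2, h3, rfl⟩ := h
    obtain ⟨w, w1, w2, w3⟩ := L.exists_word_Q S (by omega) h2 h3
    have hD := L.QQ_le_PP S.le (w3 r _ (L.XX_mem_Q hi S.le V2 s))
    have hw : (w.map (midW n i)).sum = -(w.map fun d => cw n i d (n - i)).sum := by
      clear hD w3 w2
      induction w with
      | nil => simp
      | cons d w ih =>
        have hd := w1 d (by simp)
        have : midW n i d = -cw n i d (n - i) := by unfold midW cw; split_ifs <;> omega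
        rw [List.map_cons, List.sum_cons, List.map_cons, List.sum_cons,
          ih fun d hd => w1 d (by simp [hd]), this, neg_add]
    have hτ : L.τ (Mw n w) (L.EE (fun _ => 0) i s (n - i)) =
        v ^ (w.map fun d => cw n i d (n - i)).sum • L.EE (fun _ => 0) i s (n - i) := by
      clear hD w3 w2 hw
      induction w with
      | nil =>
        have : Mw n [] = 0 := by ext c; simp [Mw]
        rw [this, L.τ_zero]; simp
      | cons d w ih =>
        have : Mw n (d :: w) = M n d + Mw n w := by ext c; simp [Mw]
        have hd := w1 d (by simp)
        rw [this, L.τ_add, ih fun d hd => w1 d (by simp [hd]), map_smul,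
          L.τ_EE_cw _ i hi (by omega) hd.2 hi2 _ V2, smul_smul, ← zpow_add₀ L.v_ne]
        simp [add_comm]
    obtain ⟨c, hc, hc'⟩ := zpow_sub_zpow_neg_mem v L.v_ne (w.map fun d => cw n i d (n - i)).sum
    have e : L.EE (fun _ => 0) i s (n - i) * L.XX i' p r -
        L.τ (midW n i) (L.XX i' p r) * L.EE (fun _ => 0) i s (n - i) =
        L.DD (L.EE (fun _ => 0) i' r p) (Mw n w) (L.XX i (n - i) s) +
        c • (L.XX i' p r * L.XX i (n - i) s) := by
      rw [DD_apply]
      simp only [XX, map_smul, w2, hτ, hw, smul_mul_assoc, mul_smul_comm]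
      generalize (w.map fun d => cw n i d (n - i)).sum = k at *
      linear_combination (norm := skip) (v - v⁻¹) • congrArg (fun c : F => c •
        (L.EE (fun _ => 0) i' r p * L.EE (fun _ => 0) i s (n - i))) hc'
      simp only [sub_smul, mul_smul]
      module
    rw [e]
    exact add_mem hD (smulP hc (mul_mem (L.XX_mem r (by omega) h2 h3) (L.XX_mem s le_rfl S.le V2)))
  | algebraMap r =>
    have : L.τ (midW n i) (algebraMap (RR v) B r) = algebraMap (RR v) B r :=
      (L.τ _).commutes (r : F)
    rw [this, Algebra.commutes, sub_self]
    exact zero_mem _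
  | add x y _ _ hx hy =>
    rw [map_add, mul_add, add_mul, add_sub_add_comm]; exact add_mem hx hy
  | mul x y hx' hy' hx hy =>
    have e : L.EE (fun _ => 0) i s (n - i) * (x * y) -
        L.τ (midW n i) (x * y) * L.EE (fun _ => 0) i s (n - i) =
        (L.EE (fun _ => 0) i s (n - i) * x - L.τ (midW n i) x * L.EE (fun _ => 0) i s (n - i)) * y +
        L.τ (midW n i) x *
        (L.EE (fun _ => 0) i s (n - i) * y - L.τ (midW n i) y * L.EE (fun _ => 0) i s (n - i)) := by
      rw [map_mul]; noncomm_ring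
    rw [e]
    exact add_mem (mul_mem hx (L.PP_mono (Nat.le_succ i) hy'))
      (mul_mem (L.τ_PP hi _ (L.PP_mono (Nat.le_succ i) hx')) hy)

lemma sp_EE_PP {i a b : ℕ} (hin : i ≤ n) (ha : Vp n i a) (hb : Vp n i b) {z : B}
    (hz : z ∈ sp v (fun s => L.EE (fun _ => 0) i s a) (fun s => L.EE (fun _ => 0) i s b)) :
    (v - v⁻¹) • (v - v⁻¹) • z ∈ L.PP i := by
  induction hz using Submodule.span_induction with
  | mem z h =>
    obtain ⟨⟨s, r⟩, rfl⟩ := h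
    have := mul_mem (L.XX_mem s le_rfl hin ha) (L.XX_mem r le_rfl hin hb)
    simpa only [XX, smul_mul_assoc, mul_smul_comm] using this
  | zero => simp
  | add a b _ _ ha hb => rw [smul_add, smul_add]; exact add_mem ha hb
  | smul c a _ ha =>
    have : (v - v⁻¹) • (v - v⁻¹) • c • a = c • (v - v⁻¹) • (v - v⁻¹) • a := by
      change (v - v⁻¹) • (v - v⁻¹) • (c : F) • a = (c : F) • (v - v⁻¹) • (v - v⁻¹) • a
      rw [smul_comm, smul_comm (v - v⁻¹) (c : F) a, smul_comm (v - v⁻¹) (c : F)]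
    rw [this]; exact Subalgebra.smul_mem _ ha _

lemma theta_QQ {i : ℕ} (S : L.Stable i) (hi2 : i + 2 ≤ n) (s : ℤ) {x : B}
    (hx : x ∈ L.QQ i (n - i - 1)) :
    L.EE (fun _ => 0) i s (n - i) * x - L.τ (midW n i) x * L.EE (fun _ => 0) i s (n - i) ∈
      L.PP i := by
  have hi := S.pos
  have V2 : Vp n i (n - i) := by unfold Vp; omega
  induction hx using Submodule.span_induction with
  | mem x h =>
    obtain ⟨c, r, y, h1, h2, h3, rfl⟩ := h
    have hF : (v - v⁻¹) • FF v (fun s => L.EE (fun _ => 0) i s c)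
        (fun s => L.EE (fun _ => 0) i s (n - i)) s r ∈ L.PP i := by
      obtain ⟨z, hz, e⟩ := (L.Rp_EE (fun _ => 0) i hi hi2 _ c (n - i) rfl (by omega) h1 V2
        (by omega)).FF_mem L.v_ne s r
      rw [e]
      exact L.sp_EE_PP S.le h1 V2 hz
    have e : L.EE (fun _ => 0) i s (n - i) * (L.XX i c r * y) -
        L.τ (midW n i) (L.XX i c r * y) * L.EE (fun _ => 0) i s (n - i) =
        ((v - v⁻¹) • FF v (fun s => L.EE (fun _ => 0) i s c)
          (fun s => L.EE (fun _ => 0) i s (n - i)) s r) * y +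
        v • (L.XX i c r *
        (L.EE (fun _ => 0) i s (n - i) * y - L.τ (midW n i) y * L.EE (fun _ => 0) i s (n - i))) := by
      rw [map_mul, L.τ_midW hi hi2 c (by omega), FF]
      simp only [XX, smul_mul_assoc, mul_smul_comm, mul_sub, sub_mul, zpow_one, mul_assoc]
      module
    rw [e]
    exact add_mem (mul_mem hF (L.PP_mono (Nat.le_succ i) h3))
      (smulP (v_mem v) (mul_mem (L.XX_mem r le_rfl S.le h1) (L.theta_mem S hi2 s h3)))
  | zero => simp
  | add x y _ _ hx hy =>
    rw [map_add, mul_add, add_mul, add_sub_add_comm]; exact add_mem hx hy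
  | smul c a _ ha =>
    have e1 : L.τ (midW n i) (c • a) = c • L.τ (midW n i) a := map_smul (L.τ _) (c : F) a
    have e2 (y : B) : y * (c • a) = c • (y * a) := mul_smul_comm _ _ _
    have e3 (x y : B) : (c • x) * y = c • (x * y) := smul_mul_assoc _ _ _
    rw [e1, e2, e3, ← smul_sub]
    exact Subalgebra.smul_mem _ ha _

lemma KM_mid_PP {i : ℕ} (S : L.Stable i) (hi2 : i + 2 ≤ n) (s r : ℤ) :
    (v - v⁻¹) • L.KM i (n - i - 1) (n - i) s r ∈ L.PP i := by
  have hi := S.pos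
  obtain ⟨k, q, hq, hc, hτ⟩ := L.mid_decomp S hi2 s r
  have hq' := hτ (midW n i) 1 (L.τ_midW hi hi2 _ (by omega))
  rw [show midW n i (n - 1) = -1 by unfold midW; split_ifs <;> omega, add_neg_cancel, zpow_zero,
    one_smul] at hq'
  have h := L.theta_QQ S hi2 s hq
  rw [hq'] at h
  have e : (v - v⁻¹) • L.KM i (n - i - 1) (n - i) s r = -(v ^ (-k) •
      (L.EE (fun _ => 0) i s (n - i) * q - q * L.EE (fun _ => 0) i s (n - i))) := by
    apply smul_right_injective B L.kap_ne
    have : L.XX i (n - i) s * q - q * L.XX i (n - i) s = v ^ k • (L.XX i (n - i - 1) r *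
        L.XX i (n - i) s - L.XX i (n - i) s * L.XX i (n - i - 1) r) := by
      simp only [mul_add, add_mul, mul_smul_comm, smul_mul_assoc] at hc
      rw [smul_sub, sub_eq_sub_iff_add_eq_add, add_comm, hc, add_comm]
    have h2 : (v - v⁻¹) • (L.EE (fun _ => 0) i s (n - i) * q - q * L.EE (fun _ => 0) i s (n - i)) =
      L.XX i (n - i) s * q - q * L.XX i (n - i) s := by
      rw [smul_sub, XX, smul_mul_assoc, mul_smul_comm]
    change (v - v⁻¹) • (v - v⁻¹) • L.KM i (n - i - 1) (n - i) s r = (v - v⁻¹) • -(v ^ (-k) •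
      (L.EE (fun _ => 0) i s (n - i) * q - q * L.EE (fun _ => 0) i s (n - i)))
    rw [KM_smul, smul_neg, smul_comm, h2, this, smul_smul, ← zpow_add₀ L.v_ne, neg_add_cancel,
      zpow_zero, one_smul, neg_sub]
  rw [e]
  exact neg_mem (smulP (zpow_mem_RR v _) h)

end LoopAlg

namespace LoopAlg
variable {F : Type} [Field F] [CharZero F] {v : F}
variable {n : ℕ} {B : Type} [Ring B] [Algebra F B] (L : LoopAlg v n B)

lemma sp_map {x y : ℤ → B} {N : Submodule (RR v) B} (f : B →ₗ[F] B)
    (h : ∀ s r, f (x s * y r) ∈ N) {z : B} (hz : z ∈ sp v x y) : f z ∈ N := by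
  induction hz using Submodule.span_induction with
  | mem z hz => obtain ⟨⟨s, r⟩, rfl⟩ := hz; exact h s r
  | zero => rw [map_zero]; exact zero_mem _
  | add a b _ _ ha hb => rw [map_add]; exact add_mem ha hb
  | smul c a _ ha =>
    have : f (c • a) = c • f a := map_smul f (c : F) a
    rw [this]; exact Submodule.smul_mem _ _ ha

/-- recursion between nested dual pairs. -/
lemma KM_rec {i a b : ℕ} (hi : 1 ≤ i) (hi2 : i + 2 ≤ n) (hab : a + b + 1 + 2 * i = 2 * n)
    (ha : a + 2 ≤ n - i) (s r : ℤ) :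
    L.KM i a b s r + v⁻¹ • L.KM i (a + 1) (b - 1) s r -
      (v - v⁻¹) • (L.EE (fun _ => 0) i r (a + 1) * L.EE (fun _ => 0) i s (b - 1)) ∈
    scl (v - v⁻¹) (sp v (fun s => L.EE (fun _ => 0) i s a) (fun s => L.EE (fun _ => 0) i s b) ⊔
      sp v (fun s => L.EE (fun _ => 0) i s (a + 1)) (fun s => L.EE (fun _ => 0) i s (b - 1))) := by
  have hv := L.v_ne
  have ea : Edge n i (i + a + 1) a (a + 1) := by unfold Edge; omega
  have eb : Edge n i (i + a + 1) (b - 1) b := by unfold Edge; omega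
  have Va : Vp n i a := by unfold Vp; omega
  have Vb : Vp n i (b - 1) := by unfold Vp; omega
  have hl : i < i + a + 1 := by omega
  have hl' : i + a + 1 ≤ n := by omega
  have τa : ∀ s, L.τ (M n (i + a + 1)) (L.EE (fun _ => 0) i s a) = v • L.EE (fun _ => 0) i s a :=
    fun s => by rw [L.τ_EE_cw _ i hi hl hl' hi2 _ Va, cw_of_source ea, zpow_one]
  have τb : ∀ s, L.τ (M n (i + a + 1)) (L.EE (fun _ => 0) i s (b - 1)) =
      v • L.EE (fun _ => 0) i s (b - 1) :=
    fun s => by rw [L.τ_EE_cw _ i hi hl hl' hi2 _ Vb, cw_of_source eb, zpow_one]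
  have da := fun s => L.EE_edge (fun _ => 0) i s hi ea
  have db := fun s => L.EE_edge (fun _ => 0) i s hi eb
  beta_reduce at da db
  obtain ⟨z, hz, e⟩ := (L.Rp_EE (fun _ => 0) i hi hi2 _ a (b - 1) rfl (by omega) Va Vb
    (by omega)).FF_mem hv s r
  have hD : L.D (i + a + 1) 0 z ∈ sp v (fun s => L.EE (fun _ => 0) i s a)
      (fun s => L.EE (fun _ => 0) i s b) ⊔ sp v (fun s => L.EE (fun _ => 0) i s (a + 1))
      (fun s => L.EE (fun _ => 0) i s (b - 1)) := by
    refine sp_map (L.D (i + a + 1) 0) (fun s r => ?_) hz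
    rw [L.D_mul, da, db, τb, mul_smul_comm]
    exact add_mem (Submodule.mem_sup_left (mem_sp (fun s => L.EE (fun _ => 0) i s a)
      (fun s => L.EE (fun _ => 0) i s b) s r)) (smulR (v_mem v) (Submodule.mem_sup_right
      (mem_sp (fun s => L.EE (fun _ => 0) i s (a + 1)) (fun s => L.EE (fun _ => 0) i s (b - 1)) s r)))
  refine ⟨v⁻¹ • L.D (i + a + 1) 0 z, smulR (v_inv_mem v) hD, ?_⟩
  have e2 := congrArg (L.D (i + a + 1) 0) e
  rw [FF, map_sub, map_smul, map_smul, L.D_mul, L.D_mul, da, db, τa, τb] at e2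
  simp only [KM, mul_smul_comm, smul_add] at e2 ⊢
  linear_combination (norm := skip) v⁻¹ • e2
  match_scalars <;> field_simp <;> ring

lemma KM_dual {i : ℕ} (S : L.Stable i) (hi2 : i + 2 ≤ n) : ∀ k a b, a + k + 1 = n - i →
    b = n - i + k → ∀ s r, (v - v⁻¹) • L.KM i a b s r ∈ L.PP i ∧
      (v - v⁻¹) • (v - v⁻¹) • L.KM i a b s r ∈ L.FQ i b
  | 0, a, b, ha, hb, s, r => by
    obtain rfl : a = n - i - 1 := by omega
    obtain rfl : b = n - i := by omega
    exact ⟨L.KM_mid_PP S hi2 s r, L.KM_mid_FQ S hi2 s r⟩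
  | k + 1, a, b, ha, hb, s, r => by
    have hi := S.pos
    have hin := S.le
    obtain ⟨h1, h2⟩ := KM_dual S hi2 k (a + 1) (b - 1) (by omega) (by omega) s r
    obtain ⟨z, hz, e⟩ := L.KM_rec hi hi2 (a := a) (b := b) (by omega) (by omega) s r
    obtain ⟨z1, hz1, z2, hz2, rfl⟩ := Submodule.mem_sup.1 hz
    have Va : Vp n i a := by unfold Vp; omega
    have Vb : Vp n i b := by unfold Vp; omega
    have Va' : Vp n i (a + 1) := by unfold Vp; omega
    have Vb' : Vp n i (b - 1) := by unfold Vp; omega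
    have e' : (v - v⁻¹) • L.KM i a b s r = L.XX i (a + 1) r * L.XX i (b - 1) s -
        v⁻¹ • ((v - v⁻¹) • L.KM i (a + 1) (b - 1) s r) +
        ((v - v⁻¹) • (v - v⁻¹) • z1 + (v - v⁻¹) • (v - v⁻¹) • z2) := by
      simp only [XX, mul_smul_comm, smul_mul_assoc, smul_add] at e ⊢
      linear_combination (norm := module) (v - v⁻¹) • e
    constructor
    · rw [e']
      exact add_mem (sub_mem (mul_mem (L.XX_mem _ le_rfl hin Va') (L.XX_mem _ le_rfl hin Vb'))
        (smulP (v_inv_mem v) h1)) (add_mem (L.sp_EE_PP hin Va Vb hz1) (L.sp_EE_PP hin Va' Vb' hz2))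
    · rw [e', smul_add, smul_sub, smul_comm _ v⁻¹]
      refine add_mem (sub_mem (smulR (kap_mem_RR v) ?_) (smulR (v_inv_mem v)
        (L.FQ_mono (by omega) h2))) (smulR (kap_mem_RR v) (add_mem ?_ ?_))
      · exact L.mem_FQ _ Va' (by omega) (L.XX_mem_Q hi hin Vb' s)
      · exact L.sp_EE_FQ hi hin Va Vb (by omega) hz1
      · exact L.sp_EE_FQ hi hin Va' Vb' (by omega) hz2

/-- products of root vectors in decreasing position order. -/
lemma XX_mul_XX {i a b : ℕ} (S : L.Stable i) (ha : Vp n i a) (hb : Vp n i b)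
    (hab : a < b) (s r : ℤ) : L.XX i b s * L.XX i a r ∈ L.FQ i b := by
  by_cases hd : a + b + 1 + 2 * i = 2 * n
  · have hi2 : i + 2 ≤ n := by unfold Vp at hb; omega
    have h := (L.KM_dual S hi2 (n - i - 1 - a) a b (by omega) (by omega) s r).2
    rw [KM_smul] at h
    have := add_mem h (L.mem_FQ r ha hab (L.XX_mem_Q S.pos S.le hb s))
    rwa [sub_add_cancel] at this
  · exact L.XX_mul_nondual S.pos S.le ha hb hab hd s r

lemma τ_block {i : ℕ} (hi : 1 ≤ i) (hin : i ≤ n) (s : ℤ) : ∀ p, Vp n i p →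
    L.τ (M n i) (L.EE (fun _ => 0) i s p) =
      v ^ (if p = 0 then -2 else if p + 1 + 2 * i = 2 * n then 0 else -1 : ℤ) •
        L.EE (fun _ => 0) i s p := by
  intro p
  induction p using Nat.strong_induction_on with
  | _ p ih =>
  intro hp
  by_cases h0 : p = 0
  · subst h0
    rw [EE_zero, L.τ_e]; simp [M, aD_self]
  obtain ⟨j, q, he, hq, hlt, hj, hj'⟩ := exists_edge i hp h0
  rw [← L.EE_edge (fun _ => 0) i s hi he, L.τ_D, ih q hlt hq, map_smul, smul_smul,
    ← zpow_add₀ L.v_ne]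
  congr 2
  unfold M
  by_cases c1 : j = i + 1 ∧ j < n
  · rw [aD_eq_neg_one (by omega)]
    unfold Edge at he; unfold Vp at hq; split_ifs <;> omega
  by_cases c2 : j = i + 2 ∧ j = n
  · rw [aD_eq_neg_one (by omega)]
    unfold Edge at he; unfold Vp at hq; split_ifs <;> omega
  rw [aD_eq_zero (by omega) (by omega) (by omega) (by omega) (by omega)]
  unfold Edge at he; unfold Vp at hq; split_ifs <;> omega

lemma D_PP_gen {i i' p : ℕ} (S : L.Stable i) (h : i ≤ i') (h' : i' ≤ n) (hp : Vp n i' p) {j : ℕ}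
    (r s : ℤ) (hj : i ≤ j) (hj' : j ≤ n) : L.D j r (L.XX i' p s) ∈ L.PP i := by
  have hi := S.pos
  have hin := S.le
  have hv := L.v_ne
  have hE : ∀ s, L.XX i 0 s ∈ L.PP i := fun s => L.XX_mem s le_rfl hin (Or.inl rfl)
  rcases hj.lt_or_eq with hj | rfl
  · rcases h.lt_or_eq with h | rfl
    · exact L.PP_mono (Nat.le_succ i) (S.D_mem j r _ hj hj' (L.XX_mem s h h' hp))
    · exact L.QQ_le_PP hin (L.D_Q S hj hj' (L.XX_mem_Q hi hin hp s))
  rcases h.lt_or_eq with h | rfl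
  · obtain ⟨w, -, w2, w3⟩ := L.exists_word_Q S h h' hp
    have hD := L.QQ_le_PP hin (w3 s _ (L.XX_mem_Q hi hin (Or.inl rfl) r))
    obtain ⟨c, hc, hc'⟩ := zpow_sub_zpow_neg_mem v hv (w.map (M n i)).sum
    have hM : Mw n w i = (w.map (M n i)).sum := by
      unfold Mw; congr 1; apply List.map_congr_left; intro d _; simp [M, aD_symm n i d]
    have e : L.D i r (L.XX i' p s) = -(v ^ (w.map (M n i)).sum •
        L.DD (L.EE (fun _ => 0) i' s p) (Mw n w) (L.XX i 0 r)) -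
        (v ^ (w.map (M n i)).sum * c) • (L.XX i' p s * L.XX i 0 r) := by
      rw [DD_apply, D_apply]
      simp only [XX, map_smul, w2, EE_zero, L.τ_e, hM, smul_mul_assoc, mul_smul_comm]
      generalize (w.map (M n i)).sum = k at *
      rw [zpow_neg] at hc'
      have hk := zpow_ne_zero k hv
      generalize v ^ k = u at *
      have hc2 : (v - v⁻¹) * c = u - u⁻¹ := by rw [hc', mul_comm]
      have e1 : u * c * (v - v⁻¹) = u * u - 1 := by
        rw [mul_assoc, mul_comm c, hc2]; field_simp
      simp only [smul_sub, smul_smul]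
      have e2 : u * c * ((v - v⁻¹) * (v - v⁻¹)) = (u * u - 1) * (v - v⁻¹) := by
        rw [← e1]; ring
      rw [e2]
      module
    rw [e]
    exact sub_mem (neg_mem (smulP (zpow_mem_RR v _) hD)) (smulP (mul_mem (zpow_mem_RR v _) hc)
      (mul_mem (L.XX_mem s h.le h' hp) (hE r)))
  have hτ := L.τ_block hi hin s p hp
  by_cases h0 : p = 0
  · subst h0
    have hq := L.Rq_EE (fun _ => 0) i hi hin 0 hp
    obtain ⟨z, hz, e⟩ := hq.comm_mem hv s r
    have hz' := L.sp_EE_PP hin hp hp hz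
    rw [if_pos rfl] at hτ
    have e' : L.D i r (L.XX i 0 s) = (v - v⁻¹) • (v - v⁻¹) • z +
        v⁻¹ • (L.XX i 0 r * L.XX i 0 s) := by
      rw [← e, D_apply, XX, XX, map_smul, hτ, EE_zero, EE_zero]
      simp only [mul_smul_comm, smul_mul_assoc, zpow_neg, zpow_ofNat, smul_sub]
      match_scalars <;> field_simp <;> ring
    rw [e']
    exact add_mem hz' (smulP (v_inv_mem v) (mul_mem (hE _) (hE _)))
  have hi2 : i + 2 ≤ n := by unfold Vp at hp; omega
  by_cases hd : p + 1 + 2 * i = 2 * n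
  · have h := (L.KM_dual S hi2 (n - i - 1) 0 p (by omega) (by omega) s r).1
    have e : L.D i r (L.XX i p s) = (v - v⁻¹) • L.KM i 0 p s r := by
      rw [if_neg h0, if_pos hd, zpow_zero, one_smul] at hτ
      rw [D_apply, XX, map_smul, hτ, KM, EE_zero]
      simp only [mul_smul_comm, smul_mul_assoc, smul_sub]
    rw [e]; exact h
  · obtain ⟨z, hz, e⟩ := (L.Rp_EE (fun _ => 0) i hi hi2 _ 0 p rfl (by omega) (Or.inl rfl) hp
      (by omega)).FF_mem hv s r
    have hz' := L.sp_EE_PP hin (Or.inl rfl) hp hz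
    have e' : L.D i r (L.XX i p s) = (v - v⁻¹) • (v - v⁻¹) • z + L.XX i 0 r * L.XX i p s := by
      rw [← e, FF, D_apply, XX, XX, map_smul, hτ, EE_zero, if_neg h0, if_neg hd]
      simp only [mul_smul_comm, smul_mul_assoc, smul_sub, zpow_neg_one]
      module
    rw [e']
    exact add_mem hz' (mul_mem (hE _) (L.XX_mem s le_rfl hin hp))

lemma D_PP {i : ℕ} (S : L.Stable i) {j : ℕ} (r : ℤ) (hj : i ≤ j) (hj' : j ≤ n) {x : B}
    (hx : x ∈ L.PP i) : L.D j r x ∈ L.PP i := by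
  induction hx using Algebra.adjoin_induction with
  | mem x h =>
    obtain ⟨i', p, s, h1, h2, h3, rfl⟩ := h
    exact L.D_PP_gen S h1 h2 h3 r s hj hj'
  | algebraMap c =>
    have : L.τ (M n j) (algebraMap (RR v) B c) = algebraMap (RR v) B c :=
      (L.τ _).commutes (c : F)
    rw [D_apply, this, Algebra.commutes, sub_self]
    exact zero_mem _
  | add a b _ _ ha hb => rw [map_add]; exact add_mem ha hb
  | mul a b ha' hb' ha hb =>
    rw [L.D_mul]
    exact add_mem (mul_mem ha' hb) (mul_mem ha (L.τ_PP S.pos _ hb'))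

lemma stable_sub {k : ℕ} : ∀ i, 1 ≤ i → i + k = n → L.Stable i := by
  induction k with
  | zero =>
    intro i h1 h2
    exact ⟨h1, by omega, fun j r x hj hj' _ => by omega⟩
  | succ k ih =>
    intro i h1 h2
    have S := ih (i + 1) (by omega) (by omega)
    exact ⟨h1, by omega, fun j r x hj hj' hx => L.D_PP S r hj hj' hx⟩

lemma stable {i : ℕ} (h : 1 ≤ i) (h' : i ≤ n) : L.Stable i :=
  L.stable_sub (k := n - i) i h (by omega)

end LoopAlg

/-- the word attached to position `p` of the block `i`. -/
def wd (n i p : ℕ) : List ℕ :=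
  if i + p < n ∨ i = n then List.range' i (p + 1)
  else if i + p = n then List.range' i (n - 1 - i) ++ [n]
  else if i + p = n + 1 then List.range' i (n - 1 - i) ++ [n, n - 1]
  else List.range' i (n - 1 - i) ++ [n] ++ (List.range' (2 * n - i - p) (n - (2 * n - i - p))).reverse

lemma wd_zero {n i : ℕ} (h : i ≤ n) : wd n i 0 = [i] := by
  rw [wd, if_pos (by omega)]; rfl

lemma exists_parent {n i p : ℕ} (hp : Vp n i p) (h0 : p ≠ 0) :
    ∃ j q, Edge n i j q p ∧ Vp n i q ∧ q < p ∧ wd n i p = wd n i q ++ [j] := by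
  have hi2 : i + 2 ≤ n := by unfold Vp at hp; omega
  have hp2 : p + 2 * i + 1 ≤ 2 * n := by unfold Vp at hp; omega
  by_cases c1 : i + p < n
  · refine ⟨i + p, p - 1, by unfold Edge; omega, by unfold Vp; omega, by omega, ?_⟩
    rw [wd, wd, if_pos (by omega), if_pos (by omega), List.range'_concat,
      show p - 1 + 1 = p by omega]
    simp
  by_cases c2 : i + p = n
  · refine ⟨n, p - 2, by unfold Edge; omega, by unfold Vp; omega, by omega, ?_⟩
    rw [wd, wd, if_neg (by omega), if_pos (by omega), if_pos (by omega),
      show p - 2 + 1 = n - 1 - i by omega]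
  by_cases c3 : i + p = n + 1
  · refine ⟨n - 1, p - 1, by unfold Edge; omega, by unfold Vp; omega, by omega, ?_⟩
    rw [wd, wd, if_neg (by omega), if_neg (by omega), if_pos (by omega), if_neg (by omega),
      if_pos (by omega)]
    simp
  refine ⟨2 * n - i - p, p - 1, by unfold Edge; omega, by unfold Vp; omega, by omega, ?_⟩
  have e : List.range' (2 * n - i - p) (n - (2 * n - i - p)) =
      (2 * n - i - p) :: List.range' (2 * n - i - (p - 1)) (n - (2 * n - i - (p - 1))) := by
    rw [show n - (2 * n - i - p) = n - (2 * n - i - (p - 1)) + 1 by omega, List.range'_succ,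
      show 2 * n - i - p + 1 = 2 * n - i - (p - 1) by omega]
  by_cases c4 : i + p = n + 2
  · rw [wd, wd, if_neg (by omega), if_neg (by omega), if_neg (by omega), if_neg (by omega),
      if_neg (by omega), if_pos (by omega), e, show 2 * n - i - (p - 1) = n - 1 by omega,
      show n - (n - 1) = 1 by omega]
    simp
  · rw [wd, wd, if_neg (by omega), if_neg (by omega), if_neg (by omega), if_neg (by omega),
      if_neg (by omega), if_neg (by omega), e]
    simp

lemma wd_ne_nil {n i p : ℕ} (hin : i ≤ n) (hp : Vp n i p) : wd n i p ≠ [] := by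
  by_cases h0 : p = 0
  · subst h0; rw [wd_zero hin]; simp
  · obtain ⟨j, q, -, -, -, h⟩ := exists_parent hp h0
    rw [h]; simp

namespace LoopAlg
variable {F : Type} [Field F] [CharZero F] {v : F}
variable {n : ℕ} {B : Type} [Ring B] [Algebra F B] (L : LoopAlg v n B)

/-- the `u`-commutator with the generator `e j r`. -/
def br (u : F) (j : ℕ) (r : ℤ) (x : B) : B := x * L.e j r - u • (L.e j r * x)

/-- the iterated `u`-commutator along a word. -/
def chl (u : F) (t : ℕ → ℤ) : List ℕ → B
  | [] => 0
  | i :: w => w.foldl (fun x j => L.br u j (t j) x) (L.e i (t i))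

lemma chl_append (u : F) (t : ℕ → ℤ) {w : List ℕ} (hw : w ≠ []) (j : ℕ) :
    L.chl u t (w ++ [j]) = L.br u j (t j) (L.chl u t w) := by
  cases w with
  | nil => exact absurd rfl hw
  | cons i w => simp [chl]

lemma τ_br (μ : ℕ → ℤ) (u : F) (j : ℕ) (r : ℤ) (x : B) :
    L.τ μ (L.br u j r x) = v ^ μ j • L.br u j r (L.τ μ x) := by
  simp only [br, map_sub, map_mul, map_smul, L.τ_e, mul_smul_comm, smul_mul_assoc, smul_sub]
  module

lemma br_lin (u : F) (j : ℕ) (r : ℤ) (c : F) (x y : B) :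
    L.br u j r (c • x + y) = c • L.br u j r x + L.br u j r y := by
  simp only [br, mul_add, add_mul, mul_smul_comm, smul_mul_assoc]
  module

lemma τ_chl {u : F} (t : ℕ → ℤ) {i l : ℕ} (hi : 1 ≤ i) (hi2 : i + 2 ≤ n) (hl : i < l)
    (hl' : l ≤ n) : ∀ p, Vp n i p →
    L.τ (M n l) (L.chl u t (wd n i p)) = v ^ cw n i l p • L.chl u t (wd n i p) := by
  intro p
  induction p using Nat.strong_induction_on with
  | _ p ih =>
  intro hp
  by_cases h0 : p = 0
  · subst h0
    have h := L.τ_EE_cw (fun _ => t i) i hi hl hl' hi2 0 hp (t i)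
    rw [EE_zero] at h
    rw [wd_zero (by omega)]
    exact h
  obtain ⟨j, q, he, hq, hlt, hw⟩ := exists_parent hp h0
  rw [hw, L.chl_append u t (wd_ne_nil (by omega) hq), τ_br, ih q hlt hq, cw_edge hl hl' he]
  have := L.br_lin u j (t j) (v ^ cw n i l q) (L.chl u t (wd n i q)) 0
  rw [add_zero, show L.br u j (t j) 0 = 0 by simp [br], add_zero] at this
  rw [this, smul_smul, ← zpow_add₀ L.v_ne, M]
  congr 2; ring

/-- a `v^{±1}`-commutator stays in the filtered piece and has the derivation as leading part. -/
lemma br_cong {u : F} (hu : u = v ∨ u = v⁻¹) {N : Submodule (RR v) B} {x : B} {j : ℕ} {r : ℤ}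
    (hx : L.τ (M n j) x = v • x) (hN : x * ((v - v⁻¹) • L.e j r) ∈ N) :
    Cong v N (L.br u j r x) (L.D j r x) := by
  have hv := L.v_ne
  rcases hu with rfl | rfl
  · refine ⟨0, ?_⟩
    rw [br, D_apply, hx, zpow_zero, one_smul, mul_smul_comm, sub_self]
    exact zero_mem _
  · refine ⟨-2, ?_⟩
    have e : L.br v⁻¹ j r x - v ^ (-2 : ℤ) • L.D j r x = v⁻¹ • (x * ((v - v⁻¹) • L.e j r)) := by
      rw [br, D_apply, hx, zpow_neg]
      simp only [mul_smul_comm, zpow_ofNat]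
      match_scalars <;> field_simp <;> ring
    rw [e]
    exact smulR (v_inv_mem v) hN

lemma chl_cong {u : F} (hu : u = v ∨ u = v⁻¹) {i : ℕ} (hi : 1 ≤ i) (hin : i ≤ n) (t : ℕ → ℤ) :
    ∀ p, Vp n i p → Cong v (L.QQ i p) ((v - v⁻¹) • L.chl u t (wd n i p))
      (L.XX i p ((wd n i p).map t).sum) := by
  intro p
  induction p using Nat.strong_induction_on with
  | _ p ih =>
  intro hp
  have S := L.stable hi hin
  have hv := L.v_ne
  by_cases h0 : p = 0
  · subst h0
    rw [wd_zero hin]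
    simp only [chl, List.foldl_nil, List.map_cons, List.map_nil, List.sum_cons, List.sum_nil,
      add_zero, XX_zero]
    exact Cong.refl _
  obtain ⟨j, q, he, hq, hlt, hw⟩ := exists_parent hp h0
  obtain ⟨-, hj, hj', hi2⟩ := Edge_lt he
  obtain ⟨k, hk⟩ := ih q hlt hq
  set Y := L.chl u t (wd n i q) with hY
  set s := ((wd n i q).map t).sum with hs
  have hτY : L.τ (M n j) Y = v • Y := by
    rw [hY, L.τ_chl t hi hi2 hj hj' q hq, cw_of_source he, zpow_one]
  have hτX : L.τ (M n j) (L.XX i q s) = v • L.XX i q s := by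
    rw [XX, map_smul, L.τ_EE_cw _ i hi hj hj' hi2 q hq, cw_of_source he, zpow_one, smul_comm]
  set z := (v - v⁻¹) • Y - v ^ k • L.XX i q s with hz
  have hτz : L.τ (M n j) z = v • z := by
    rw [hz, map_sub, map_smul, map_smul, hτY, hτX]; module
  have e : (v - v⁻¹) • L.chl u t (wd n i p) =
      v ^ k • L.br u j (t j) (L.XX i q s) + L.br u j (t j) z := by
    rw [hw, L.chl_append u t (wd_ne_nil hin hq), ← br_lin, hz, add_sub_cancel]
    have := L.br_lin u j (t j) (v - v⁻¹) Y 0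
    rwa [add_zero, show L.br u j (t j) 0 = 0 by simp [br], add_zero, eq_comm] at this
  have hsum : ((wd n i p).map t).sum = s + t j := by rw [hw]; simp [hs]
  have he' : ∀ r, r ∈ L.QQ i (q + 1) → r ∈ L.QQ i p := fun r hr => L.QQ_mono (by omega) hr
  have c1 : Cong v (L.QQ i p) (L.br u j (t j) (L.XX i q s)) (L.XX i p (s + t j)) := by
    refine (L.br_cong hu hτX (he' _ (L.mem_QQ _ hq (by omega)
      (L.e_mem (t j) (by omega) hj')))).trans hv ?_
    have := (L.shift_all S q hq j hj hj' (t j) s).mono (L.QQ_mono (Nat.succ_le_of_lt hlt))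
    rwa [L.XX_edge hi he] at this
  have c2 : L.br u j (t j) z ∈ L.QQ i p := by
    refine (L.br_cong hu hτz (he' _ (L.QQ_mono (Nat.le_succ q) (L.QQ_mul hk
      (L.e_mem (t j) (by omega) hj'))))).mem ?_
    exact L.D_QQ_of_shift S (fun q _ h => L.shift_all S q h) hlt.le hj hj'
      (fun q' q'' h1 h2 h3 => by unfold Edge at he h3; omega) hk
  obtain ⟨k', hk'⟩ := c1
  refine ⟨k + k', ?_⟩
  rw [e, hsum, zpow_add₀ hv, mul_smul]
  have := add_mem (smulR (zpow_mem_RR v k) hk') c2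
  rwa [smul_sub, sub_add_eq_add_sub] at this

end LoopAlg

namespace Sorting
variable {R : Type} [CommRing R] {B : Type} [Ring B] [Algebra R B]

/-- the element attached to a position and a degree. -/
def ev (Y : ℕ → ℤ → B) (x : ℕ ×ₗ ℤ) : B := Y (ofLex x).1 (ofLex x).2

/-- products of `k` factors in increasing order, bounded below by `x`, times elements of `P`. -/
def TT (V : ℕ → Prop) (Y : ℕ → ℤ → B) (P : Subalgebra R B) (k : ℕ) (x : ℕ ×ₗ ℤ) :
    Submodule R B :=
  Submodule.span R {z | ∃ (l : List (ℕ ×ₗ ℤ)) (y : B), l.Pairwise (· ≤ ·) ∧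
    (∀ a ∈ l, V (ofLex a).1 ∧ x ≤ a) ∧ l.length = k ∧ y ∈ P ∧ z = (l.map (ev Y)).prod * y}

/-- products of `k` factors in increasing order times elements of `P`. -/
def SS (V : ℕ → Prop) (Y : ℕ → ℤ → B) (P : Subalgebra R B) (k : ℕ) : Submodule R B :=
  Submodule.span R {z | ∃ (l : List (ℕ ×ₗ ℤ)) (y : B), l.Pairwise (· ≤ ·) ∧
    (∀ a ∈ l, V (ofLex a).1) ∧ l.length = k ∧ y ∈ P ∧ z = (l.map (ev Y)).prod * y}

/-- the span of `Y c s * z` with `c < b` and `z ∈ N`. -/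
def lt (V : ℕ → Prop) (Y : ℕ → ℤ → B) (N : Submodule R B) (b : ℕ) : Submodule R B :=
  Submodule.span R {z | ∃ c s y, V c ∧ c < b ∧ y ∈ N ∧ z = Y c s * y}

/-- the span of `Y c s * y` with `y ∈ P`. -/
def qq (V : ℕ → Prop) (Y : ℕ → ℤ → B) (P : Subalgebra R B) : Submodule R B :=
  Submodule.span R {z | ∃ c s y, V c ∧ y ∈ P ∧ z = Y c s * y}

/-- squares of position `b` straightening `Y b s * Y b r`. -/
def sq (Y : ℕ → ℤ → B) (b : ℕ) (r s : ℤ) : Submodule R B :=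
  Submodule.span R {z | ∃ s' r', r ≤ s' ∧ s' ≤ r' ∧ s' < s ∧ z = Y b s' * Y b r'}

lemma span_mul {N : Submodule R B} {X : Set B} {w x : B} (hx : x ∈ Submodule.span R X)
    (h : ∀ z ∈ X, z * w ∈ N) : x * w ∈ N := by
  have : Submodule.span R X ≤ N.comap (LinearMap.mulRight R w) :=
    Submodule.span_le.2 fun z hz => h z hz
  exact this hx

lemma mul_span {N : Submodule R B} {X : Set B} {w x : B} (hx : x ∈ Submodule.span R X)
    (h : ∀ z ∈ X, w * z ∈ N) : w * x ∈ N := by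
  have : Submodule.span R X ≤ N.comap (LinearMap.mulLeft R w) :=
    Submodule.span_le.2 fun z hz => h z hz
  exact this hx

variable {V : ℕ → Prop} {Y : ℕ → ℤ → B} {P : Subalgebra R B}

lemma TT_le_SS (k : ℕ) (x : ℕ ×ₗ ℤ) : TT V Y P k x ≤ SS V Y P k := by
  apply Submodule.span_mono
  rintro z ⟨l, y, h1, h2, h3, h4, h5⟩
  exact ⟨l, y, h1, fun a ha => (h2 a ha).1, h3, h4, h5⟩

lemma TT_anti (k : ℕ) {x x' : ℕ ×ₗ ℤ} (h : x ≤ x') : TT V Y P k x' ≤ TT V Y P k x := by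
  apply Submodule.span_mono
  rintro z ⟨l, y, h1, h2, h3, h4, h5⟩
  exact ⟨l, y, h1, fun a ha => ⟨(h2 a ha).1, h.trans (h2 a ha).2⟩, h3, h4, h5⟩

lemma mem_lt {N : Submodule R B} {b c : ℕ} (s : ℤ) {y : B} (hc : V c) (h : c < b) (hy : y ∈ N) :
    Y c s * y ∈ lt V Y N b := Submodule.subset_span ⟨c, s, y, hc, h, hy, rfl⟩

variable (V Y P) in
/-- straightening data for one block of root vectors. -/
structure Str : Prop where
  left : ∀ y ∈ P, ∀ x ∈ qq V Y P, y * x ∈ qq V Y P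
  lower : ∀ a b s r, V a → V b → a < b → Y b s * Y a r ∈ lt V Y (qq V Y P) b
  square : ∀ b s r, V b → r < s → Y b s * Y b r ∈ sq Y b r s ⊔ lt V Y (qq V Y P) b

/-- left multiplication by root vectors and by `P` on products of `k` factors. -/
def Good (V : ℕ → Prop) (Y : ℕ → ℤ → B) (P : Subalgebra R B) (k : ℕ) : Prop :=
  (∀ b s x, V b → x ∈ SS V Y P k → Y b s * x ∈ SS V Y P (k + 1)) ∧
  (∀ y x, y ∈ P → x ∈ SS V Y P k → y * x ∈ SS V Y P k)

lemma lt_mul {k b : ℕ} (hk : Good V Y P k) {f z : B} (hf : f ∈ lt V Y (qq V Y P) b)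
    (hz : z ∈ SS V Y P k) : f * z ∈ lt V Y (SS V Y P (k + 1)) b := by
  refine span_mul hf ?_
  rintro _ ⟨c, s, x, hc, hcb, hx, rfl⟩
  rw [mul_assoc]
  refine mem_lt s hc hcb (span_mul hx ?_)
  rintro _ ⟨d, s', y, hd, hy, rfl⟩
  rw [mul_assoc]
  exact hk.1 d s' _ hd (hk.2 y z hy hz)

/-- straightening left multiplication by a factor of position `b`. -/
def LeftStable (V : ℕ → Prop) (Y : ℕ → ℤ → B) (P : Subalgebra R B) (k : ℕ) : Prop :=
  ∀ b s r x, V b → x ∈ TT V Y P k (toLex (b, r)) →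
    Y b s * x ∈ TT V Y P (k + 1) (toLex (b, min s r)) ⊔ lt V Y (SS V Y P k) b

lemma cons_mem {b : ℕ} {s r : ℤ} {l : List (ℕ ×ₗ ℤ)} {y : B} {k : ℕ} (hb : V b)
    (h1 : l.Pairwise (· ≤ ·)) (h2 : ∀ a ∈ l, V (ofLex a).1 ∧ toLex (b, r) ≤ a)
    (h3 : l.length = k) (h4 : y ∈ P) (h : ∀ a ∈ l, toLex (b, s) ≤ a) :
    Y b s * ((l.map (ev Y)).prod * y) ∈ TT V Y P (k + 1) (toLex (b, min s r)) := by
  refine Submodule.subset_span ⟨toLex (b, s) :: l, y, ?_, ?_, ?_, h4, ?_⟩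
  · exact List.pairwise_cons.2 ⟨h, h1⟩
  · intro a ha
    rcases List.mem_cons.1 ha with rfl | ha
    · refine ⟨hb, ?_⟩
      simp [Prod.Lex.toLex_le_toLex]
    · refine ⟨(h2 a ha).1, le_trans ?_ (h2 a ha).2⟩
      simp [Prod.Lex.toLex_le_toLex]
  · simp [h3]
  · simp [ev, mul_assoc]

lemma leftStable_zero : LeftStable V Y P 0 := by
  intro b s r x hb hx
  refine Submodule.mem_sup_left (mul_span hx ?_)
  rintro _ ⟨l, y, h1, h2, h3, h4, rfl⟩
  obtain rfl := List.length_eq_zero_iff.1 h3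
  exact cons_mem hb h1 h2 h3 h4 (by simp)

lemma leftStable_succ (H : Str V Y P) {k : ℕ} (hk : Good V Y P k) (hc : LeftStable V Y P k) :
    LeftStable V Y P (k + 1) := by
  have key : ∀ (m : ℕ) (b : ℕ) (s r : ℤ) (x : B), s - r ≤ m → V b →
      x ∈ TT V Y P (k + 1) (toLex (b, r)) →
      Y b s * x ∈ TT V Y P (k + 2) (toLex (b, min s r)) ⊔ lt V Y (SS V Y P (k + 1)) b := by
    intro m
    induction m with
    | zero =>
      intro b s r x hm hb hx
      refine Submodule.mem_sup_left (mul_span hx ?_)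
      rintro _ ⟨l, y, h1, h2, h3, h4, rfl⟩
      refine cons_mem hb h1 h2 h3 h4 fun a ha => le_trans ?_ (h2 a ha).2
      rw [Prod.Lex.toLex_le_toLex]
      right
      push_cast at hm
      exact ⟨rfl, by simp; omega⟩
    | succ m ih =>
      intro b s r x hm hb hx
      refine mul_span hx ?_
      rintro _ ⟨l, y, h1, h2, h3, h4, rfl⟩
      by_cases hcase : ∀ a ∈ l, toLex (b, s) ≤ a
      · exact Submodule.mem_sup_left (cons_mem hb h1 h2 h3 h4 hcase)
      obtain ⟨a, l', rfl⟩ : ∃ a l', l = a :: l' := by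
        cases l with
        | nil => simp at h3
        | cons a l' => exact ⟨a, l', rfl⟩
      rw [List.pairwise_cons] at h1
      have ha : ¬ toLex (b, s) ≤ a := by
        intro h
        apply hcase
        intro c hc
        rcases List.mem_cons.1 hc with rfl | hc
        · exact h
        · exact h.trans (h1.1 c hc)
      have ha2 := (h2 a (by simp)).2
      obtain ⟨⟨a1, s1⟩, rfl⟩ := toLex.surjective a
      rw [Prod.Lex.toLex_le_toLex] at ha ha2
      simp only at ha ha2
      obtain ⟨rfl, hr, hs⟩ : b = a1 ∧ r ≤ s1 ∧ s1 < s := by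
        push Not at ha
        rcases ha2 with h | ⟨h, h'⟩
        · omega
        · exact ⟨h, h', ha.2 h⟩
      set w := (l'.map (ev Y)).prod * y with hw
      have hwT : w ∈ TT V Y P k (toLex (b, s1)) :=
        Submodule.subset_span ⟨l', y, h1.2, fun c hc => ⟨(h2 c (by simp [hc])).1, h1.1 c hc⟩,
          by simpa using h3, h4, rfl⟩
      have e1 : Y b s * (((toLex (b, s1) :: l').map (ev Y)).prod * y) = (Y b s * Y b s1) * w := by
        simp [ev, hw, mul_assoc]
      rw [e1]
      obtain ⟨f, hf, g, hg, hfg⟩ := Submodule.mem_sup.1 (H.square b s s1 hb hs)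
      rw [← hfg, add_mul]
      refine add_mem ?_ (Submodule.mem_sup_right (lt_mul hk hg (TT_le_SS _ _ hwT)))
      refine span_mul hf ?_
      rintro _ ⟨s', r', h5, h6, h7, rfl⟩
      rw [mul_assoc]
      obtain ⟨f', hf', g', hg', hfg'⟩ := Submodule.mem_sup.1 (hc b r' s1 w hb hwT)
      rw [← hfg', mul_add]
      rw [min_eq_right (h5.trans h6)] at hf'
      refine add_mem ?_ (Submodule.mem_sup_right (mul_span hg' ?_))
      · have := ih b s' s1 f' (by push_cast at hm; omega) hb hf'
        refine (sup_le_sup_right (TT_anti _ ?_) _) this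
        rw [Prod.Lex.toLex_le_toLex]
        right
        refine ⟨rfl, ?_⟩
        simp only [min_eq_right h5]
        exact (min_le_right _ _).trans hr
      · rintro _ ⟨c, s2, z, hcV, hcb, hz, rfl⟩
        rw [← mul_assoc]
        exact lt_mul hk (H.lower c b s' s2 hcV hb hcb) hz
  intro b s r x hb hx
  exact key (s - r).toNat b s r x (by omega) hb hx

lemma good_left {k : ℕ} (hcl : LeftStable V Y P k)
    (hl : ∀ a b s s1 z, V a → V b → a < b → ∀ l : List (ℕ ×ₗ ℤ), ∀ y,
      l.Pairwise (· ≤ ·) → (∀ a ∈ l, V (ofLex a).1) → l.length + 1 = k → y ∈ P →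
      z = (l.map (ev Y)).prod * y → Y b s * (Y a s1 * z) ∈ lt V Y (SS V Y P k) b) :
    ∀ b s x, V b → x ∈ SS V Y P k → Y b s * x ∈ SS V Y P (k + 1) := by
  intro b
  induction b using Nat.strong_induction_on with
  | _ b ih =>
  intro s x hb hx
  have hlt : lt V Y (SS V Y P k) b ≤ SS V Y P (k + 1) := by
    refine Submodule.span_le.2 ?_
    rintro _ ⟨c, s', y, hc, hcb, hy, rfl⟩
    exact ih c hcb s' y hc hy
  refine mul_span hx ?_
  rintro _ ⟨l, y, h1, h2, h3, h4, rfl⟩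
  rcases l with _ | ⟨a, l⟩
  · exact TT_le_SS _ _ (cons_mem (r := s) hb h1 (by simp) h3 h4 (by simp))
  obtain ⟨⟨a1, s1⟩, rfl⟩ := toLex.surjective a
  by_cases hab : a1 < b
  · apply hlt
    have := hl a1 b s s1 _ (h2 (toLex (a1, s1)) (by simp)) hb hab l y (List.pairwise_cons.1 h1).2
      (fun a ha => h2 a (by simp [ha])) (by simpa using h3) h4 rfl
    simpa [ev, mul_assoc] using this
  · have h5 : ((toLex (a1, s1) :: l).map (ev Y)).prod * y ∈ TT V Y P k (toLex (b, s1)) := by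
      refine Submodule.subset_span ⟨_, y, h1, fun c hc => ⟨h2 c hc, ?_⟩, h3, h4, rfl⟩
      have h6 : toLex (b, s1) ≤ toLex (a1, s1) := by
        rw [Prod.Lex.toLex_le_toLex]
        rcases lt_or_eq_of_le (not_lt.1 hab) with h | h
        · exact Or.inl h
        · exact Or.inr ⟨h, le_rfl⟩
      rcases List.mem_cons.1 hc with rfl | hc
      · exact h6
      · exact h6.trans ((List.pairwise_cons.1 h1).1 c hc)
    exact (sup_le (TT_le_SS _ _) hlt) (hcl b s s1 _ hb h5)

lemma good_and_leftStable (H : Str V Y P) : ∀ k, Good V Y P k ∧ LeftStable V Y P k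
  | 0 => by
    refine ⟨⟨good_left leftStable_zero ?_, ?_⟩, leftStable_zero⟩
    · intro a b s s1 z ha hb hab l y h1 h2 h3
      simp at h3
    · intro y x hy hx
      refine mul_span hx ?_
      rintro _ ⟨l, y', h1, h2, h3, h4, rfl⟩
      obtain rfl := List.length_eq_zero_iff.1 h3
      exact Submodule.subset_span ⟨[], y * y', by simp, by simp, rfl, mul_mem hy h4, by simp⟩
  | k + 1 => by
    obtain ⟨hg, hc⟩ := good_and_leftStable H k
    have hc' := leftStable_succ H hg hc
    refine ⟨⟨good_left hc' ?_, ?_⟩, hc'⟩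
    · rintro a b s s1 z ha hb hab l y h1 h2 h3 h4 rfl
      rw [← mul_assoc]
      exact lt_mul hg (H.lower a b s s1 ha hb hab)
        (Submodule.subset_span ⟨l, y, h1, h2, by omega, h4, rfl⟩)
    · intro y x hy hx
      refine mul_span hx ?_
      rintro _ ⟨l, y', h1, h2, h3, h4, rfl⟩
      rcases l with _ | ⟨a, l⟩
      · simp at h3
      have h5 : (l.map (ev Y)).prod * y' ∈ SS V Y P k :=
        Submodule.subset_span ⟨l, y', (List.pairwise_cons.1 h1).2, fun c hc => h2 c (by simp [hc]),
          by simpa using h3, h4, rfl⟩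
      have h6 : y * (((a :: l).map (ev Y)).prod * y') =
          (y * (Y (ofLex a).1 (ofLex a).2 * 1)) * ((l.map (ev Y)).prod * y') := by
        simp [ev, mul_assoc]
      rw [h6]
      have h7 := H.left y hy (Y (ofLex a).1 (ofLex a).2 * 1)
        (Submodule.subset_span ⟨_, _, 1, h2 a (by simp), one_mem _, rfl⟩)
      refine span_mul h7 ?_
      rintro _ ⟨c, s, y2, hcV, hy2, rfl⟩
      rw [mul_assoc]
      exact hg.1 c s _ hcV (hg.2 _ _ hy2 h5)

/-- the algebra generated by one block over `P` is spanned by ordered products. -/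
theorem mem_span_of_mem_adjoin (H : Str V Y P) {x : B}
    (hx : x ∈ Algebra.adjoin R ({z | ∃ c s, V c ∧ z = Y c s} ∪ (P : Set B))) :
    x ∈ Submodule.span R {z | ∃ (l : List (ℕ ×ₗ ℤ)) (y : B), l.Pairwise (· ≤ ·) ∧
      (∀ a ∈ l, V (ofLex a).1) ∧ y ∈ P ∧ z = (l.map (ev Y)).prod * y} := by
  set N := Submodule.span R {z | ∃ (l : List (ℕ ×ₗ ℤ)) (y : B), l.Pairwise (· ≤ ·) ∧
      (∀ a ∈ l, V (ofLex a).1) ∧ y ∈ P ∧ z = (l.map (ev Y)).prod * y} with hN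
  have hS : ∀ k, SS V Y P k ≤ N := fun k => Submodule.span_mono (by
    rintro z ⟨l, y, h1, h2, h3, h4, h5⟩
    exact ⟨l, y, h1, h2, h4, h5⟩)
  have key : ∀ z ∈ N, x * z ∈ N := by
    induction hx using Algebra.adjoin_induction with
    | mem x hx =>
      intro z hz
      refine mul_span hz ?_
      rintro _ ⟨l, y, h1, h2, h4, rfl⟩
      have h5 : (l.map (ev Y)).prod * y ∈ SS V Y P l.length :=
        Submodule.subset_span ⟨l, y, h1, h2, rfl, h4, rfl⟩
      rcases hx with ⟨c, s, hc, rfl⟩ | hx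
      · exact hS _ ((good_and_leftStable H _).1.1 c s _ hc h5)
      · exact hS _ ((good_and_leftStable H _).1.2 _ _ hx h5)
    | algebraMap r =>
      intro z hz
      rw [← Algebra.smul_def]
      exact N.smul_mem r hz
    | add x y _ _ hx hy => intro z hz; rw [add_mul]; exact add_mem (hx z hz) (hy z hz)
    | mul x y _ _ hx hy => intro z hz; rw [mul_assoc]; exact hx _ (hy z hz)
  have h1 : (1 : B) ∈ N := Submodule.subset_span ⟨[], 1, by simp, by simp, one_mem _, by simp⟩
  simpa using key 1 h1

end Sorting

namespace LoopAlg
open Sorting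
variable {F : Type} [Field F] [CharZero F] {v : F}
variable {n : ℕ} {B : Type} [Ring B] [Algebra F B] (L : LoopAlg v n B)

/-- a family of elements of block `i` triangularly equivalent to the standard one. -/
def Adapted (i : ℕ) (X : ℕ → ℤ → B) : Prop :=
  ∀ p s, Vp n i p → Cong v (L.QQ i p) (X p s) (L.XX i p s)

variable {L}

lemma Adapted.exists_eq {i : ℕ} {X : ℕ → ℤ → B} (hX : L.Adapted i X) {p : ℕ} (s : ℤ)
    (hp : Vp n i p) : ∃ k : ℤ, ∃ q ∈ L.QQ i p, X p s = v ^ k • L.XX i p s + q := by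
  obtain ⟨k, hk⟩ := hX p s hp
  exact ⟨k, _, hk, by abel⟩

lemma Adapted.exists_eq' {i : ℕ} {X : ℕ → ℤ → B} (hX : L.Adapted i X) {p : ℕ} (s : ℤ)
    (hp : Vp n i p) : ∃ k : ℤ, ∃ q ∈ L.QQ i p, L.XX i p s = v ^ k • X p s + q := by
  obtain ⟨k, hk⟩ := (hX p s hp).symm L.v_ne
  exact ⟨k, _, hk, by abel⟩

lemma Adapted.mem_QQ {i : ℕ} {X : ℕ → ℤ → B} (hX : L.Adapted i X) {p c : ℕ} (s : ℤ)
    (hp : Vp n i p) (hc : p < c) : X p s ∈ L.QQ i c := by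
  obtain ⟨k, q, hq, h⟩ := hX.exists_eq s hp
  rw [h]
  exact add_mem (smulR (zpow_mem_RR v k) (L.mem_QQ' s hp hc)) (L.QQ_mono hc.le hq)

lemma Adapted.mem_Q {i : ℕ} {X : ℕ → ℤ → B} (hX : L.Adapted i X) {p : ℕ} (s : ℤ)
    (hi : 1 ≤ i) (hin : i ≤ n) (hp : Vp n i p) : X p s ∈ L.Q i :=
  hX.mem_QQ s hp (Vp_lt hi hin hp)

lemma qq_mul {i : ℕ} {X : ℕ → ℤ → B} {x y : B}
    (hx : x ∈ qq (Vp n i) X (L.PP (i + 1))) (hy : y ∈ L.PP (i + 1)) :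
    x * y ∈ qq (Vp n i) X (L.PP (i + 1)) := by
  refine span_mul hx ?_
  rintro _ ⟨c, s, z, hc, hz, rfl⟩
  rw [mul_assoc]
  exact Submodule.subset_span ⟨c, s, _, hc, mul_mem hz hy, rfl⟩

lemma Adapted.QQ_le {i : ℕ} {X : ℕ → ℤ → B} (hX : L.Adapted i X) (b : ℕ) :
    L.QQ i b ≤ qq (Vp n i) X (L.PP (i + 1)) := by
  induction b using Nat.strong_induction_on with
  | _ b ih =>
  refine Submodule.span_le.2 ?_
  rintro _ ⟨c, s, y, hc, hcb, hy, rfl⟩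
  obtain ⟨k, q, hq, h⟩ := hX.exists_eq' s hc
  rw [h, add_mul, smul_mul_assoc]
  exact add_mem (smulR (zpow_mem_RR v k) (Submodule.subset_span ⟨c, s, y, hc, hy, rfl⟩))
    (qq_mul (ih c hcb hq) hy)

lemma Adapted.qq_le {i : ℕ} {X : ℕ → ℤ → B} (hX : L.Adapted i X) (hi : 1 ≤ i) (hin : i ≤ n) :
    qq (Vp n i) X (L.PP (i + 1)) ≤ L.Q i := by
  refine Submodule.span_le.2 ?_
  rintro _ ⟨c, s, y, hc, hy, rfl⟩
  exact L.QQ_mul (hX.mem_Q s hi hin hc) hy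

lemma lt_mono {V : ℕ → Prop} {Y : ℕ → ℤ → B} {N : Submodule (RR v) B} {b c : ℕ} (h : b ≤ c) :
    lt V Y N b ≤ lt V Y N c :=
  Submodule.span_mono fun _ ⟨q, s, y, h1, h2, h3⟩ => ⟨q, s, y, h1, h2.trans_le h, h3⟩

lemma Adapted.FQ_le {i : ℕ} {X : ℕ → ℤ → B} (S : L.Stable i) (hX : L.Adapted i X) (b : ℕ) :
    L.FQ i b ≤ lt (Vp n i) X (qq (Vp n i) X (L.PP (i + 1))) b := by
  induction b using Nat.strong_induction_on with
  | _ b ih =>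
  refine Submodule.span_le.2 ?_
  rintro _ ⟨c, s, y, hc, hcb, hy, rfl⟩
  obtain ⟨k, q, hq, h⟩ := hX.exists_eq' s hc
  rw [h, add_mul, smul_mul_assoc]
  exact add_mem (smulR (zpow_mem_RR v k) (mem_lt s hc hcb (hX.QQ_le _ hy)))
    (lt_mono hcb.le (ih c hcb (L.QQ_mul_Q S hq hy)))

lemma XX_mul_QQ {i b : ℕ} (S : L.Stable i) (hb : Vp n i b) (s : ℤ) {q : B}
    (hq : q ∈ L.QQ i b) : L.XX i b s * q ∈ L.FQ i b := by
  refine mul_span hq ?_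
  rintro _ ⟨c, r, y, hc, hcb, hy, rfl⟩
  rw [← mul_assoc]
  exact L.FQ_mul (L.XX_mul_XX S hc hb hcb s r) hy

lemma Adapted.mul_sub {i a b : ℕ} {X : ℕ → ℤ → B} (S : L.Stable i) (hX : L.Adapted i X)
    (ha : Vp n i a) (hb : Vp n i b) (hab : a ≤ b) (s r : ℤ) :
    ∃ k : ℤ, X b s * X a r - v ^ k • (L.XX i b s * L.XX i a r) ∈ L.FQ i b := by
  obtain ⟨k, q, hq, h⟩ := hX.exists_eq s hb
  obtain ⟨k', q', hq', h'⟩ := hX.exists_eq r ha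
  have e : X b s * X a r - v ^ (k + k') • (L.XX i b s * L.XX i a r) =
      v ^ k • (L.XX i b s * q') + q * X a r := by
    rw [h, zpow_add₀ L.v_ne, add_mul, mul_smul, h', mul_add]
    simp only [smul_mul_assoc, mul_smul_comm]
    rw [smul_comm (v ^ k') (v ^ k)]
    abel
  refine ⟨k + k', ?_⟩
  rw [e]
  exact add_mem (smulR (zpow_mem_RR v k) (XX_mul_QQ S hb s (L.QQ_mono hab hq')))
    (L.QQ_mul_Q S hq (hX.mem_Q r S.pos S.le ha))

lemma Adapted.str {i : ℕ} {X : ℕ → ℤ → B} (S : L.Stable i) (hX : L.Adapted i X) :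
    Str (Vp n i) X (L.PP (i + 1)) where
  left y hy x hx := hX.QQ_le _ (L.PP_mul_Q S hy x (hX.qq_le S.pos S.le hx))
  lower a b s r ha hb hab := by
    apply hX.FQ_le S
    obtain ⟨k, hk⟩ := hX.mul_sub S ha hb hab.le s r
    have := add_mem hk (smulR (zpow_mem_RR v k) (L.XX_mul_XX S ha hb hab s r))
    simpa using this
  square b s r hb hrs := by
    have hle := hX.FQ_le S b
    obtain ⟨k, hk⟩ := hX.mul_sub S hb hb le_rfl s r
    have h1 : L.XX i b s * L.XX i b r ∈
        Sorting.sq X b r s ⊔ lt (Vp n i) X (qq (Vp n i) X (L.PP (i + 1))) b := by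
      have h2 := (L.Rq_EE (fun _ => 0) i S.pos S.le b hb).mul_mem (s - r - 1).toNat s r (by omega)
      have e : L.XX i b s * L.XX i b r = ((v - v⁻¹) * (v - v⁻¹)) •
          ((fun s => L.EE (fun _ => 0) i s b) s * (fun s => L.EE (fun _ => 0) i s b) r) := by
        simp only [XX, smul_mul_assoc, mul_smul_comm, mul_smul]
      rw [e]
      set N := Sorting.sq X b r s ⊔ lt (Vp n i) X (qq (Vp n i) X (L.PP (i + 1))) b
      have : sqs v (fun s => L.EE (fun _ => 0) i s b) r s ≤
          N.comap ((LinearMap.lsmul F B ((v - v⁻¹) * (v - v⁻¹))).restrictScalars (RR v)) := by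
        refine Submodule.span_le.2 ?_
        rintro _ ⟨s', r', h3, h4, h5, rfl⟩
        change ((v - v⁻¹) * (v - v⁻¹)) • _ ∈ N
        have e' : ((v - v⁻¹) * (v - v⁻¹)) • (L.EE (fun _ => 0) i s' b *
            L.EE (fun _ => 0) i r' b) = L.XX i b s' * L.XX i b r' := by
          simp only [XX, smul_mul_assoc, mul_smul_comm, mul_smul]
        rw [e']
        obtain ⟨k, hk⟩ := hX.mul_sub S hb hb le_rfl s' r'
        have h6 : X b s' * X b r' ∈ N := Submodule.mem_sup_left
          (Submodule.subset_span ⟨s', r', h3, h4, h5, rfl⟩)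
        have h7 := sub_mem h6 (show _ ∈ N from Submodule.mem_sup_right (hle hk))
        rw [sub_sub_cancel] at h7
        have h8 := smulR (zpow_mem_RR v (-k)) h7
        rwa [← mul_smul, ← zpow_add₀ L.v_ne, neg_add_cancel, zpow_zero, one_smul] at h8
      exact this h2
    have := add_mem (Submodule.mem_sup_right (hle hk)) (smulR (zpow_mem_RR v k) h1)
    simpa using this

variable (L)

/-- an element attached to a triple (block, position, degree). -/
def ev3 (X : ℕ → ℕ → ℤ → B) (x : ℕ ×ₗ (ℕ ×ₗ ℤ)) : B :=
  X (ofLex x).1 (ofLex (ofLex x).2).1 (ofLex (ofLex x).2).2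

lemma PP_eq_bot {i : ℕ} (hi : n < i) {x : B} (hx : x ∈ L.PP i) :
    ∃ c : RR v, x = algebraMap (RR v) B c := by
  have : L.PP i = ⊥ := by
    refine eq_bot_iff.2 (Algebra.adjoin_le ?_)
    rintro _ ⟨i', p, s, h1, h2, h3⟩
    omega
  rw [this, Algebra.mem_bot] at hx
  obtain ⟨c, hc⟩ := hx
  exact ⟨c, hc.symm⟩

lemma PP_le_adjoin {i : ℕ} {X : ℕ → ℤ → B} (hX : L.Adapted i X) {x : B} (hx : x ∈ L.PP i) :
    x ∈ Algebra.adjoin (RR v) ({z | ∃ c s, Vp n i c ∧ z = X c s} ∪ (L.PP (i + 1) : Set B)) := by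
  set A := Algebra.adjoin (RR v) ({z | ∃ c s, Vp n i c ∧ z = X c s} ∪ (L.PP (i + 1) : Set B))
  have h1 : ∀ p s, Vp n i p → X p s ∈ A := fun p s hp =>
    Algebra.subset_adjoin (Or.inl ⟨p, s, hp, rfl⟩)
  have h2 : L.PP (i + 1) ≤ A := fun y hy => Algebra.subset_adjoin (Or.inr hy)
  have h3 : Sorting.qq (Vp n i) X (L.PP (i + 1)) ≤ Subalgebra.toSubmodule A := by
    refine Submodule.span_le.2 ?_
    rintro _ ⟨c, s, y, hc, hy, rfl⟩
    exact A.mul_mem (h1 c s hc) (h2 hy)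
  refine (Algebra.adjoin_le ?_ : L.PP i ≤ A) hx
  rintro _ ⟨i', p, s, h4, h5, h6, rfl⟩
  rcases eq_or_lt_of_le h4 with rfl | h4
  · exact h3 (hX.QQ_le _ (L.mem_QQ' s h6 (Nat.lt_succ_self p)))
  · exact h2 (L.XX_mem s h4 h5 h6)

/-- `PP i` is spanned by the ordered products in any adapted families. -/
theorem PP_mem_span {X : ℕ → ℕ → ℤ → B} (hX : ∀ i, 1 ≤ i → i ≤ n → L.Adapted i (X i)) {k : ℕ} :
    ∀ i, 1 ≤ i → i + k = n + 1 → ∀ x ∈ L.PP i, x ∈ Submodule.span (RR v)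
      {z | ∃ l : List (ℕ ×ₗ (ℕ ×ₗ ℤ)), l.Pairwise (· ≤ ·) ∧
        (∀ a ∈ l, i ≤ (ofLex a).1 ∧ (ofLex a).1 ≤ n ∧ Vp n (ofLex a).1 (ofLex (ofLex a).2).1) ∧
        z = (l.map (ev3 X)).prod} := by
  induction k with
  | zero =>
    intro i hi hk x hx
    obtain ⟨c, rfl⟩ := L.PP_eq_bot (by omega) hx
    rw [Algebra.algebraMap_eq_smul_one]
    exact Submodule.smul_mem _ _ (Submodule.subset_span ⟨[], by simp, by simp, by simp⟩)
  | succ k ih =>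
    intro i hi hk x hx
    have hXi := hX i hi (by omega)
    have := mem_span_of_mem_adjoin (hXi.str (L.stable hi (by omega))) (L.PP_le_adjoin hXi hx)
    refine (Submodule.span_le.2 ?_ : Submodule.span (RR v) _ ≤ _) this
    rintro _ ⟨l, y, h1, h2, h3, rfl⟩
    refine mul_span (ih (i + 1) (by omega) (by omega) y h3) ?_
    rintro _ ⟨l', h4, h5, rfl⟩
    refine Submodule.subset_span ⟨l.map (fun a => toLex (i, a)) ++ l', ?_, ?_, ?_⟩
    · rw [List.pairwise_append]
      refine ⟨?_, h4, ?_⟩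
      · rw [List.pairwise_map]
        refine h1.imp ?_
        intro a b hab
        rw [Prod.Lex.toLex_le_toLex]
        exact Or.inr ⟨rfl, hab⟩
      · intro a ha b hb
        obtain ⟨a, _, rfl⟩ := List.mem_map.1 ha
        rw [Prod.Lex.le_iff]
        left
        have := (h5 b hb).1
        simp only [ofLex_toLex]
        omega
    · intro a ha
      rcases List.mem_append.1 ha with ha | ha
      · obtain ⟨b, hb, rfl⟩ := List.mem_map.1 ha
        exact ⟨le_rfl, by simp only [ofLex_toLex]; omega, h2 b hb⟩
      · have := h5 a ha
        exact ⟨by omega, this.2⟩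
    · rw [List.map_append, List.prod_append, List.map_map]
      rfl

lemma X_mem_PP {X : ℕ → ℕ → ℤ → B} (hX : ∀ i, 1 ≤ i → i ≤ n → L.Adapted i (X i)) {i p : ℕ}
    (s : ℤ) (hi : 1 ≤ i) (hin : i ≤ n) (hp : Vp n i p) : X i p s ∈ L.PP 1 :=
  L.PP_mono hi (L.QQ_le_PP hin ((hX i hi hin).mem_Q s hi hin hp))

end LoopAlg

section Present

lemma vv_sub_inv_ne_zero : (vv - vv⁻¹ : KK) ≠ 0 := by
  have h0 := vv_ne_zero
  have h : (vv - vv⁻¹ : KK) = (vv ^ 2 - 1) / vv := by field_simp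
  rw [h]
  exact div_ne_zero vv_sq_sub_one_ne_zero h0

lemma vv_add_inv_ne_zero : (vv + vv⁻¹ : KK) ≠ 0 := by
  have h0 := vv_ne_zero
  have h : (vv + vv⁻¹ : KK) = (vv ^ 2 + 1) / vv := by field_simp
  rw [h]
  exact div_ne_zero vv_sq_add_one_ne_zero h0

lemma qInt_one : qInt vv 1 = 1 := by
  have := vv_sub_inv_ne_zero
  simp only [qInt, Nat.cast_one, zpow_one, zpow_neg]
  exact div_self this

lemma qInt_two : qInt vv 2 = vv + vv⁻¹ := by
  have h1 := vv_sub_inv_ne_zero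
  rw [qInt, div_eq_iff h1]
  rw [zpow_neg, zpow_natCast]
  have h0 := vv_ne_zero
  field_simp
  ring

lemma qFact_zero : qFact vv 0 = 1 := by simp [qFact]
lemma qFact_one : qFact vv 1 = 1 := by simp [qFact, qInt_one]
lemma qFact_two : qFact vv 2 = vv + vv⁻¹ := by
  simp [qFact, Finset.prod_range_succ, qInt_one, qInt_two]

variable {n : ℕ}

lemma vpow_dD (i : ℕ) : vpow (dD n i) = vv := by simp [vpow, dD]

lemma serreElt_one (i j : Fin n) (r : Fin 1 → ℤ) (t : ℤ) :
    serreElt n (dD n) i j 1 r t = fg n j t * fg n i (r 0) - fg n i (r 0) * fg n j t := by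
  simp [serreElt, Finset.sum_range_succ, vpow_dD, qBinom, qFact_zero, qFact_one, sub_eq_add_neg]

lemma serreElt_two (i j : Fin n) (r : Fin 2 → ℤ) (t : ℤ) :
    serreElt n (dD n) i j 2 r t =
      (fg n i (r 0) * fg n i (r 1) * fg n j t
        - (vv + vv⁻¹) • (fg n i (r 0) * fg n j t * fg n i (r 1))
        + fg n j t * fg n i (r 0) * fg n i (r 1)) +
      (fg n i (r 1) * fg n i (r 0) * fg n j t
        - (vv + vv⁻¹) • (fg n i (r 1) * fg n j t * fg n i (r 0))
        + fg n j t * fg n i (r 1) * fg n i (r 0)) := by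
  have h := vv_add_inv_ne_zero
  have h2 := qFact_two
  generalize vv + vv⁻¹ = q at h h2 ⊢
  have hu : (Finset.univ : Finset (Equiv.Perm (Fin 2))) = {1, Equiv.swap 0 1} := by decide
  rw [serreElt, hu, Finset.sum_pair (by decide)]
  simp only [Finset.sum_range_succ, Finset.sum_range_zero, vpow_dD, qBinom, qFact_zero, qFact_one,
    h2, List.ofFn_succ, List.ofFn_zero, Fin.succ_zero_eq_one, Equiv.swap_apply_left,
    Equiv.swap_apply_right, Equiv.Perm.one_apply]
  simp [h, mul_assoc, qFact_zero, qFact_one]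
  abel

lemma aD_ne {i j : ℕ} (h : i ≠ j) : aD n i j = 0 ∨ aD n i j = -1 := by
  unfold aD; split_ifs <;> simp_all

end Present

section LiftHom
variable {n : ℕ} {B : Type} [Ring B] [Algebra KK B]

/-- universal property of `U_v^>(Lo_{2n})` with explicit relations. -/
def liftUD (g : Fin n → ℤ → B)
    (h1 : ∀ (i j : Fin n) r s, g i (r + 1) * g j s - vv ^ aD n (i + 1) (j + 1) • (g i r * g j (s + 1)) =
      vv ^ aD n (i + 1) (j + 1) • (g j s * g i (r + 1)) - g j (s + 1) * g i r)
    (h2 : ∀ (i j : Fin n) r s, aD n (i + 1) (j + 1) = 0 → g i r * g j s = g j s * g i r)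
    (h3 : ∀ (i j : Fin n) r s t, aD n (i + 1) (j + 1) = -1 →
      (g i r * g i s * g j t - (vv + vv⁻¹) • (g i r * g j t * g i s) + g j t * g i r * g i s) +
      (g i s * g i r * g j t - (vv + vv⁻¹) • (g i s * g j t * g i r) + g j t * g i s * g i r) = 0) :
    UD n →ₐ[KK] B :=
  RingQuot.liftAlgHom KK ⟨FreeAlgebra.lift KK fun p => g p.1 p.2, by
    rintro _ _ (⟨i, j, r, s⟩ | ⟨i, j, hij, r, t⟩)
    · have := h1 i j r s
      simp only [map_sub, map_mul, map_smul, fg, FreeAlgebra.lift_ι_apply]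
      simpa [vpow, dD] using this
    · have hij' : (i : ℕ) + 1 ≠ j + 1 := fun h => hij (Fin.ext (by omega))
      rw [map_zero]
      generalize hm : (1 - aD n (i + 1) (j + 1)).toNat = m at r
      rcases aD_ne (n := n) hij' with h | h
      · obtain rfl : m = 1 := by rw [← hm, h]; rfl
        rw [serreElt_one]
        simp only [map_sub, map_mul, fg, FreeAlgebra.lift_ι_apply]
        rw [h2 i j _ _ h, sub_self]
      · obtain rfl : m = 2 := by rw [← hm, h]; rfl
        rw [serreElt_two]
        have := h3 i j (r 0) (r 1) t h
        simpa only [map_sub, map_add, map_mul, map_smul, fg, FreeAlgebra.lift_ι_apply] using this⟩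

lemma liftUD_ug (g : Fin n → ℤ → B) (h1 h2 h3) (i : Fin n) (r : ℤ) :
    liftUD g h1 h2 h3 (ug n (aD n) (dD n) i r) = g i r := by
  simp [liftUD, ug, fg]

lemma ug_loop (i j : Fin n) (r s : ℤ) :
    ug n (aD n) (dD n) i (r + 1) * ug n (aD n) (dD n) j s
      - vv ^ aD n (i + 1) (j + 1) • (ug n (aD n) (dD n) i r * ug n (aD n) (dD n) j (s + 1)) =
    vv ^ aD n (i + 1) (j + 1) • (ug n (aD n) (dD n) j s * ug n (aD n) (dD n) i (r + 1))
      - ug n (aD n) (dD n) j (s + 1) * ug n (aD n) (dD n) i r := by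
  have := RingQuot.mkAlgHom_rel KK (URel.loop (n := n) (A := aD n) (Dd := dD n) i j r s)
  simpa [vpow, dD, ug] using this

lemma ug_serreElt (i j : Fin n) (hij : i ≠ j) (m : ℕ)
    (hm : (1 - aD n (i + 1) (j + 1)).toNat = m) (r : Fin m → ℤ) (t : ℤ) :
    RingQuot.mkAlgHom KK (URel n (aD n) (dD n)) (serreElt n (dD n) i j m r t) = 0 := by
  subst hm
  have := RingQuot.mkAlgHom_rel KK (URel.serre (n := n) (A := aD n) (Dd := dD n) i j hij r t)
  rwa [map_zero] at this

lemma ug_comm (i j : Fin n) (r s : ℤ) (h : aD n (i + 1) (j + 1) = 0) :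
    ug n (aD n) (dD n) i r * ug n (aD n) (dD n) j s =
      ug n (aD n) (dD n) j s * ug n (aD n) (dD n) i r := by
  have hij : i ≠ j := by rintro rfl; rw [aD_self] at h; omega
  have := ug_serreElt i j hij 1 (by rw [h]; rfl) (fun _ => r) s
  rw [serreElt_one, map_sub, map_mul, map_mul, sub_eq_zero] at this
  exact this.symm

lemma ug_serre (i j : Fin n) (r s t : ℤ) (h : aD n (i + 1) (j + 1) = -1) :
    (ug n (aD n) (dD n) i r * ug n (aD n) (dD n) i s * ug n (aD n) (dD n) j t
      - (vv + vv⁻¹) • (ug n (aD n) (dD n) i r * ug n (aD n) (dD n) j t * ug n (aD n) (dD n) i s)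
      + ug n (aD n) (dD n) j t * ug n (aD n) (dD n) i r * ug n (aD n) (dD n) i s) +
    (ug n (aD n) (dD n) i s * ug n (aD n) (dD n) i r * ug n (aD n) (dD n) j t
      - (vv + vv⁻¹) • (ug n (aD n) (dD n) i s * ug n (aD n) (dD n) j t * ug n (aD n) (dD n) i r)
      + ug n (aD n) (dD n) j t * ug n (aD n) (dD n) i s * ug n (aD n) (dD n) i r) = 0 := by
  have hij : i ≠ j := by rintro rfl; rw [aD_self] at h; omega
  have := ug_serreElt i j hij 2 (by rw [h]; rfl) ![r, s] t
  rw [serreElt_two] at this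
  simp only [map_sub, map_add, map_mul, map_smul, Matrix.cons_val_zero, Matrix.cons_val_one] at this
  exact this

/-- the torus action on `U_v^>(Lo_{2n})`. -/
def torus (n : ℕ) (μ : ℕ → ℤ) : UD n →ₐ[KK] UD n :=
  liftUD (fun i r => vv ^ μ (i + 1) • ug n (aD n) (dD n) i r)
    (by
      intro i j r s
      have := congrArg (fun x => (vv ^ μ (i + 1) * vv ^ μ (j + 1)) • x) (ug_loop i j r s)
      simp only [smul_sub, smul_smul, mul_assoc] at this
      simp only [smul_mul_assoc, mul_smul_comm, smul_smul, mul_comm, mul_assoc]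
      exact this)
    (by
      intro i j r s h
      simp only [smul_mul_assoc, mul_smul_comm, smul_smul]
      rw [ug_comm i j r s h, mul_comm])
    (by
      intro i j r s t h
      have := congrArg (fun x => (vv ^ μ (i + 1) * vv ^ μ (i + 1) * vv ^ μ (j + 1)) • x)
        (ug_serre i j r s t h)
      simp only [smul_sub, smul_add, smul_smul, smul_zero, mul_comm, mul_assoc] at this
      simp only [smul_mul_assoc, mul_smul_comm, smul_smul, mul_comm, mul_assoc]
      exact this)

lemma torus_ug (μ : ℕ → ℤ) (i : Fin n) (r : ℤ) :
    torus n μ (ug n (aD n) (dD n) i r) = vv ^ μ (i + 1) • ug n (aD n) (dD n) i r :=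
  liftUD_ug _ _ _ _ i r

lemma UD_hom_ext {f g : UD n →ₐ[KK] B}
    (h : ∀ i r, f (ug n (aD n) (dD n) i r) = g (ug n (aD n) (dD n) i r)) : f = g := by
  apply RingQuot.ringQuot_ext'
  apply FreeAlgebra.hom_ext
  funext p
  exact h p.1 p.2

lemma genD_eq {i : ℕ} (h : 1 ≤ i) (h' : i ≤ n) (r : ℤ) :
    genD n i r = ug n (aD n) (dD n) ⟨i - 1, by omega⟩ r := by
  simp [genD, g1, h, h']

/-- `U_v^>(Lo_{2n})` as a weight-graded loop algebra. -/
def loopUD (n : ℕ) : LoopAlg vv n (UD n) where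
  v_ne := vv_ne_zero
  v_add := vv_sq_add_one_ne_zero
  v_sub := vv_sq_sub_one_ne_zero
  e := genD n
  τ := torus n
  τ_e μ j r := by
    by_cases h : 1 ≤ j ∧ j ≤ n
    · rw [genD_eq h.1 h.2, torus_ug]
      simp only [Nat.sub_add_cancel h.1]
    · simp [genD, g1, h]
  τ_add μ ν x := by
    have : torus n (μ + ν) = (torus n μ).comp (torus n ν) := by
      apply UD_hom_ext
      intro i r
      rw [AlgHom.comp_apply, torus_ug, torus_ug, map_smul, torus_ug, smul_smul, Pi.add_apply,
        zpow_add₀ vv_ne_zero, mul_comm]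
    rw [this]; rfl
  τ_zero x := by
    have : torus n 0 = AlgHom.id KK _ := by
      apply UD_hom_ext
      intro i r
      rw [torus_ug]
      simp
    rw [this]; rfl
  loop i j r s h1 h2 h3 h4 := by
    have := ug_loop (n := n) ⟨i - 1, by omega⟩ ⟨j - 1, by omega⟩ r s
    simp only [Nat.sub_add_cancel h1, Nat.sub_add_cancel h3] at this
    simpa only [genD_eq h1 h2, genD_eq h3 h4] using this
  comm i j r s h1 h2 h3 h4 h := by
    have := ug_comm (n := n) ⟨i - 1, by omega⟩ ⟨j - 1, by omega⟩ r s
    simp only [Nat.sub_add_cancel h1, Nat.sub_add_cancel h3] at this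
    simpa only [genD_eq h1 h2, genD_eq h3 h4] using this h
  serre i j r s t h1 h2 h3 h4 h := by
    have := ug_serre (n := n) ⟨i - 1, by omega⟩ ⟨j - 1, by omega⟩ r s t
    simp only [Nat.sub_add_cancel h1, Nat.sub_add_cancel h3] at this
    simpa only [genD_eq h1 h2, genD_eq h3 h4] using this h

end LiftHom

section OrderedMonomials
variable {B : Type} [Ring B] {ι : Type} [LinearOrder ι]

lemma sort_toMultiset (h : ι →₀ ℕ) : (Finsupp.toMultiset h).sort (· ≤ ·) =
    (h.support.sort (· ≤ ·)).flatMap (fun p => List.replicate (h p) p) := by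
  have hp : ((Finsupp.toMultiset h).sort (· ≤ ·)).Perm
      ((h.support.sort (· ≤ ·)).flatMap (fun p => List.replicate (h p) p)) := by
    rw [← Multiset.coe_eq_coe, Multiset.sort_eq, Finsupp.toMultiset_apply, Finsupp.sum]
    rw [← Multiset.coe_bind]
    have : ((h.support.sort (· ≤ ·) : List ι) : Multiset ι) = h.support.val :=
      Finset.sort_eq _ _
    rw [this]
    simp only [Multiset.bind, Multiset.join, Multiset.nsmul_singleton]
    rfl
  refine hp.eq_of_pairwise (le := (· ≤ ·)) (fun a b _ _ => le_antisymm) ?_ ?_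
  · exact Multiset.pairwise_sort _ _
  · rw [List.pairwise_flatMap]
    refine ⟨fun a _ => ?_, ?_⟩
    · simp [List.pairwise_replicate]
    · refine (Finset.pairwise_sort h.support (· ≤ ·)).imp ?_
      intro a b hab x hx y hy
      rw [List.eq_of_mem_replicate hx, List.eq_of_mem_replicate hy]
      exact hab

lemma ordMon_eq (E : ι → B) (h : ι →₀ ℕ) :
    ordMon E h = (((Finsupp.toMultiset h).sort (· ≤ ·)).map E).prod := by
  rw [sort_toMultiset, ordMon, List.map_flatMap]
  generalize h.support.sort (· ≤ ·) = l
  induction l with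
  | nil => simp
  | cons a l ih => simp [ih, List.flatMap_cons]

lemma exists_ordMon (E : ι → B) {l : List ι} (hl : l.Pairwise (· ≤ ·)) :
    ∃ h : ι →₀ ℕ, (l.map E).prod = ordMon E h := by
  classical
  refine ⟨Multiset.toFinsupp (l : Multiset ι), ?_⟩
  rw [ordMon_eq, Multiset.toFinsupp_toMultiset]
  congr 2
  refine List.Perm.eq_of_pairwise (le := (· ≤ ·)) (fun a b _ _ => le_antisymm) hl ?_ ?_
  · exact Multiset.pairwise_sort _ _
  · rw [← Multiset.coe_eq_coe, Multiset.sort_eq]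

end OrderedMonomials

section RttForm
variable {n : ℕ}
open LoopAlg

/-- a triple encodes a positive root and a degree. -/
def IsTriple (n i p : ℕ) : Prop := 1 ≤ i ∧ i ≤ n ∧ Vp n i p

/-- the positive root at position `p` of block `i`. -/
def mkRoot {i p : ℕ} (h : IsTriple n i p) : PosRootD n :=
  ⟨toLex (⟨i, by have := h.2.1; omega⟩, ⟨p, by
    obtain ⟨h1, h2, h3⟩ := h
    unfold Vp at h3; omega⟩), by
    obtain ⟨h1, h2, h3⟩ := h
    unfold Vp at h3
    unfold IsPosRootD
    simp only [ofLex_toLex]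
    omega⟩

lemma isTriple (β : PosRootD n) : IsTriple n (riD β) (rtD β) := by
  obtain ⟨β, h⟩ := β
  have h' := h
  unfold IsPosRootD at h'
  unfold IsTriple Vp riD rtD
  have := (ofLex β).1.2
  simp only
  omega

lemma mkRoot_eq (β : PosRootD n) : mkRoot (isTriple β) = β := rfl

lemma mkRoot_lt {i p i' p' : ℕ} (h : IsTriple n i p) (h' : IsTriple n i' p')
    (hlt : i < i' ∨ i = i' ∧ p < p') : mkRoot h < mkRoot h' := by
  rw [← Subtype.coe_lt_coe]
  rw [mkRoot, mkRoot, Prod.Lex.toLex_lt_toLex]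
  simpa [Fin.lt_def, Fin.ext_iff] using hlt

lemma wordD_eq (β : PosRootD n) : wordD β = wd n (riD β) (rtD β) := rfl

lemma foldl_zip {C : Type} (u : KK) (t : ℕ → ℤ) (f : C → (ℕ × ℤ) × KK → C) (w : List ℕ) (a : C) :
    ((w.zip (w.map t)).zip (List.replicate w.length u)).foldl f a =
      w.foldl (fun x j => f x ((j, t j), u)) a := by
  induction w generalizing a with
  | nil => rfl
  | cons j w ih => simp [List.replicate_succ, ih]

lemma chainE_eq_chl (u : KK) (t : ℕ → ℤ) (w : List ℕ) :
    chainE (genD n) w (w.map t) (List.replicate (w.length - 1) u) = (loopUD n).chl u t w := by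
  cases w with
  | nil => rfl
  | cons i w =>
    simp only [chainE, List.map_cons, List.length_cons, Nat.add_sub_cancel, chl]
    rw [foldl_zip]
    rfl

lemma vpow_sgn (ε : Bool) : vpow (sgn ε) = vv ∨ vpow (sgn ε) = vv⁻¹ := by
  cases ε <;> simp [vpow, sgn]

lemma qBrack_one : qBrack 1 = vv - vv⁻¹ := by simp [qBrack, vpow]

lemma rttED_eq (ε : Bool) (β : PosRootD n) (t : ℕ → ℤ) :
    rttED ε β t = (vv - vv⁻¹) • (loopUD n).chl (vpow (sgn ε)) t (wd n (riD β) (rtD β)) := by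
  rw [rttED, qBrack_one, tildeED, chainE_eq_chl, wordD_eq]

open Classical in
/-- the normalized root vectors indexed by triples. -/
def rttX (ε : Bool) (T : PosRootD n × ℤ → (ℕ → ℤ)) (i p : ℕ) (s : ℤ) : UD n :=
  if h : IsTriple n i p then rttED ε (mkRoot h) (T (mkRoot h, s)) else 0

lemma rttX_adapted (ε : Bool) (T : PosRootD n × ℤ → (ℕ → ℤ)) (hT : ∀ p, sOfD p.1 (T p) = p.2)
    {i : ℕ} (hi : 1 ≤ i) (hin : i ≤ n) : (loopUD n).Adapted i (rttX ε T i) := by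
  intro p s hp
  have h : IsTriple n i p := ⟨hi, hin, hp⟩
  have h1 := (loopUD n).chl_cong (vpow_sgn ε) hi hin (T (mkRoot h, s)) p hp
  have h2 : ((wd n i p).map (T (mkRoot h, s))).sum = s := hT (mkRoot h, s)
  rw [h2] at h1
  rw [rttX, dif_pos h, rttED_eq]
  exact h1

lemma rttX_root (ε : Bool) (T : PosRootD n × ℤ → (ℕ → ℤ)) (p : PosRootD n × ℤ) :
    rttX ε T (riD p.1) (rtD p.1) p.2 = rttED ε p.1 (T p) := by
  rw [rttX, dif_pos (isTriple p.1), mkRoot_eq]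

lemma rttED_mem_PP (ε : Bool) (T : PosRootD n × ℤ → (ℕ → ℤ)) (hT : ∀ p, sOfD p.1 (T p) = p.2)
    (p : PosRootD n × ℤ) : rttED ε p.1 (T p) ∈ (loopUD n).PP 1 := by
  rw [← rttX_root]
  obtain ⟨h1, h2, h3⟩ := isTriple p.1
  exact (loopUD n).X_mem_PP (fun i hi hin => rttX_adapted ε T hT hi hin) p.2 h1 h2 h3

lemma algebraMap_mem_RttFormD (ε : Bool) (T : PosRootD n × ℤ → (ℕ → ℤ)) {c : KK}
    (hc : c ∈ RR vv) : algebraMap KK (UD n) c ∈ RttFormD ε T := by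
  have : RR vv ≤ (RttFormD ε T).comap (algebraMap KK (UD n)) := by
    refine Subring.closure_le.2 ?_
    rintro x (rfl | rfl)
    · exact Subring.subset_closure (Or.inl (by simp))
    · exact Subring.subset_closure (Or.inl (by simp))
  exact this hc

lemma RttFormD_le (ε : Bool) (T : PosRootD n × ℤ → (ℕ → ℤ)) (hT : ∀ p, sOfD p.1 (T p) = p.2)
    {x : UD n} (hx : x ∈ RttFormD ε T) : x ∈ (loopUD n).PP 1 := by
  have : RttFormD ε T ≤ ((loopUD n).PP 1).toSubring := by
    refine Subring.closure_le.2 ?_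
    rintro x ((rfl | rfl) | ⟨p, rfl⟩)
    · exact ((loopUD n).PP 1).algebraMap_mem ⟨vv, v_mem vv⟩
    · exact ((loopUD n).PP 1).algebraMap_mem ⟨vv⁻¹, v_inv_mem vv⟩
    · exact rttED_mem_PP ε T hT p
  exact this hx

/-- ordered monomials in the normalized root vectors. -/
abbrev rttMon (ε : Bool) (T : PosRootD n × ℤ → (ℕ → ℤ)) :
    (Lex (PosRootD n × ℤ) →₀ ℕ) → UD n :=
  ordMon (fun p => rttED ε (ofLex p).1 (T (ofLex p)))

lemma ordMon_mem {ι : Type} [LinearOrder ι] {B : Type} [Ring B] (S : Subring B) {E : ι → B}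
    (hE : ∀ p, E p ∈ S) (h : ι →₀ ℕ) : ordMon E h ∈ S := by
  rw [ordMon]
  refine Subring.list_prod_mem S ?_
  intro x hx
  obtain ⟨p, _, rfl⟩ := List.mem_map.1 hx
  exact pow_mem (hE p) _

lemma rttMon_mem (ε : Bool) (T : PosRootD n × ℤ → (ℕ → ℤ)) (h : Lex (PosRootD n × ℤ) →₀ ℕ) :
    rttMon ε T h ∈ RttFormD ε T :=
  ordMon_mem (RttFormD ε T) (fun p => Subring.subset_closure (Or.inr ⟨ofLex p, rfl⟩)) h

lemma PP_le_span (ε : Bool) (T : PosRootD n × ℤ → (ℕ → ℤ)) (hT : ∀ p, sOfD p.1 (T p) = p.2)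
    {x : UD n} (hx : x ∈ (loopUD n).PP 1) :
    x ∈ Submodule.span (RR vv) (Set.range (rttMon ε T)) := by
  by_cases hn : n = 0
  · subst hn
    obtain ⟨c, rfl⟩ := (loopUD 0).PP_eq_bot (by omega) hx
    rw [Algebra.algebraMap_eq_smul_one]
    exact Submodule.smul_mem _ _ (Submodule.subset_span ⟨0, by simp [ordMon]⟩)
  have := (loopUD n).PP_mem_span (k := n) (fun i hi hin => rttX_adapted ε T hT hi hin) 1 le_rfl
    (by omega) x hx
  refine (Submodule.span_mono ?_ : Submodule.span (RR vv) _ ≤ _) this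
  rintro _ ⟨l, h1, h2, rfl⟩
  have h2' : ∀ a ∈ l, IsTriple n (ofLex a).1 (ofLex (ofLex a).2).1 := h2
  obtain ⟨h, hh⟩ := exists_ordMon (fun p => rttED ε (ofLex p).1 (T (ofLex p)))
    (l := l.pmap (fun a ha => toLex (mkRoot ha, (ofLex (ofLex a).2).2)) h2') (by
      rw [List.pairwise_pmap]
      refine h1.imp ?_
      intro a b hab ha hb
      rw [Prod.Lex.toLex_le_toLex]
      rw [Prod.Lex.le_iff, Prod.Lex.le_iff] at hab
      simp only
      rcases hab with hab | ⟨hab, hab' | ⟨hab', hab''⟩⟩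
      · exact Or.inl (mkRoot_lt _ _ (Or.inl hab))
      · exact Or.inl (mkRoot_lt _ _ (Or.inr ⟨hab, hab'⟩))
      · right
        refine ⟨?_, hab''⟩
        apply Subtype.ext
        simp [mkRoot, hab, hab'])
  refine ⟨h, ?_⟩
  change ordMon _ h = _
  rw [← hh, List.map_pmap]
  congr 1
  rw [List.pmap_congr_left l (g := fun a _ => ev3 (rttX ε T) a) (H₂ := h2') ?_, List.pmap_eq_map]
  intro a _ ha _
  simp only [ofLex_toLex]
  rw [ev3, rttX, dif_pos ha]

lemma mem_RttFormD_iff (ε : Bool) (T : PosRootD n × ℤ → (ℕ → ℤ))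
    (hT : ∀ p, sOfD p.1 (T p) = p.2) (x : UD n) :
    x ∈ RttFormD ε T ↔ x ∈ Submodule.span (RR vv) (Set.range (rttMon ε T)) := by
  refine ⟨fun h => PP_le_span ε T hT (RttFormD_le ε T hT h), fun h => ?_⟩
  induction h using Submodule.span_induction with
  | mem x h => obtain ⟨h, rfl⟩ := h; exact rttMon_mem ε T h
  | zero => exact zero_mem _
  | add a b _ _ ha hb => exact add_mem ha hb
  | smul c a _ ha =>
    have e : c • a = algebraMap KK (UD n) c * a := by rw [← Algebra.smul_def]; rfl
    rw [e]
    exact mul_mem (algebraMap_mem_RttFormD ε T c.2) ha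

lemma mem_RttFormD_iff_PP (ε : Bool) (T : PosRootD n × ℤ → (ℕ → ℤ))
    (hT : ∀ p, sOfD p.1 (T p) = p.2) (x : UD n) :
    x ∈ RttFormD ε T ↔ x ∈ (loopUD n).PP 1 :=
  ⟨RttFormD_le ε T hT, fun h => (mem_RttFormD_iff ε T hT x).2 (PP_le_span ε T hT h)⟩

theorem RttFormD_indep (ε ε' : Bool) (T T' : PosRootD n × ℤ → (ℕ → ℤ))
    (hT : ∀ p, sOfD p.1 (T p) = p.2) (hT' : ∀ p, sOfD p.1 (T' p) = p.2) :
    RttFormD ε T = RttFormD ε' T' := by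
  ext x
  rw [mem_RttFormD_iff_PP ε T hT, mem_RttFormD_iff_PP ε' T' hT']

theorem RttFormD_spanned (ε : Bool) (T : PosRootD n × ℤ → (ℕ → ℤ))
    (hT : ∀ p, sOfD p.1 (T p) = p.2) (x : UD n) : x ∈ RttFormD ε T ↔
      ∃ c : (Lex (PosRootD n × ℤ) →₀ ℕ) →₀ KK, (∀ h, c h ∈ Rint) ∧
          x = c.sum fun h a => a • rttMon ε T h := by
  rw [mem_RttFormD_iff ε T hT, Finsupp.mem_span_range_iff_exists_finsupp]
  constructor
  · rintro ⟨c, rfl⟩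
    refine ⟨c.mapRange (fun a : RR vv => (a : KK)) rfl, fun h => (c h).2, ?_⟩
    rw [Finsupp.sum_mapRange_index (by simp)]
    rfl
  · rintro ⟨c, hc', rfl⟩
    have hc : ∀ h, c h ∈ RR vv := hc'
    refine ⟨Finsupp.onFinset c.support (fun h => (⟨c h, hc h⟩ : RR vv)) ?_, ?_⟩
    · intro h hh
      rw [Finsupp.mem_support_iff]
      intro h0
      exact hh (Subtype.ext h0)
    · refine (Finsupp.onFinset_sum _ ?_).trans rfl
      intro h
      exact zero_smul (RR vv) (rttMon ε T h)

end RttForm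

/-! ### Shuffle operators on functions of finite sets of variables -/

namespace Shuffle
variable {F : Type} [Field F] {V : Type} [DecidableEq V]

/-- product of `ζ a b` over `a ∈ S` and `b ∈ T`. -/
def zz (ζ : V → V → F) (S T : Finset V) : F := ∏ a ∈ S, ∏ b ∈ T, ζ a b

/-- the elementary shuffle operator attached to a set of variables. -/
def MM (ζ : V → V → F) (T : Finset V) : Module.End F (Finset V → F) where
  toFun f S := if T ⊆ S then zz ζ T (S \ T) * f (S \ T) else 0
  map_add' f g := by
    funext S
    simp only [Pi.add_apply]
    split_ifs <;> ring
  map_smul' c f := by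
    funext S
    simp only [Pi.smul_apply, smul_eq_mul, RingHom.id_apply]
    split_ifs <;> ring

lemma MM_apply (ζ : V → V → F) (T : Finset V) (f : Finset V → F) (S : Finset V) :
    MM ζ T f S = if T ⊆ S then zz ζ T (S \ T) * f (S \ T) else 0 := rfl

lemma MM_mul (ζ : V → V → F) (T T' : Finset V) :
    MM ζ T * MM ζ T' = if Disjoint T T' then zz ζ T T' • MM ζ (T ∪ T') else 0 := by
  apply LinearMap.ext
  intro f
  funext S
  rw [Module.End.mul_apply, MM_apply]
  by_cases hd : Disjoint T T'
  · rw [if_pos hd, LinearMap.smul_apply, Pi.smul_apply, MM_apply, MM_apply]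
    by_cases h : T ∪ T' ⊆ S
    · have h1 : T ⊆ S := Finset.union_subset_left h
      have h2 : T' ⊆ S \ T := by
        intro a ha
        exact Finset.mem_sdiff.2 ⟨Finset.union_subset_right h ha, fun h' =>
          (Finset.disjoint_left.1 hd h' ha)⟩
      rw [if_pos h1, if_pos h2, if_pos h, sdiff_sdiff_left, Finset.sup_eq_union]
      have e : S \ T = T' ∪ (S \ (T ∪ T')) := by
        ext a
        simp only [Finset.mem_sdiff, Finset.mem_union]
        have h3 : a ∈ T ∪ T' → a ∈ S := fun ha => h ha
        have h4 : a ∈ T → a ∉ T' := fun ha => Finset.disjoint_left.1 hd ha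
        simp only [Finset.mem_union] at h3 ⊢
        tauto
      have e2 : zz ζ T (S \ T) = zz ζ T T' * zz ζ T (S \ (T ∪ T')) := by
        rw [e, zz, zz, zz, ← Finset.prod_mul_distrib]
        refine Finset.prod_congr rfl fun a _ => Finset.prod_union ?_
        rw [Finset.disjoint_left]
        intro b hb hb'
        simp [hb] at hb'
      have e3 : zz ζ (T ∪ T') (S \ (T ∪ T')) =
          zz ζ T (S \ (T ∪ T')) * zz ζ T' (S \ (T ∪ T')) := by
        rw [zz, Finset.prod_union hd]; rfl
      rw [e2, e3, smul_eq_mul]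
      ring
    · rw [if_neg h, smul_zero]
      by_cases h1 : T ⊆ S
      · rw [if_pos h1, if_neg, mul_zero]
        intro h2
        exact h (Finset.union_subset h1 (h2.trans Finset.sdiff_subset))
      · rw [if_neg h1]
  · rw [if_neg hd, LinearMap.zero_apply, Pi.zero_apply, MM_apply]
    split_ifs with h1 h2
    · exact absurd (Finset.disjoint_left.2 fun a ha ha' =>
        (Finset.mem_sdiff.1 (h2 ha')).2 ha) hd
    · rw [mul_zero]
    · rfl

/-- the vacuum: the indicator function of the empty set. -/
def vac : Finset V → F := fun S => if S = ∅ then 1 else 0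

/-- the matrix coefficient of an operator at a set of variables. -/
def Φ (f : Module.End F (Finset V → F)) (A : Finset V) : F := f vac A

lemma Φ_add (f g : Module.End F (Finset V → F)) (A : Finset V) :
    Φ (f + g) A = Φ f A + Φ g A := rfl
lemma Φ_sub (f g : Module.End F (Finset V → F)) (A : Finset V) :
    Φ (f - g) A = Φ f A - Φ g A := rfl
lemma Φ_smul (c : F) (f : Module.End F (Finset V → F)) (A : Finset V) :
    Φ (c • f) A = c * Φ f A := rfl

lemma Φ_MM (ζ : V → V → F) (T A : Finset V) : Φ (MM ζ T) A = if T = A then 1 else 0 := by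
  rw [Φ, MM_apply, vac]
  by_cases h : T = A
  · subst h; simp [zz]
  · rw [if_neg h]
    split_ifs with h1 h2
    · exact absurd (h1.antisymm (Finset.sdiff_eq_empty_iff_subset.1 h2)) h
    · rw [mul_zero]
    · rfl

variable [Fintype V]

/-- the algebra of shuffle operators. -/
def WW (ζ : V → V → F) : Subalgebra F (Module.End F (Finset V → F)) :=
  (Submodule.span F (Set.range (MM ζ))).toSubalgebra
    (by
      have : (1 : Module.End F (Finset V → F)) = MM ζ ∅ := by
        apply LinearMap.ext; intro f; funext S
        simp [MM_apply, zz]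
      rw [this]
      exact Submodule.subset_span ⟨_, rfl⟩)
    (by
      intro x y hx hy
      have h1 : ∀ T, MM ζ T * y ∈ Submodule.span F (Set.range (MM ζ)) := by
        intro T
        refine Sorting.mul_span hy ?_
        rintro _ ⟨T', rfl⟩
        rw [MM_mul]
        split_ifs
        · exact Submodule.smul_mem _ _ (Submodule.subset_span ⟨_, rfl⟩)
        · exact zero_mem _
      refine Sorting.span_mul hx ?_
      rintro _ ⟨T, rfl⟩
      exact h1 T)

lemma MM_mem (ζ : V → V → F) (T : Finset V) : MM ζ T ∈ WW ζ :=
  Submodule.subset_span ⟨T, rfl⟩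

lemma eq_sum {ζ : V → V → F} {f : Module.End F (Finset V → F)} (hf : f ∈ WW ζ) :
    f = ∑ T, Φ f T • MM ζ T := by
  replace hf : f ∈ Submodule.span F (Set.range (MM ζ)) := hf
  induction hf using Submodule.span_induction with
  | mem x h =>
    obtain ⟨T, rfl⟩ := h
    simp [Φ_MM]
  | zero =>
    symm
    refine Finset.sum_eq_zero fun T _ => ?_
    have : Φ (0 : Module.End F (Finset V → F)) T = 0 := rfl
    rw [this, zero_smul]
  | add a b ha hb iha ihb =>
    conv_lhs => rw [iha, ihb]
    rw [← Finset.sum_add_distrib]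
    exact Finset.sum_congr rfl fun T _ => by rw [Φ_add, add_smul]
  | smul c a ha iha =>
    conv_lhs => rw [iha]
    rw [Finset.smul_sum]
    exact Finset.sum_congr rfl fun T _ => by rw [Φ_smul, mul_smul]

lemma Φ_mul {ζ : V → V → F} {f : Module.End F (Finset V → F)} (hf : f ∈ WW ζ)
    (g : Module.End F (Finset V → F)) (A : Finset V) :
    Φ (f * g) A = ∑ T ∈ A.powerset, Φ f T * zz ζ T (A \ T) * Φ g (A \ T) := by
  rw [Φ, Module.End.mul_apply]
  conv_lhs => rw [eq_sum hf]
  rw [LinearMap.sum_apply, Finset.sum_apply]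
  have e : A.powerset = Finset.univ.filter (· ⊆ A) := by ext; simp
  rw [e, Finset.sum_filter]
  refine Finset.sum_congr rfl fun T _ => ?_
  rw [LinearMap.smul_apply, Pi.smul_apply, MM_apply, smul_eq_mul]
  split_ifs
  · rw [mul_assoc]; rfl
  · rw [mul_zero]

/-- variables with colors and values in the base field. -/
structure Model (v : F) (n : ℕ) (V : Type) where
  col : V → ℕ
  x : V → F
  x_ne : ∀ a, x a ≠ 0
  x_inj : ∀ a b, a ≠ b → aD n (col a) (col b) ≠ 0 → x a ≠ x b

namespace Model
variable {v : F} {n : ℕ} (m : Model v n V)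

/-- the structure function of the shuffle algebra. -/
def ζ (a b : V) : F := if aD n (m.col a) (m.col b) = 0 then 1 else
  (v ^ aD n (m.col a) (m.col b) * m.x a - m.x b) / (m.x a - m.x b)

/-- creation of the variable `a`. -/
def y (a : V) : Module.End F (Finset V → F) := MM m.ζ {a}

lemma y_sq (a : V) : m.y a * m.y a = 0 := by simp [y, MM_mul]

lemma y_mul {a b : V} (h : a ≠ b) : m.y a * m.y b = m.ζ a b • MM m.ζ {a, b} := by
  rw [y, y, MM_mul, if_pos (by simpa using h), ← Finset.insert_eq]
  simp [zz]

lemma y_mul_mul {a b c : V} (hab : a ≠ b) (hac : a ≠ c) (hbc : b ≠ c) :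
    m.y a * m.y b * m.y c = (m.ζ a b * m.ζ a c * m.ζ b c) • MM m.ζ {a, b, c} := by
  rw [mul_assoc, m.y_mul hbc, mul_smul_comm, y, MM_mul, if_pos (by simp [hab, hac])]
  rw [← Finset.insert_eq, smul_smul, zz, Finset.prod_singleton, Finset.prod_pair hbc]
  congr 1
  ring

lemma y_aba (a b : V) : m.y a * m.y b * m.y a = 0 := by
  by_cases h : a = b
  · subst h; rw [m.y_sq, zero_mul]
  · rw [m.y_mul h, smul_mul_assoc, y, MM_mul, if_neg (by simp), smul_zero]

lemma ζ_rel {a b : V} (h : a ≠ b) :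
    (m.x a - v ^ aD n (m.col a) (m.col b) * m.x b) * m.ζ a b =
      (v ^ aD n (m.col a) (m.col b) * m.x a - m.x b) * m.ζ b a := by
  unfold ζ
  rw [aD_symm n (m.col b) (m.col a)]
  split_ifs with h0
  · simp [h0]
  · have h1 := sub_ne_zero.2 (m.x_inj a b h h0)
    have h2 : m.x b - m.x a ≠ 0 := by rw [← neg_sub]; exact neg_ne_zero.2 h1
    field_simp
    ring

lemma y_rel (a b : V) :
    (m.x a - v ^ aD n (m.col a) (m.col b) * m.x b) • (m.y a * m.y b) =
      (v ^ aD n (m.col a) (m.col b) * m.x a - m.x b) • (m.y b * m.y a) := by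
  by_cases h : a = b
  · subst h; rw [m.y_sq, smul_zero, smul_zero]
  · rw [m.y_mul h, m.y_mul (Ne.symm h), smul_smul, smul_smul, m.ζ_rel h, Finset.pair_comm]

lemma y_comm {a b : V} (h : aD n (m.col a) (m.col b) = 0) : m.y a * m.y b = m.y b * m.y a := by
  by_cases hab : a = b
  · subst hab; rfl
  · rw [m.y_mul hab, m.y_mul (Ne.symm hab), Finset.pair_comm]
    have h1 : m.ζ a b = 1 := if_pos h
    have h2 : m.ζ b a = 1 := if_pos (by rw [aD_symm, h])
    rw [h1, h2]

lemma y_serre (hv : v ≠ 0) {a b c : V} (hab : m.col a = m.col b)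
    (hac : aD n (m.col a) (m.col c) = -1) :
    (m.y a * m.y b * m.y c - (v + v⁻¹) • (m.y a * m.y c * m.y b) + m.y c * m.y a * m.y b) +
    (m.y b * m.y a * m.y c - (v + v⁻¹) • (m.y b * m.y c * m.y a) + m.y c * m.y b * m.y a) = 0 := by
  by_cases h : a = b
  · subst h
    rw [m.y_sq, m.y_aba, mul_assoc, m.y_sq]; simp
  have hbc : aD n (m.col b) (m.col c) = -1 := by rw [← hab]; exact hac
  have hca : aD n (m.col c) (m.col a) = -1 := by rw [aD_symm]; exact hac
  have hcb : aD n (m.col c) (m.col b) = -1 := by rw [aD_symm]; exact hbc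
  have haa : aD n (m.col a) (m.col b) = 2 := by rw [hab, aD_self]
  have hbb : aD n (m.col b) (m.col a) = 2 := by rw [hab, aD_self]
  have nac : a ≠ c := by rintro rfl; rw [aD_self] at hac; omega
  have nbc : b ≠ c := by rintro rfl; rw [aD_self] at hbc; omega
  rw [m.y_mul_mul h nac nbc, m.y_mul_mul nac h (Ne.symm nbc),
    m.y_mul_mul (Ne.symm nac) (Ne.symm nbc) h, m.y_mul_mul (Ne.symm h) nbc nac,
    m.y_mul_mul nbc (Ne.symm h) (Ne.symm nac), m.y_mul_mul (Ne.symm nbc) (Ne.symm nac) (Ne.symm h)]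
  have s1 : ({a, c, b} : Finset V) = {a, b, c} := by ext; simp; tauto
  have s2 : ({c, a, b} : Finset V) = {a, b, c} := by ext; simp; tauto
  have s3 : ({b, a, c} : Finset V) = {a, b, c} := by ext; simp; tauto
  have s4 : ({b, c, a} : Finset V) = {a, b, c} := by ext; simp; tauto
  have s5 : ({c, b, a} : Finset V) = {a, b, c} := by ext; simp; tauto
  rw [s1, s2, s3, s4, s5]
  simp only [smul_smul]
  have h1 := sub_ne_zero.2 (m.x_inj a b h (by omega))
  have h2 := sub_ne_zero.2 (m.x_inj a c nac (by omega))
  have h3 := sub_ne_zero.2 (m.x_inj b c nbc (by omega))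
  have h1' := sub_ne_zero.2 (m.x_inj a b h (by omega)).symm
  have h2' := sub_ne_zero.2 (m.x_inj a c nac (by omega)).symm
  have h3' := sub_ne_zero.2 (m.x_inj b c nbc (by omega)).symm
  have K : (m.ζ a b * m.ζ a c * m.ζ b c - (v + v⁻¹) * (m.ζ a c * m.ζ a b * m.ζ c b) +
      m.ζ c a * m.ζ c b * m.ζ a b) + (m.ζ b a * m.ζ b c * m.ζ a c -
      (v + v⁻¹) * (m.ζ b c * m.ζ b a * m.ζ c a) + m.ζ c b * m.ζ c a * m.ζ b a) = 0 := by
    simp only [ζ, hac, hbc, hca, hcb, haa, hbb]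
    have z2 : v ^ (2 : ℤ) = v ^ 2 := by norm_cast
    have n2 : ¬ (2 : ℤ) = 0 := by norm_num
    have n1 : ¬ (-1 : ℤ) = 0 := by norm_num
    simp only [if_neg n2, if_neg n1, z2, zpow_neg_one]
    have e1 : m.x b - m.x a = -(m.x a - m.x b) := by ring
    have e2 : m.x c - m.x a = -(m.x a - m.x c) := by ring
    have e3 : m.x c - m.x b = -(m.x b - m.x c) := by ring
    rw [e1, e2, e3]
    field_simp
    ring
  have K2 := congrArg (fun z => z • MM m.ζ {a, b, c}) K
  simp only [add_smul, sub_smul, mul_smul, zero_smul] at K2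
  simp only [add_smul, mul_smul]
  exact K2

/-- the shuffle operator of the generator `e_{i,r}`. -/
def ee (i : ℕ) (r : ℤ) : Module.End F (Finset V → F) :=
  ∑ a ∈ Finset.univ.filter (fun a => m.col a = i), m.x a ^ r • m.y a

lemma ee_mem (i : ℕ) (r : ℤ) : m.ee i r ∈ WW m.ζ :=
  sum_mem fun a _ => Subalgebra.smul_mem _ (MM_mem _ _) _

lemma ee_mul (i j : ℕ) (r s : ℤ) : m.ee i r * m.ee j s =
    ∑ a ∈ Finset.univ.filter (fun a => m.col a = i),
      ∑ b ∈ Finset.univ.filter (fun a => m.col a = j),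
        (m.x a ^ r * m.x b ^ s) • (m.y a * m.y b) := by
  rw [ee, ee, Finset.sum_mul_sum]
  refine Finset.sum_congr rfl fun a _ => Finset.sum_congr rfl fun b _ => ?_
  rw [smul_mul_smul_comm]

lemma ee_mul_mul (i j k : ℕ) (r s t : ℤ) : m.ee i r * m.ee j s * m.ee k t =
    ∑ a ∈ Finset.univ.filter (fun a => m.col a = i),
      ∑ b ∈ Finset.univ.filter (fun a => m.col a = j),
        ∑ c ∈ Finset.univ.filter (fun a => m.col a = k),
        (m.x a ^ r * m.x b ^ s * m.x c ^ t) • (m.y a * m.y b * m.y c) := by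
  rw [ee_mul, ee, Finset.sum_mul]
  refine Finset.sum_congr rfl fun a _ => ?_
  rw [Finset.sum_mul_sum]
  refine Finset.sum_congr rfl fun b _ => Finset.sum_congr rfl fun c _ => ?_
  rw [smul_mul_smul_comm]

lemma ee_loop (i j : ℕ) (r s : ℤ) :
    m.ee i (r + 1) * m.ee j s - v ^ aD n i j • (m.ee i r * m.ee j (s + 1)) =
      v ^ aD n i j • (m.ee j s * m.ee i (r + 1)) - m.ee j (s + 1) * m.ee i r := by
  simp only [ee_mul]
  rw [Finset.sum_comm (s := Finset.univ.filter (fun a => m.col a = j)),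
    Finset.sum_comm (s := Finset.univ.filter (fun a => m.col a = j))]
  simp only [Finset.smul_sum, ← Finset.sum_sub_distrib]
  refine Finset.sum_congr rfl fun a ha => Finset.sum_congr rfl fun b hb => ?_
  obtain rfl := (Finset.mem_filter.1 ha).2
  obtain rfl := (Finset.mem_filter.1 hb).2
  have h := congrArg (fun z => (m.x a ^ r * m.x b ^ s) • z) (m.y_rel a b)
  simp only [smul_smul] at h
  rw [zpow_add_one₀ (m.x_ne a), zpow_add_one₀ (m.x_ne b), smul_smul, smul_smul]
  rw [mul_sub, mul_sub, sub_smul, sub_smul] at h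
  have e1 : m.x a ^ r * m.x a * m.x b ^ s = m.x a ^ r * m.x b ^ s * m.x a := by ring
  have e2 : v ^ aD n (m.col a) (m.col b) * (m.x a ^ r * (m.x b ^ s * m.x b)) =
    m.x a ^ r * m.x b ^ s * (v ^ aD n (m.col a) (m.col b) * m.x b) := by ring
  have e3 : v ^ aD n (m.col a) (m.col b) * (m.x b ^ s * (m.x a ^ r * m.x a)) =
    m.x a ^ r * m.x b ^ s * (v ^ aD n (m.col a) (m.col b) * m.x a) := by ring
  have e4 : m.x b ^ s * m.x b * m.x a ^ r = m.x a ^ r * m.x b ^ s * m.x b := by ring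
  rw [e1, e2, e3, e4]
  exact h

lemma ee_comm {i j : ℕ} (h : aD n i j = 0) (r s : ℤ) :
    m.ee i r * m.ee j s = m.ee j s * m.ee i r := by
  simp only [ee_mul]
  rw [Finset.sum_comm]
  refine Finset.sum_congr rfl fun b hb => Finset.sum_congr rfl fun a ha => ?_
  obtain rfl := (Finset.mem_filter.1 ha).2
  obtain rfl := (Finset.mem_filter.1 hb).2
  rw [m.y_comm h, mul_comm]

lemma ee_serre (hv : v ≠ 0) {i j : ℕ} (h : aD n i j = -1) (r s t : ℤ) :
    (m.ee i r * m.ee i s * m.ee j t - (v + v⁻¹) • (m.ee i r * m.ee j t * m.ee i s)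
      + m.ee j t * m.ee i r * m.ee i s) +
    (m.ee i s * m.ee i r * m.ee j t - (v + v⁻¹) • (m.ee i s * m.ee j t * m.ee i r)
      + m.ee j t * m.ee i s * m.ee i r) = 0 := by
  set I := Finset.univ.filter (fun a => m.col a = i) with hI
  set J := Finset.univ.filter (fun a => m.col a = j) with hJ
  have e1 : ∀ r s, m.ee i r * m.ee j t * m.ee i s = ∑ a ∈ I, ∑ b ∈ I, ∑ c ∈ J,
      (m.x a ^ r * m.x b ^ s * m.x c ^ t) • (m.y a * m.y c * m.y b) := by
    intro r s
    rw [ee_mul_mul]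
    refine Finset.sum_congr rfl fun a _ => ?_
    rw [Finset.sum_comm]
    refine Finset.sum_congr rfl fun b _ => Finset.sum_congr rfl fun c _ => ?_
    congr 1; ring
  have e2 : ∀ r s, m.ee j t * m.ee i r * m.ee i s = ∑ a ∈ I, ∑ b ∈ I, ∑ c ∈ J,
      (m.x a ^ r * m.x b ^ s * m.x c ^ t) • (m.y c * m.y a * m.y b) := by
    intro r s
    rw [ee_mul_mul, Finset.sum_comm]
    refine Finset.sum_congr rfl fun a _ => ?_
    rw [Finset.sum_comm]
    refine Finset.sum_congr rfl fun b _ => Finset.sum_congr rfl fun c _ => ?_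
    congr 1; ring
  have e3 : ∀ f : V → V → V → Module.End F (Finset V → F),
      (∑ a ∈ I, ∑ b ∈ I, ∑ c ∈ J, f a b c) = ∑ a ∈ I, ∑ b ∈ I, ∑ c ∈ J, f b a c :=
    fun f => Finset.sum_comm
  rw [e1, e2, e1, e2, ee_mul_mul, ee_mul_mul, ← hI, ← hJ]
  rw [e3 (fun a b c => (m.x a ^ s * m.x b ^ r * m.x c ^ t) • (m.y a * m.y b * m.y c)),
    e3 (fun a b c => (m.x a ^ s * m.x b ^ r * m.x c ^ t) • (m.y a * m.y c * m.y b)),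
    e3 (fun a b c => (m.x a ^ s * m.x b ^ r * m.x c ^ t) • (m.y c * m.y a * m.y b))]
  simp only [Finset.smul_sum, ← Finset.sum_sub_distrib, ← Finset.sum_add_distrib]
  refine Finset.sum_eq_zero fun a ha => Finset.sum_eq_zero fun b hb =>
    Finset.sum_eq_zero fun c hc => ?_
  have ha' := (Finset.mem_filter.1 ha).2
  have hb' := (Finset.mem_filter.1 hb).2
  have hc' := (Finset.mem_filter.1 hc).2
  have h1 := congrArg (fun z => (m.x a ^ r * m.x b ^ s * m.x c ^ t) • z)
    (m.y_serre hv (a := a) (b := b) (c := c) (by rw [ha', hb']) (by rw [ha', hc', h]))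
  rw [mul_comm (m.x b ^ s) (m.x a ^ r)]
  simp only [smul_add, smul_sub, smul_zero] at h1
  rw [smul_comm (v + v⁻¹), smul_comm (v + v⁻¹)]
  exact h1

end Model
end Shuffle

open Shuffle in
/-- the representation of `U_v^>(Lo_{2n})` by shuffle operators. -/
def shuffleRep {n : ℕ} {V : Type} [DecidableEq V] [Fintype V] (m : Model vv n V) :
    UD n →ₐ[KK] Module.End KK (Finset V → KK) :=
  liftUD (fun i r => m.ee (i + 1) r) (fun i j r s => m.ee_loop _ _ r s)
    (fun i j r s h => m.ee_comm h r s) (fun i j r s t h => m.ee_serre vv_ne_zero h r s t)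

lemma shuffleRep_genD {n : ℕ} {V : Type} [DecidableEq V] [Fintype V] (m : Shuffle.Model vv n V)
    {i : ℕ} (h : 1 ≤ i) (h' : i ≤ n) (r : ℤ) : shuffleRep m (genD n i r) = m.ee i r := by
  rw [genD_eq h h', shuffleRep, liftUD_ug]
  simp only [Nat.sub_add_cancel h]

/-! ### Regular rational functions at `v = 1` and their values -/

/-- `f` is regular at `v = 1`, with value `a`. -/
def Res (f : KK) (a : ℚ) : Prop :=
  ∃ p q : Polynomial ℚ, q.eval 1 ≠ 0 ∧ f * algebraMap _ KK q = algebraMap _ KK p ∧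
    p.eval 1 = a * q.eval 1

namespace Res

lemma poly (p : Polynomial ℚ) : Res (algebraMap _ KK p) (p.eval 1) :=
  ⟨p, 1, by simp, by simp, by simp⟩

lemma const (a : ℚ) : Res (algebraMap ℚ KK a) a := by
  have := poly (Polynomial.C a)
  rwa [Polynomial.eval_C, ← Polynomial.algebraMap_eq, ← IsScalarTower.algebraMap_apply] at this

lemma zero : Res 0 0 := by simpa using poly 0
lemma one : Res 1 1 := by simpa using poly 1
lemma natCast (k : ℕ) : Res k k := by simpa using const k
lemma intCast (k : ℤ) : Res k k := by simpa using const k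
lemma var : Res vv 1 := by simpa [RatFunc.algebraMap_X, vv] using poly Polynomial.X

lemma add {f g : KK} {a b : ℚ} (hf : Res f a) (hg : Res g b) : Res (f + g) (a + b) := by
  obtain ⟨p, q, h1, h2, h3⟩ := hf
  obtain ⟨p', q', h1', h2', h3'⟩ := hg
  refine ⟨p * q' + p' * q, q * q', ?_, ?_, ?_⟩
  · rw [Polynomial.eval_mul]; exact mul_ne_zero h1 h1'
  · rw [map_mul, map_add, map_mul, map_mul, ← h2, ← h2']; ring
  · simp only [Polynomial.eval_add, Polynomial.eval_mul, h3, h3']; ring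

lemma mul {f g : KK} {a b : ℚ} (hf : Res f a) (hg : Res g b) : Res (f * g) (a * b) := by
  obtain ⟨p, q, h1, h2, h3⟩ := hf
  obtain ⟨p', q', h1', h2', h3'⟩ := hg
  refine ⟨p * p', q * q', ?_, ?_, ?_⟩
  · rw [Polynomial.eval_mul]; exact mul_ne_zero h1 h1'
  · rw [map_mul, map_mul, ← h2, ← h2']; ring
  · simp only [Polynomial.eval_mul, h3, h3']; ring

lemma neg {f : KK} {a : ℚ} (hf : Res f a) : Res (-f) (-a) := by
  simpa using (intCast (-1)).mul hf

lemma sub {f g : KK} {a b : ℚ} (hf : Res f a) (hg : Res g b) : Res (f - g) (a - b) := by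
  rw [sub_eq_add_neg, sub_eq_add_neg]; exact hf.add hg.neg

lemma map_ne_zero {q : Polynomial ℚ} (h : q.eval 1 ≠ 0) : algebraMap _ KK q ≠ 0 := by
  intro h'
  rw [map_eq_zero_iff _ (RatFunc.algebraMap_injective ℚ)] at h'
  simp [h'] at h

lemma inv {f : KK} {a : ℚ} (hf : Res f a) (ha : a ≠ 0) : Res f⁻¹ a⁻¹ := by
  obtain ⟨p, q, h1, h2, h3⟩ := hf
  have hp : p.eval 1 ≠ 0 := by rw [h3]; exact mul_ne_zero ha h1
  have hp' := map_ne_zero hp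
  have hf : f ≠ 0 := by rintro rfl; rw [zero_mul] at h2; exact hp' h2.symm
  refine ⟨q, p, hp, ?_, ?_⟩
  · rw [← h2, inv_mul_cancel_left₀ hf]
  · rw [h3, inv_mul_cancel_left₀ ha]

lemma div {f g : KK} {a b : ℚ} (hf : Res f a) (hg : Res g b) (hb : b ≠ 0) :
    Res (f / g) (a / b) := by
  rw [div_eq_mul_inv, div_eq_mul_inv]; exact hf.mul (hg.inv hb)

lemma pow {f : KK} {a : ℚ} (hf : Res f a) (k : ℕ) : Res (f ^ k) (a ^ k) := by
  induction k with
  | zero => simpa using one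
  | succ k ih => rw [pow_succ, pow_succ]; exact ih.mul hf

lemma zpow {f : KK} {a : ℚ} (hf : Res f a) (ha : a ≠ 0) (k : ℤ) : Res (f ^ k) (a ^ k) := by
  obtain ⟨k, rfl | rfl⟩ := k.eq_nat_or_neg
  · simpa using hf.pow k
  · simpa using (hf.pow k).inv (pow_ne_zero _ ha)

lemma unique {f : KK} {a b : ℚ} (hf : Res f a) (hg : Res f b) : a = b := by
  obtain ⟨p, q, h1, h2, h3⟩ := hf
  obtain ⟨p', q', h1', h2', h3'⟩ := hg
  have : p * q' = p' * q := by
    apply RatFunc.algebraMap_injective ℚ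
    rw [map_mul, map_mul, ← h2, ← h2']; ring
  have h := congrArg (Polynomial.eval 1) this
  rw [Polynomial.eval_mul, Polynomial.eval_mul, h3, h3'] at h
  have : (a - b) * (q.eval 1 * q'.eval 1) = 0 := by linear_combination h
  rcases mul_eq_zero.1 this with h | h
  · linarith
  · exact absurd h (mul_ne_zero h1 h1')

lemma ne_zero {f : KK} {a : ℚ} (hf : Res f a) (ha : a ≠ 0) : f ≠ 0 := by
  rintro rfl
  exact ha (hf.unique zero)

lemma sum {ι : Type} (s : Finset ι) {f : ι → KK} {a : ι → ℚ} (h : ∀ i ∈ s, Res (f i) (a i)) :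
    Res (∑ i ∈ s, f i) (∑ i ∈ s, a i) := by
  classical
  induction s using Finset.induction_on with
  | empty => simpa using zero
  | insert i s hi ih =>
    rw [Finset.sum_insert hi, Finset.sum_insert hi]
    exact (h i (by simp)).add (ih fun j hj => h j (by simp [hj]))

lemma prod {ι : Type} (s : Finset ι) {f : ι → KK} {a : ι → ℚ} (h : ∀ i ∈ s, Res (f i) (a i)) :
    Res (∏ i ∈ s, f i) (∏ i ∈ s, a i) := by
  classical
  induction s using Finset.induction_on with
  | empty => simpa using one
  | insert i s hi ih =>
    rw [Finset.prod_insert hi, Finset.prod_insert hi]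
    exact (h i (by simp)).mul (ih fun j hj => h j (by simp [hj]))

end Res

/-- the local parameter `v - 1`. -/
def ϖ : KK := vv - 1

lemma ϖ_res : Res ϖ 0 := by simpa [ϖ] using Res.var.sub Res.one

lemma ϖ_eq : ϖ = algebraMap _ KK (Polynomial.X - Polynomial.C (1 : ℚ)) := by
  simp [ϖ, vv, RatFunc.algebraMap_X]

lemma ϖ_ne_zero : ϖ ≠ 0 := by
  rw [ϖ_eq, Ne, map_eq_zero_iff _ (RatFunc.algebraMap_injective ℚ)]
  exact Polynomial.X_sub_C_ne_zero 1

lemma Res.div_ϖ {f : KK} (h : Res f 0) : ∃ a, Res (f / ϖ) a := by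
  obtain ⟨p, q, h1, h2, h3⟩ := h
  rw [zero_mul] at h3
  obtain ⟨r, rfl⟩ := Polynomial.dvd_iff_isRoot.2 h3
  refine ⟨r.eval 1 / q.eval 1, r, q, h1, ?_, by field_simp⟩
  rw [div_mul_eq_mul_div, h2, map_mul, ← ϖ_eq, mul_div_cancel_left₀ _ ϖ_ne_zero]

lemma exists_res_ϖ_pow {f : KK} (hf : f ≠ 0) : ∃ k : ℤ, ∃ a, a ≠ 0 ∧ Res (f * ϖ ^ k) a := by
  obtain ⟨p, q, hq, rfl⟩ := IsFractionRing.div_surjective (A := Polynomial ℚ) f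
  have hq0 : q ≠ 0 := nonZeroDivisors.ne_zero hq
  have hp0 : p ≠ 0 := by rintro rfl; simp at hf
  obtain ⟨p', hp, hp'⟩ := Polynomial.exists_eq_pow_rootMultiplicity_mul_and_not_dvd p hp0 1
  obtain ⟨q', hq, hq'⟩ := Polynomial.exists_eq_pow_rootMultiplicity_mul_and_not_dvd q hq0 1
  rw [Polynomial.dvd_iff_isRoot, Polynomial.IsRoot] at hp' hq'
  generalize p.rootMultiplicity 1 = a at hp
  generalize q.rootMultiplicity 1 = b at hq
  refine ⟨(b : ℤ) - a, p'.eval 1 / q'.eval 1, div_ne_zero hp' hq', ?_⟩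
  have : (algebraMap _ KK p / algebraMap _ KK q) * ϖ ^ ((b : ℤ) - a) =
      algebraMap _ KK p' / algebraMap _ KK q' := by
    have h1 := Res.map_ne_zero hq'
    have h2 := ϖ_ne_zero
    rw [hp, hq, map_mul, map_mul, map_pow, map_pow, ← ϖ_eq, zpow_sub₀ h2, zpow_natCast,
      zpow_natCast]
    field_simp
  rw [this]
  exact (Res.poly p').div (Res.poly q') hq'

/-- a nonzero family of rational functions can be scaled to a regular family with a nonzero
value at `v = 1`. -/
lemma exists_scale {ι : Type} (c : ι →₀ KK) (hc : c ≠ 0) :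
    ∃ (d : KK) (a : ι → ℚ), (∀ i, Res (c i * d) (a i)) ∧ ∃ i, a i ≠ 0 := by
  classical
  have h : ∀ i : ι, ∃ k : ℤ, ∃ a, c i ≠ 0 → a ≠ 0 ∧ Res (c i * ϖ ^ k) a := by
    intro i
    by_cases h : c i = 0
    · exact ⟨0, 0, fun h' => absurd h h'⟩
    · obtain ⟨k, a, h1, h2⟩ := exists_res_ϖ_pow h
      exact ⟨k, a, fun _ => ⟨h1, h2⟩⟩
  choose k a h using h
  obtain ⟨i0, hi0, hmax⟩ := c.support.exists_max_image k (Finsupp.support_nonempty_iff.2 hc)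
  refine ⟨ϖ ^ k i0, fun i => if c i = 0 then 0 else if k i = k i0 then a i else 0, ?_, i0, ?_⟩
  · intro i
    dsimp only
    split_ifs with h1 h2
    · rw [h1, zero_mul]; exact Res.zero
    · rw [← h2]; exact (h i h1).2
    · have hlt : k i < k i0 := lt_of_le_of_ne (hmax i (by simpa using h1)) h2
      obtain ⟨m, hm⟩ : ∃ m : ℕ, k i0 = k i + ((m + 1 : ℕ) : ℤ) :=
        ⟨(k i0 - k i - 1).toNat, by push_cast; omega⟩
      rw [hm, zpow_add₀ ϖ_ne_zero, ← mul_assoc, zpow_natCast, pow_succ', ← mul_assoc]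
      simpa using ((h i h1).2.mul ϖ_res).mul (ϖ_res.pow m)
  · have h1 : c i0 ≠ 0 := by simpa using hi0
    simp only [if_neg h1, if_true]
    exact (h i0 h1).1

/-- `f` vanishes at `v = 1` to order at least `k`. -/
def OrdGe (k : ℕ) (f : KK) : Prop := ∃ a, Res (f / ϖ ^ k) a

namespace OrdGe

lemma zero (k : ℕ) : OrdGe k 0 := ⟨0, by simpa using Res.zero⟩

lemma add {k : ℕ} {f g : KK} (hf : OrdGe k f) (hg : OrdGe k g) : OrdGe k (f + g) := by
  obtain ⟨a, ha⟩ := hf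
  obtain ⟨b, hb⟩ := hg
  exact ⟨a + b, by rw [add_div]; exact ha.add hb⟩

lemma mul {k l : ℕ} {f g : KK} (hf : OrdGe k f) (hg : OrdGe l g) : OrdGe (k + l) (f * g) := by
  obtain ⟨a, ha⟩ := hf
  obtain ⟨b, hb⟩ := hg
  exact ⟨a * b, by rw [pow_add, mul_div_mul_comm]; exact ha.mul hb⟩

lemma of_res {f : KK} {a : ℚ} (h : Res f a) : OrdGe 0 f := ⟨a, by simpa using h⟩

lemma of_res_zero {f : KK} (h : Res f 0) : OrdGe 1 f := by simpa [OrdGe] using h.div_ϖ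

lemma res_of_lt {k l : ℕ} {f : KK} (h : OrdGe l f) (hkl : k < l) : Res (f / ϖ ^ k) 0 := by
  obtain ⟨a, ha⟩ := h
  obtain ⟨m, rfl⟩ := Nat.exists_eq_add_of_lt hkl
  have : f / ϖ ^ k = f / ϖ ^ (k + m + 1) * ϖ ^ (m + 1) := by
    have := ϖ_ne_zero
    rw [add_assoc, pow_add]
    field_simp
  rw [this]
  simpa using ha.mul (ϖ_res.pow (m + 1))

lemma mono {k l : ℕ} {f : KK} (h : OrdGe l f) (hkl : k ≤ l) : OrdGe k f := by
  rcases hkl.lt_or_eq with h' | rfl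
  · exact ⟨0, h.res_of_lt h'⟩
  · exact h

lemma sum {ι : Type} {k : ℕ} (s : Finset ι) {f : ι → KK} (h : ∀ i ∈ s, OrdGe k (f i)) :
    OrdGe k (∑ i ∈ s, f i) := by
  classical
  induction s using Finset.induction_on with
  | empty => simpa using zero k
  | insert i s hi ih =>
    rw [Finset.sum_insert hi]
    exact (h i (by simp)).add (ih fun j hj => h j (by simp [hj]))

end OrdGe

lemma res_κ : Res ((vv - vv⁻¹) / ϖ) 2 := by
  have h : (vv - vv⁻¹) / ϖ = 1 + vv⁻¹ := by
    have h1 := vv_ne_zero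
    have h2 : vv - 1 ≠ 0 := ϖ_ne_zero
    rw [ϖ]; field_simp; ring
  rw [h]
  have := Res.one.add (Res.var.inv one_ne_zero)
  norm_num at this
  exact this

lemma res_vpow_sub_one {A : ℤ} (h : A = 0 ∨ A = -1 ∨ A = 2) : Res ((vv ^ A - 1) / ϖ) A := by
  have h1 := vv_ne_zero
  have h2 : vv - 1 ≠ 0 := ϖ_ne_zero
  rcases h with rfl | rfl | rfl
  · simpa using Res.zero
  · have e : (vv ^ (-1 : ℤ) - 1) / ϖ = -vv⁻¹ := by
      rw [ϖ, zpow_neg_one]; field_simp; ring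
    rw [e]
    simpa using (Res.var.inv one_ne_zero).neg
  · have e : (vv ^ (2 : ℤ) - 1) / ϖ = vv + 1 := by
      have : vv ^ (2 : ℤ) = vv ^ 2 := by norm_cast
      rw [ϖ, this]; field_simp; ring
    rw [e]
    have := Res.var.add Res.one
    norm_num at this
    simpa using this

/-! ### Clustered variables and their limit at `v = 1` -/

namespace Shuffle

/-- variables grouped into clusters; the variables of the cluster `p` are labelled by the letters
of the word `W p`. -/
structure Clu (V P : Type) (W : P → List ℕ) where
  cl : V → P
  pos : V → ℕ
  inj : ∀ a b, cl a = cl b → pos a = pos b → a = b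
  lt : ∀ a, pos a < (W (cl a)).length
  ex : ∀ p k, k < (W p).length → ∃ a, cl a = p ∧ pos a = k
  w : P → ℚ
  w_ne : ∀ p, w p ≠ 0
  w_inj : ∀ p q, w p = w q → p = q

namespace Clu
variable {V P : Type} [DecidableEq V] [DecidableEq P] [Fintype V] {W : P → List ℕ} (C : Clu V P W)
  (n : ℕ)

/-- the color of a variable. -/
def col (a : V) : ℕ := (W (C.cl a)).getD (C.pos a) 0

/-- the value of a variable. -/
def xx (a : V) : KK := algebraMap ℚ KK (C.w (C.cl a)) * (1 - (C.pos a : KK) * ϖ)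

lemma xx_res (a : V) : Res (C.xx a) (C.w (C.cl a)) := by
  have := (Res.const (C.w (C.cl a))).mul (Res.one.sub ((Res.natCast (C.pos a)).mul ϖ_res))
  rwa [mul_zero, sub_zero, mul_one] at this

lemma xx_sub {a b : V} (h : C.cl a = C.cl b) : C.xx a - C.xx b =
    algebraMap ℚ KK (C.w (C.cl a)) * (((C.pos b : ℤ) - (C.pos a : ℤ) : ℤ) : KK) * ϖ := by
  rw [xx, xx, ← h]; push_cast; ring

lemma pos_ne {a b : V} (h : C.cl a = C.cl b) (hab : a ≠ b) :
    ((C.pos b : ℤ) - (C.pos a : ℤ) : ℤ) ≠ 0 := by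
  intro h'
  exact hab (C.inj a b h (by omega))

lemma algebraMap_w_ne (p : P) : algebraMap ℚ KK (C.w p) ≠ 0 :=
  (Res.const _).ne_zero (C.w_ne p)

lemma xx_ne {a b : V} (h : a ≠ b) : C.xx a - C.xx b ≠ 0 := by
  by_cases hc : C.cl a = C.cl b
  · rw [C.xx_sub hc]
    exact mul_ne_zero (mul_ne_zero (C.algebraMap_w_ne _) (Int.cast_ne_zero.2 (C.pos_ne hc h)))
      ϖ_ne_zero
  · exact ((C.xx_res a).sub (C.xx_res b)).ne_zero
      (sub_ne_zero.2 fun h' => hc (C.w_inj _ _ h'))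

/-- the model of clustered variables. -/
def mod : Model vv n V where
  col := C.col
  x := C.xx
  x_ne a := (C.xx_res a).ne_zero (C.w_ne _)
  x_inj a b h _ := sub_ne_zero.1 (C.xx_ne h)

/-- the structure function of the model. -/
abbrev ζ (a b : V) : KK := (C.mod n).ζ a b

lemma res_ζ_of_ne {a b : V} (h : C.cl a ≠ C.cl b) : Res (C.ζ n a b) 1 := by
  rw [ζ, Model.ζ]
  split_ifs
  · exact Res.one
  · have hw : C.w (C.cl a) - C.w (C.cl b) ≠ 0 := sub_ne_zero.2 fun h' => h (C.w_inj _ _ h')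
    have := (((Res.var.zpow one_ne_zero (aD n (C.col a) (C.col b))).mul (C.xx_res a)).sub
      (C.xx_res b)).div ((C.xx_res a).sub (C.xx_res b)) hw
    rwa [one_zpow, one_mul, div_self hw] at this

/-- the value at `v = 1` of the structure function inside a cluster. -/
def zr (A k l : ℤ) : ℚ := if A = 0 then 1 else ((A + l - k : ℤ) : ℚ) / ((l - k : ℤ) : ℚ)

lemma res_ζ_of_eq {a b : V} (h : C.cl a = C.cl b) (hab : a ≠ b) :
    Res (C.ζ n a b) (zr (aD n (C.col a) (C.col b)) (C.pos a) (C.pos b)) := by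
  have hA : aD n (C.col a) (C.col b) = 0 ∨ aD n (C.col a) (C.col b) = -1 ∨
      aD n (C.col a) (C.col b) = 2 := by
    by_cases h : C.col a = C.col b
    · rw [h, aD_self]; simp
    · rcases aD_ne (n := n) h with h | h <;> simp [h]
  have e : C.ζ n a b = if aD n (C.col a) (C.col b) = 0 then 1 else
    (vv ^ aD n (C.col a) (C.col b) * C.xx a - C.xx b) / (C.xx a - C.xx b) := rfl
  rw [e, zr]
  clear e
  split_ifs with h0
  · exact Res.one
  · generalize aD n (C.col a) (C.col b) = A at hA
    have hp := C.pos_ne h hab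
    have e : (vv ^ A * C.xx a - C.xx b) / (C.xx a - C.xx b) =
        ((vv ^ A - 1) / ϖ * (1 - (C.pos a : KK) * ϖ) + ((C.pos b - C.pos a : ℤ) : KK)) /
          ((C.pos b - C.pos a : ℤ) : KK) := by
      rw [C.xx_sub h]
      have h1 := ϖ_ne_zero
      have h2 := C.algebraMap_w_ne (C.cl a)
      have h3 : ((C.pos b - C.pos a : ℤ) : KK) ≠ 0 := Int.cast_ne_zero.2 hp
      rw [div_eq_div_iff (mul_ne_zero (mul_ne_zero h2 h3) h1) h3, xx, xx, ← h]
      field_simp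
      push_cast
      ring
    rw [e]
    have := (((res_vpow_sub_one hA).mul (Res.one.sub ((Res.natCast (C.pos a)).mul ϖ_res))).add
      (Res.intCast (C.pos b - C.pos a))).div (Res.intCast (C.pos b - C.pos a))
        (Int.cast_ne_zero.2 hp)
    convert this using 2
    push_cast
    ring

lemma exists_res_ζ {a b : V} (hab : a ≠ b) : ∃ z, Res (C.ζ n a b) z := by
  by_cases h : C.cl a = C.cl b
  · exact ⟨_, C.res_ζ_of_eq n h hab⟩
  · exact ⟨_, C.res_ζ_of_ne n h⟩

lemma exists_res_zz {S T : Finset V} (h : Disjoint S T) : ∃ z, Res (zz (C.ζ n) S T) z := by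
  have h' : ∀ a b, ∃ z, a ≠ b → Res (C.ζ n a b) z := by
    intro a b
    by_cases hab : a = b
    · exact ⟨0, fun h => absurd hab h⟩
    · obtain ⟨z, hz⟩ := C.exists_res_ζ n hab
      exact ⟨z, fun _ => hz⟩
  choose z hz using h'
  exact ⟨∏ a ∈ S, ∏ b ∈ T, z a b, Res.prod _ fun a ha => Res.prod _ fun b hb =>
    hz a b (fun hab => Finset.disjoint_left.1 h ha (hab ▸ hb))⟩

lemma res_zz_of_ne {S T : Finset V} (h : ∀ a ∈ S, ∀ b ∈ T, C.cl a ≠ C.cl b) :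
    Res (zz (C.ζ n) S T) 1 := by
  have := Res.prod S (f := fun a => ∏ b ∈ T, C.ζ n a b) (a := fun _ => 1) fun a ha => by
    simpa using Res.prod T (f := fun b => C.ζ n a b) (a := fun _ => 1) fun b hb =>
      C.res_ζ_of_ne n (h a ha b hb)
  rwa [Finset.prod_const_one] at this

/-- the number of clusters meeting a set of variables. -/
def nc (A : Finset V) : ℕ := (A.image C.cl).card

/-- operators with matrix coefficients divisible by `v - 1` as many times as there are clusters. -/
def Good (f : Module.End KK (Finset V → KK)) : Prop :=
  f ∈ WW (C.ζ n) ∧ ∀ A, OrdGe (C.nc A) (Φ f A)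

lemma good_one : C.Good n 1 := by
  refine ⟨one_mem _, fun A => ?_⟩
  by_cases h : A = ∅
  · subst h
    exact ⟨1, by simpa [nc, Φ, vac] using Res.one⟩
  · have : Φ (1 : Module.End KK (Finset V → KK)) A = 0 := if_neg h
    rw [this]
    exact OrdGe.zero _

lemma ordGe_term {f g : Module.End KK (Finset V → KK)} (hf : C.Good n f) (hg : C.Good n g)
    (T A : Finset V) : OrdGe (C.nc T + C.nc (A \ T))
      (Φ f T * zz (C.ζ n) T (A \ T) * Φ g (A \ T)) := by
  obtain ⟨z, hz⟩ := C.exists_res_zz n (S := T) (T := A \ T) Finset.disjoint_sdiff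
  exact ((hf.2 T).mul (OrdGe.of_res hz)).mul (hg.2 (A \ T))

lemma nc_le {T A : Finset V} (h : T ⊆ A) : C.nc A ≤ C.nc T + C.nc (A \ T) := by
  rw [nc, nc, nc]
  conv_lhs => rw [← Finset.union_sdiff_of_subset h, Finset.image_union]
  exact Finset.card_union_le _ _

lemma Good.mul {C : Clu V P W} {n : ℕ} {f g : Module.End KK (Finset V → KK)} (hf : C.Good n f)
    (hg : C.Good n g) : C.Good n (f * g) := by
  refine ⟨mul_mem hf.1 hg.1, fun A => ?_⟩
  rw [Φ_mul hf.1]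
  refine OrdGe.sum _ fun T hT => ?_
  exact (C.ordGe_term n hf hg T A).mono (C.nc_le (Finset.mem_powerset.1 hT))

lemma good_prod (l : List (Module.End KK (Finset V → KK))) (h : ∀ f ∈ l, C.Good n f) :
    C.Good n l.prod := by
  induction l with
  | nil => exact C.good_one n
  | cons f l ih =>
    rw [List.prod_cons]
    exact (h f (by simp)).mul (ih fun g hg => h g (by simp [hg]))

/-- all the variables of the given clusters. -/
def full (S : Finset P) : Finset V := Finset.univ.filter fun a => C.cl a ∈ S

lemma mem_full {S : Finset P} {a : V} : a ∈ C.full S ↔ C.cl a ∈ S := by simp [full]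

lemma image_full (hW : ∀ p, W p ≠ []) (S : Finset P) : (C.full S).image C.cl = S := by
  ext p
  simp only [Finset.mem_image, mem_full]
  constructor
  · rintro ⟨a, ha, rfl⟩; exact ha
  · intro hp
    obtain ⟨a, ha, -⟩ := C.ex p 0 (List.length_pos_iff.2 (hW p))
    exact ⟨a, ha ▸ hp, ha⟩

lemma nc_full (hW : ∀ p, W p ≠ []) (S : Finset P) : C.nc (C.full S) = S.card := by
  rw [nc, C.image_full hW]

/-- the limit at `v = 1` of the matrix coefficient at a union of clusters. -/
def ρ (f : Module.End KK (Finset V → KK)) (S : Finset P) : ℚ :=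
  open Classical in
  if h : ∃ a, Res (Φ f (C.full S) / ϖ ^ S.card) a then h.choose else 0

lemma ρ_eq {f : Module.End KK (Finset V → KK)} {S : Finset P} {a : ℚ}
    (h : Res (Φ f (C.full S) / ϖ ^ S.card) a) : C.ρ f S = a := by
  have h' : ∃ a, Res (Φ f (C.full S) / ϖ ^ S.card) a := ⟨a, h⟩
  rw [ρ, dif_pos h']
  exact h'.choose_spec.unique h

lemma Good.res {C : Clu V P W} {n : ℕ} (hW : ∀ p, W p ≠ []) {f : Module.End KK (Finset V → KK)}
    (hf : C.Good n f) (S : Finset P) : Res (Φ f (C.full S) / ϖ ^ S.card) (C.ρ f S) := by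
  obtain ⟨a, ha⟩ := hf.2 (C.full S)
  rw [C.nc_full hW] at ha
  rwa [C.ρ_eq ha]

lemma ρ_mul (hW : ∀ p, W p ≠ []) {f g : Module.End KK (Finset V → KK)} (hf : C.Good n f)
    (hg : C.Good n g) (S : Finset P) :
    C.ρ (f * g) S = ∑ S' ∈ S.powerset, C.ρ f S' * C.ρ g (S \ S') := by
  apply C.ρ_eq
  rw [Φ_mul hf.1, Finset.sum_div]
  have e : ∑ S' ∈ S.powerset, C.ρ f S' * C.ρ g (S \ S') =
      ∑ T ∈ (C.full S).powerset, if T = C.full (T.image C.cl) then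
        C.ρ f (T.image C.cl) * C.ρ g (S \ T.image C.cl) else 0 := by
    rw [← Finset.sum_filter]
    have : ((C.full S).powerset.filter fun T => T = C.full (T.image C.cl)) =
        S.powerset.image C.full := by
      ext T
      simp only [Finset.mem_filter, Finset.mem_powerset, Finset.mem_image]
      constructor
      · rintro ⟨h1, h2⟩
        refine ⟨T.image C.cl, ?_, h2.symm⟩
        have := Finset.image_subset_image (f := C.cl) h1
        rwa [C.image_full hW] at this
      · rintro ⟨S', h, rfl⟩
        rw [C.image_full hW]
        exact ⟨fun a ha => C.mem_full.2 (h (C.mem_full.1 ha)), rfl⟩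
    rw [this, Finset.sum_image]
    · exact Finset.sum_congr rfl fun S' _ => by rw [C.image_full hW]
    · intro S1 _ S2 _ h
      rw [← C.image_full hW S1, ← C.image_full hW S2, h]
  rw [e]
  refine Res.sum _ fun T hT => ?_
  rw [Finset.mem_powerset] at hT
  split_ifs with h
  · set S' := T.image C.cl with hS'
    have hsub : S' ⊆ S := by
      have := Finset.image_subset_image (f := C.cl) hT
      rwa [C.image_full hW] at this
    have e1 : C.full S \ T = C.full (S \ S') := by
      rw [h]; ext a; simp [mem_full]
    have hz : Res (zz (C.ζ n) T (C.full S \ T)) 1 := by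
      apply C.res_zz_of_ne
      intro a ha b hb
      rw [h, C.mem_full] at ha
      rw [e1, C.mem_full, Finset.mem_sdiff] at hb
      intro hab
      exact hb.2 (hab ▸ ha)
    have hc : S.card = S'.card + (S \ S').card := by
      rw [Finset.card_sdiff_of_subset hsub]
      have := Finset.card_le_card hsub
      omega
    have := ((hf.res hW S').mul hz).mul (hg.res hW (S \ S'))
    rw [mul_one, ← h, ← e1] at this
    rw [hc, pow_add]
    convert this using 1
    ring
  · refine (C.ordGe_term n hf hg T (C.full S)).res_of_lt ?_
    have h1 : (T.image C.cl ∪ (C.full S \ T).image C.cl).card = S.card := by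
      rw [← Finset.image_union, Finset.union_sdiff_of_subset hT, C.image_full hW]
    have h2 := Finset.card_union_add_card_inter (T.image C.cl) ((C.full S \ T).image C.cl)
    have h3 : 0 < (T.image C.cl ∩ (C.full S \ T).image C.cl).card := by
      rw [Finset.card_pos]
      by_contra h4
      apply h
      refine Finset.Subset.antisymm (fun a ha => C.mem_full.2 (Finset.mem_image_of_mem _ ha)) ?_
      intro a ha
      by_contra haT
      have h5 := C.mem_full.1 ha
      obtain ⟨b, hb, hab⟩ := Finset.mem_image.1 h5
      refine h4 ⟨C.cl a, Finset.mem_inter.2 ⟨h5, Finset.mem_image.2 ⟨a, ?_, rfl⟩⟩⟩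
      rw [Finset.mem_sdiff, C.mem_full, ← hab]
      exact ⟨C.mem_full.1 (hT hb), haT⟩
    rw [nc, nc]
    omega

end Clu

/-- sum over all the ways to distribute the members of a list over a set. -/
def per {P R : Type} [DecidableEq P] [CommSemiring R] : List (P → R) → Finset P → R
  | [], S => if S = ∅ then 1 else 0
  | f :: l, S => ∑ p ∈ S, f p * per l (S.erase p)

lemma per_eq_zero {P R : Type} [DecidableEq P] [CommSemiring R] (l : List (P → R)) (S : Finset P)
    (h : S.card ≠ l.length) : per l S = 0 := by
  induction l generalizing S with
  | nil => exact if_neg fun h' => h (by simp [h'])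
  | cons f l ih =>
    refine Finset.sum_eq_zero fun p hp => ?_
    rw [ih, mul_zero]
    rw [Finset.card_erase_of_mem hp]
    have := Finset.card_pos.2 ⟨p, hp⟩
    simp at h
    omega

namespace Clu
variable {V P : Type} [DecidableEq V] [DecidableEq P] [Fintype V] {W : P → List ℕ} (C : Clu V P W)
  (n : ℕ)

lemma ρ_prod (hW : ∀ p, W p ≠ []) (l : List (Module.End KK (Finset V → KK)))
    (h : ∀ f ∈ l, C.Good n f) (h0 : ∀ f ∈ l, Φ f ∅ = 0) (S : Finset P) (hS : S.card ≤ l.length) :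
    C.ρ l.prod S = per (l.map fun f p => C.ρ f {p}) S := by
  induction l generalizing S with
  | nil =>
    have : S = ∅ := by simpa using hS
    subst this
    rw [List.map_nil, per, if_pos rfl]
    apply C.ρ_eq
    simpa [full, Φ, vac] using Res.one
  | cons f l ih =>
    have hl : ∀ f ∈ l, C.Good n f := fun g hg => h g (by simp [hg])
    have ih' := ih hl (fun g hg => h0 g (by simp [hg]))
    rw [List.prod_cons, C.ρ_mul n hW (h f (by simp)) (C.good_prod n l hl), List.map_cons, per]
    have e : ∑ p ∈ S, C.ρ f {p} * per (l.map fun f p => C.ρ f {p}) (S.erase p) =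
        ∑ S' ∈ S.image (fun p => ({p} : Finset P)), C.ρ f S' * C.ρ l.prod (S \ S') := by
      rw [Finset.sum_image (by simp)]
      refine Finset.sum_congr rfl fun p hp => ?_
      rw [Finset.sdiff_singleton_eq_erase, ih']
      rw [Finset.card_erase_of_mem hp]
      simp at hS
      omega
    rw [e]
    symm
    refine Finset.sum_subset ?_ ?_
    · intro S' hS'
      obtain ⟨p, hp, rfl⟩ := Finset.mem_image.1 hS'
      simpa using hp
    · intro S' hS' hn
      rw [Finset.mem_powerset] at hS'
      rcases Nat.lt_or_ge S'.card 1 with h1 | h1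
      · have : S' = ∅ := by simpa using h1
        subst this
        have : C.ρ f ∅ = 0 := by
          apply C.ρ_eq
          have : C.full ∅ = ∅ := by simp [full]
          rw [this, h0 f (by simp), zero_div]
          exact Res.zero
        rw [this, zero_mul]
      rcases h1.eq_or_lt with h1 | h1
      · obtain ⟨p, rfl⟩ := Finset.card_eq_one.1 h1.symm
        exact absurd (Finset.mem_image.2 ⟨p, by simpa using hS', rfl⟩) hn
      · have hc := Finset.card_sdiff_of_subset hS'
        have hc' := Finset.card_le_card hS'
        simp at hS
        rw [ih' _ (by omega), per_eq_zero, mul_zero]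
        simp
        omega

end Clu
end Shuffle

/-! ### Matrix coefficients of root vectors -/

namespace Shuffle

namespace Model
variable {V : Type} [DecidableEq V] [Fintype V]

section Field
variable {F : Type} [Field F] {v : F} {n : ℕ} (m : Model v n V)

lemma Φ_ee (i : ℕ) (r : ℤ) (B : Finset V) : Φ (m.ee i r) B =
    ∑ a ∈ Finset.univ.filter (fun a => m.col a = i), if {a} = B then m.x a ^ r else 0 := by
  rw [ee, Φ, LinearMap.sum_apply, Finset.sum_apply]
  refine Finset.sum_congr rfl fun a _ => ?_
  have : (m.x a ^ r • m.y a) vac B = m.x a ^ r * Φ (m.y a) B := rfl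
  rw [this, y, Φ_MM]
  split_ifs <;> simp

lemma Φ_mul_ee {f : Module.End F (Finset V → F)} (hf : f ∈ WW m.ζ) (i : ℕ) (r : ℤ)
    (A : Finset V) : Φ (f * m.ee i r) A =
    ∑ a ∈ A.filter (fun a => m.col a = i), m.x a ^ r * (zz m.ζ (A.erase a) {a} * Φ f (A.erase a)) := by
  rw [Φ_mul hf]
  simp only [Φ_ee, Finset.mul_sum]
  rw [Finset.sum_comm]
  have e : A.filter (fun a => m.col a = i) =
      (Finset.univ.filter (fun a => m.col a = i)).filter (· ∈ A) := by
    ext; simp [and_comm]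
  rw [e, Finset.sum_filter (fun a => a ∈ A)]
  refine Finset.sum_congr rfl fun a _ => ?_
  split_ifs with ha
  · rw [Finset.sum_eq_single (A.erase a)]
    · have : A \ A.erase a = {a} := by
        ext b; simp only [Finset.mem_sdiff, Finset.mem_erase, Finset.mem_singleton]
        constructor
        · rintro ⟨h1, h2⟩; by_contra h; exact h2 ⟨h, h1⟩
        · rintro rfl; exact ⟨ha, fun h => h.1 rfl⟩
      rw [this, if_pos rfl]
      ring
    · intro T hT hne
      rw [if_neg, mul_zero]
      intro h
      apply hne
      rw [← Finset.sdiff_singleton_eq_erase, h, Finset.sdiff_sdiff_eq_self (Finset.mem_powerset.1 hT)]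
    · intro h
      exact absurd (Finset.mem_powerset.2 (Finset.erase_subset _ _)) h
  · refine Finset.sum_eq_zero fun T _ => ?_
    rw [if_neg, mul_zero]
    intro h
    have : a ∈ A \ T := h ▸ Finset.mem_singleton_self a
    exact ha (Finset.mem_sdiff.1 this).1

lemma Φ_ee_mul (f : Module.End F (Finset V → F)) (i : ℕ) (r : ℤ)
    (A : Finset V) : Φ (m.ee i r * f) A =
    ∑ a ∈ A.filter (fun a => m.col a = i), m.x a ^ r * (zz m.ζ {a} (A.erase a) * Φ f (A.erase a)) := by
  rw [Φ, Module.End.mul_apply, ee, LinearMap.sum_apply, Finset.sum_apply]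
  have e : A.filter (fun a => m.col a = i) =
      (Finset.univ.filter (fun a => m.col a = i)).filter (· ∈ A) := by
    ext; simp [and_comm]
  rw [e, Finset.sum_filter (fun a => a ∈ A)]
  refine Finset.sum_congr rfl fun a _ => ?_
  rw [LinearMap.smul_apply, Pi.smul_apply, y, MM_apply, smul_eq_mul, Finset.sdiff_singleton_eq_erase]
  by_cases h : a ∈ A
  · rw [if_pos h, if_pos (Finset.singleton_subset_iff.2 h)]; rfl
  · rw [if_neg h, if_neg (fun h' => h (Finset.singleton_subset_iff.1 h')), mul_zero]

end Field

variable {n : ℕ} (m : Model vv n V)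

/-- the normalized iterated commutator of shuffle operators along a word. -/
def ch (u : KK) (t : ℕ → ℤ) : List ℕ → Module.End KK (Finset V → KK)
  | [] => 0
  | i :: w => w.foldl (fun x j => x * m.ee j (t j) - u • (m.ee j (t j) * x))
      ((vv - vv⁻¹) • m.ee i (t i))

lemma ch_append (u : KK) (t : ℕ → ℤ) {w : List ℕ} (hw : w ≠ []) (j : ℕ) :
    m.ch u t (w ++ [j]) = m.ch u t w * m.ee j (t j) - u • (m.ee j (t j) * m.ch u t w) := by
  cases w with
  | nil => exact absurd rfl hw
  | cons i w => simp [ch]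

lemma shuffleRep_chl (u : KK) (t : ℕ → ℤ) (w : List ℕ) (hw : ∀ j ∈ w, 1 ≤ j ∧ j ≤ n) :
    shuffleRep m ((vv - vv⁻¹) • (loopUD n).chl u t w) = m.ch u t w := by
  induction w using List.reverseRecOn with
  | nil =>
    have : (loopUD n).chl u t [] = 0 := rfl
    rw [this, smul_zero, map_zero]; rfl
  | append_singleton w j ih =>
    have hj := hw j (by simp)
    by_cases h : w = []
    · subst h
      have e : (loopUD n).chl u t ([] ++ [j]) = genD n j (t j) := rfl
      rw [e, map_smul, shuffleRep_genD m hj.1 hj.2]; rfl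
    · have ih' := ih fun k hk => hw k (by simp [hk])
      have e : (vv - vv⁻¹) • (loopUD n).chl u t (w ++ [j]) =
          ((vv - vv⁻¹) • (loopUD n).chl u t w) * genD n j (t j) -
            u • (genD n j (t j) * ((vv - vv⁻¹) • (loopUD n).chl u t w)) := by
        rw [LoopAlg.chl_append _ _ _ h, LoopAlg.br, smul_sub, smul_mul_assoc, mul_smul_comm,
          smul_comm u]
        rfl
      rw [e, map_sub, map_smul, map_mul, map_mul, ih', shuffleRep_genD m hj.1 hj.2, m.ch_append _ _ h]

lemma ch_mem (u : KK) (t : ℕ → ℤ) (w : List ℕ) : m.ch u t w ∈ WW m.ζ := by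
  induction w using List.reverseRecOn with
  | nil => exact zero_mem _
  | append_singleton w j ih =>
    by_cases h : w = []
    · subst h
      exact Subalgebra.smul_mem _ (m.ee_mem _ _) _
    · rw [m.ch_append _ _ h]
      exact sub_mem (mul_mem ih (m.ee_mem _ _))
        (Subalgebra.smul_mem _ (mul_mem (m.ee_mem _ _) ih) _)

lemma Φ_ch_append (u : KK) (t : ℕ → ℤ) {w : List ℕ} (hw : w ≠ []) (j : ℕ) (A : Finset V) :
    Φ (m.ch u t (w ++ [j])) A = ∑ a ∈ A.filter (fun a => m.col a = j), m.x a ^ t j *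
      ((zz m.ζ (A.erase a) {a} - u * zz m.ζ {a} (A.erase a)) * Φ (m.ch u t w) (A.erase a)) := by
  rw [m.ch_append _ _ hw, Φ_sub, Φ_smul, m.Φ_mul_ee (m.ch_mem _ _ _), m.Φ_ee_mul, Finset.mul_sum,
    ← Finset.sum_sub_distrib]
  refine Finset.sum_congr rfl fun a _ => ?_
  ring

lemma Φ_ch_singleton (u : KK) (t : ℕ → ℤ) (j : ℕ) (A : Finset V) :
    Φ (m.ch u t [j]) A = (vv - vv⁻¹) *
    ∑ a ∈ Finset.univ.filter (fun a => m.col a = j), if {a} = A then m.x a ^ t j else 0 := by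
  rw [← Φ_ee]; rfl

lemma Φ_ch_content (u : KK) (t : ℕ → ℤ) (w : List ℕ) (A : Finset V)
    (h : Φ (m.ch u t w) A ≠ 0) : A.val.map m.col = (w : Multiset ℕ) := by
  induction w using List.reverseRecOn generalizing A with
  | nil => exact absurd rfl h
  | append_singleton w j ih =>
    by_cases hw : w = []
    · subst hw
      rw [List.nil_append, Φ_ch_singleton] at h
      obtain ⟨a, ha, h1⟩ := Finset.exists_ne_zero_of_sum_ne_zero (right_ne_zero_of_mul h)
      have h2 : {a} = A := by
        by_contra h2
        exact h1 (if_neg h2)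
      subst h2
      have h3 := (Finset.mem_filter.1 ha).2
      simp [h3]
    · rw [m.Φ_ch_append _ _ hw] at h
      obtain ⟨a, ha, h1⟩ := Finset.exists_ne_zero_of_sum_ne_zero h
      have h2 := ih _ (right_ne_zero_of_mul (right_ne_zero_of_mul h1))
      obtain ⟨h3, h4⟩ := Finset.mem_filter.1 ha
      rw [← Finset.insert_erase h3, Finset.insert_val_of_notMem (Finset.notMem_erase _ _),
        Multiset.map_cons, h2, h4]
      exact Multiset.coe_eq_coe.2 (List.perm_append_singleton j w).symm

end Model

namespace Clu
variable {V P : Type} [DecidableEq V] [DecidableEq P] [Fintype V] {W : P → List ℕ} (C : Clu V P W)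
  (n : ℕ)

lemma Φ_ch_empty (u : KK) (t : ℕ → ℤ) (w : List ℕ) : Φ ((C.mod n).ch u t w) ∅ = 0 := by
  by_contra h
  have h' := (C.mod n).Φ_ch_content u t w ∅ h
  have : w = [] := by simpa using h'.symm
  subst this
  exact h rfl

lemma good_ch {u : KK} (hu : Res u 1) (t : ℕ → ℤ) (w : List ℕ) :
    C.Good n ((C.mod n).ch u t w) := by
  refine ⟨(C.mod n).ch_mem u t w, ?_⟩
  induction w using List.reverseRecOn with
  | nil => intro A; exact OrdGe.zero _
  | append_singleton w j ih =>
    intro A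
    by_cases hw : w = []
    · subst hw
      rw [List.nil_append, Model.Φ_ch_singleton, Finset.mul_sum]
      refine OrdGe.sum _ fun a _ => ?_
      split_ifs with h
      · subst h
        have h1 : OrdGe 1 (vv - vv⁻¹) := ⟨2, by simpa using res_κ⟩
        have h2 := h1.mul (OrdGe.of_res ((C.xx_res a).zpow (C.w_ne _) (t j)))
        have e : C.nc {a} = 1 + 0 := by simp [nc]
        rw [e]
        exact h2
      · rw [mul_zero]; exact OrdGe.zero _
    · rw [Model.Φ_ch_append _ _ _ hw]
      refine OrdGe.sum _ fun a ha => ?_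
      have haA := (Finset.mem_filter.1 ha).1
      have hx := OrdGe.of_res ((C.xx_res a).zpow (C.w_ne _) (t j))
      obtain ⟨z1, hz1⟩ := C.exists_res_zz n (S := A.erase a) (T := {a}) (by simp)
      obtain ⟨z2, hz2⟩ := C.exists_res_zz n (S := {a}) (T := A.erase a) (by simp)
      by_cases h : ∃ b ∈ A.erase a, C.cl b = C.cl a
      · obtain ⟨b, hb, hab⟩ := h
        have : C.nc A = C.nc (A.erase a) := by
          rw [nc, nc, ← Finset.insert_erase haA, Finset.image_insert, Finset.erase_insert
            (Finset.notMem_erase _ _), Finset.insert_eq_of_mem]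
          exact Finset.mem_image.2 ⟨b, hb, hab⟩
        rw [this]
        have := hx.mul ((OrdGe.of_res (hz1.sub (hu.mul hz2))).mul (ih (A.erase a)))
        rw [zero_add, zero_add] at this
        exact this
      · push Not at h
        have hz1' := C.res_zz_of_ne n (S := A.erase a) (T := {a}) (by simpa using h)
        have hz2' := C.res_zz_of_ne n (S := {a}) (T := A.erase a)
          (by simpa using fun b h1 h2 => (h b (by simp [h1, h2])).symm)
        have h1 := hz1'.sub (hu.mul hz2')
        rw [one_mul, sub_self] at h1
        have hc : C.nc A ≤ 1 + C.nc (A.erase a) := by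
          have := C.nc_le (T := {a}) (A := A) (by simpa using haA)
          rwa [Finset.sdiff_singleton_eq_erase, nc, nc, nc, Finset.image_singleton,
            Finset.card_singleton] at this
        have := hx.mul ((OrdGe.of_res_zero h1).mul (ih (A.erase a)))
        rw [zero_add] at this
        exact this.mono hc

end Clu

/-- the variables of a cluster preceding a letter of the same color as the `m`-th one, and the
letters preceding the `m`-th one, are in general position. -/
def GoodWord (n : ℕ) (w : List ℕ) : Prop := ∀ m, 1 ≤ m → m < w.length →
  (∀ k, k < m → w.getD k 0 = w.getD m 0 → 1 ≤ k ∧ aD n (w.getD (k - 1) 0) (w.getD m 0) = -1 ∧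
    k + 1 < m ∧ aD n (w.getD (k + 1) 0) (w.getD m 0) = -1 ∧ m ≠ k + 2) ∧
  (aD n (w.getD (m - 1) 0) (w.getD m 0) = -1 ∨
    (2 ≤ m ∧ aD n (w.getD (m - 1) 0) (w.getD m 0) = 0 ∧
      aD n (w.getD (m - 2) 0) (w.getD m 0) = -1 ∧
      ∀ k, k + 2 < m → aD n (w.getD k 0) (w.getD m 0) = 0))

/-- the contribution of the `m`-th letter to the leading coefficient of a root vector. -/
def lcf (n : ℕ) (w : List ℕ) (m : ℕ) : ℚ :=
  (∏ k ∈ Finset.range m, Clu.zr (aD n (w.getD k 0) (w.getD m 0)) k m) -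
    ∏ k ∈ Finset.range m, Clu.zr (aD n (w.getD m 0) (w.getD k 0)) m k

/-- the leading coefficient of a root vector. -/
def lco (n : ℕ) (w : List ℕ) : ℕ → ℚ
  | 0 => 2
  | m + 1 => lco n w m * lcf n w (m + 1)

lemma lcf_ne_zero {n : ℕ} {w : List ℕ} (hw : GoodWord n w) {m : ℕ} (h1 : 1 ≤ m)
    (h2 : m < w.length) : lcf n w m ≠ 0 := by
  obtain ⟨ha, hb⟩ := hw m h1 h2
  obtain ⟨m, rfl⟩ : ∃ m', m = m' + 1 := ⟨m - 1, by omega⟩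
  rw [lcf]
  set j := w.getD (m + 1) 0 with hj
  rcases hb with hb | ⟨h3, hb, hb', hb''⟩
  · have e : (∏ k ∈ Finset.range (m + 1), Clu.zr (aD n (w.getD k 0) j) k (m + 1 : ℕ)) = 0 := by
      refine Finset.prod_eq_zero (Finset.self_mem_range_succ m) ?_
      have hb : aD n (w.getD m 0) j = -1 := hb
      rw [hb, Clu.zr, if_neg (by norm_num)]
      push_cast
      simp
    rw [e, zero_sub]
    refine neg_ne_zero.2 (Finset.prod_ne_zero_iff.2 fun k hk => ?_)
    rw [Finset.mem_range] at hk
    rw [Clu.zr]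
    have hd : (((k : ℤ) - (m + 1 : ℕ) : ℤ) : ℚ) ≠ 0 := by
      rw [Int.cast_ne_zero]; push_cast; omega
    by_cases hk2 : w.getD k 0 = j
    · rw [hk2, aD_self, if_neg (by norm_num)]
      refine div_ne_zero ?_ hd
      have := (ha k hk hk2).2.2.2.2
      rw [Int.cast_ne_zero]; push_cast; omega
    · rcases aD_ne (n := n) (Ne.symm hk2) with h | h
      · rw [h, if_pos rfl]; exact one_ne_zero
      · rw [h, if_neg (by norm_num)]
        refine div_ne_zero ?_ hd
        rw [Int.cast_ne_zero]; push_cast; omega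
  · obtain ⟨m, rfl⟩ : ∃ m', m = m' + 1 := ⟨m - 1, by omega⟩
    have hb0 : aD n (w.getD (m + 1) 0) j = 0 := hb
    have hb1 : aD n (w.getD m 0) j = -1 := hb'
    have e1 : (∏ k ∈ Finset.range m, Clu.zr (aD n (w.getD k 0) j) k (m + 1 + 1 : ℕ)) = 1 := by
      refine Finset.prod_eq_one fun k hk => ?_
      rw [Finset.mem_range] at hk
      rw [hb'' k (by omega), Clu.zr, if_pos rfl]
    have e2 : (∏ k ∈ Finset.range m, Clu.zr (aD n j (w.getD k 0)) (m + 1 + 1 : ℕ) k) = 1 := by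
      refine Finset.prod_eq_one fun k hk => ?_
      rw [Finset.mem_range] at hk
      rw [aD_symm, hb'' k (by omega), Clu.zr, if_pos rfl]
    rw [Finset.prod_range_succ, Finset.prod_range_succ, Finset.prod_range_succ,
      Finset.prod_range_succ, e1, e2, aD_symm n j, aD_symm n j, hb0, hb1]
    simp only [Clu.zr]
    have hn : ¬ ((-1 : ℤ) = 0) := by norm_num
    rw [if_neg hn, if_neg hn]
    simp only [if_true]
    push_cast
    have x1 : ((-1 : ℚ) + (m + 1 + 1) - m) = 1 := by ring
    have x2 : ((m : ℚ) + 1 + 1 - m) = 2 := by ring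
    have x3 : ((-1 : ℚ) + m - (m + 1 + 1)) = -3 := by ring
    have x4 : ((m : ℚ) - (m + 1 + 1)) = -2 := by ring
    rw [x1, x2, x3, x4]
    norm_num

lemma lco_ne_zero {n : ℕ} {w : List ℕ} (hw : GoodWord n w) {m : ℕ} 
    (h2 : m < w.length) : lco n w m ≠ 0 := by
  induction m with
  | zero => exact two_ne_zero
  | succ m ih => exact mul_ne_zero (ih (by omega)) (lcf_ne_zero hw (by omega) h2)

namespace Clu
variable {V P : Type} [DecidableEq V] [DecidableEq P] [Fintype V] {W : P → List ℕ} (C : Clu V P W)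
  (n : ℕ)

/-- the first variables of a cluster. -/
def ini (p : P) (m : ℕ) : Finset V := Finset.univ.filter fun a => C.cl a = p ∧ C.pos a < m

lemma mem_ini {p : P} {m : ℕ} {a : V} : a ∈ C.ini p m ↔ C.cl a = p ∧ C.pos a < m := by simp [ini]

lemma ini_length (p : P) : C.ini p (W p).length = C.full {p} := by
  ext a
  rw [mem_ini, mem_full, Finset.mem_singleton]
  exact ⟨fun h => h.1, fun h => ⟨h, h ▸ C.lt a⟩⟩

lemma erase_ini {p : P} {m : ℕ} {a : V} (h : C.cl a = p) (h' : C.pos a = m) :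
    (C.ini p (m + 1)).erase a = C.ini p m := by
  ext b
  rw [Finset.mem_erase, mem_ini, mem_ini]
  constructor
  · rintro ⟨h1, h2, h3⟩
    refine ⟨h2, lt_of_le_of_ne (by omega) fun h4 => h1 (C.inj _ _ (h2.trans h.symm) (h4.trans h'.symm))⟩
  · rintro ⟨h1, h2⟩
    exact ⟨by rintro rfl; omega, h1, by omega⟩

lemma prod_ini {p : P} {m : ℕ} (hm : m ≤ (W p).length) (g : ℕ → ℚ) :
    ∏ b ∈ C.ini p m, g (C.pos b) = ∏ k ∈ Finset.range m, g k := by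
  have : (C.ini p m).image C.pos = Finset.range m := by
    ext k
    simp only [Finset.mem_image, mem_ini, Finset.mem_range]
    constructor
    · rintro ⟨a, h, rfl⟩; exact h.2
    · intro hk
      obtain ⟨a, h1, h2⟩ := C.ex p k (by omega)
      exact ⟨a, ⟨h1, by omega⟩, h2⟩
  rw [← this, Finset.prod_image]
  intro a ha b hb h
  exact C.inj a b ((C.mem_ini.1 ha).1.trans (C.mem_ini.1 hb).1.symm) h

lemma res_zz_left {B : Finset V} {a : V} (ha : a ∉ B) (h : ∀ b ∈ B, C.cl b = C.cl a) :
    Res (zz (C.ζ n) B {a}) (∏ b ∈ B, zr (aD n (C.col b) (C.col a)) (C.pos b) (C.pos a)) := by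
  simp only [zz, Finset.prod_singleton]
  exact Res.prod _ fun b hb => C.res_ζ_of_eq n (h b hb) (by rintro rfl; exact ha hb)

lemma res_zz_right {B : Finset V} {a : V} (ha : a ∉ B) (h : ∀ b ∈ B, C.cl b = C.cl a) :
    Res (zz (C.ζ n) {a} B) (∏ b ∈ B, zr (aD n (C.col a) (C.col b)) (C.pos a) (C.pos b)) := by
  simp only [zz, Finset.prod_singleton]
  exact Res.prod _ fun b hb => C.res_ζ_of_eq n (h b hb).symm (by rintro rfl; exact ha hb)

lemma col_eq {p : P} {k : ℕ} {a : V} (h : C.cl a = p) (h' : C.pos a = k) :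
    C.col a = (W p).getD k 0 := by rw [col, h, h']

lemma res_ini {u : KK} (hu : Res u 1) (t : ℕ → ℤ) {p : P} (hW : GoodWord n (W p)) (m : ℕ)
    (hm : m < (W p).length) :
    Res (Φ ((C.mod n).ch u t ((W p).take (m + 1))) (C.ini p (m + 1)) / ϖ)
      (lco n (W p) m * C.w p ^ (((W p).take (m + 1)).map t).sum) := by
  have htake : ∀ k, k < (W p).length → (W p).take (k + 1) = (W p).take k ++ [(W p).getD k 0] := by
    intro k hk
    rw [List.take_add_one, List.getD_eq_getElem _ _ hk, List.getElem?_eq_getElem hk]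
    rfl
  induction m with
  | zero =>
    obtain ⟨a, h1, h2⟩ := C.ex p 0 hm
    have hA : C.ini p 1 = {a} := by
      have h3 : a ∈ C.ini p 1 := C.mem_ini.2 ⟨h1, by omega⟩
      rw [← Finset.insert_erase h3, C.erase_ini h1 h2]
      have : C.ini p 0 = ∅ := by ext; simp [mem_ini]
      rw [this]; rfl
    rw [htake 0 hm, List.take_zero, List.nil_append, Model.Φ_ch_singleton, zero_add, hA]
    have e : (∑ b ∈ Finset.univ.filter (fun b => (C.mod n).col b = (W p).getD 0 0),
        if ({b} : Finset V) = {a} then (C.mod n).x b ^ t ((W p).getD 0 0) else 0) =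
        C.xx a ^ t ((W p).getD 0 0) := by
      rw [Finset.sum_eq_single a]
      · rw [if_pos rfl]; rfl
      · intro b _ hb
        exact if_neg fun h => hb (Finset.singleton_injective h)
      · intro h
        have h5 : (C.mod n).col a = (W p).getD 0 0 := C.col_eq h1 h2
        exact absurd (Finset.mem_filter.2 ⟨Finset.mem_univ a, h5⟩) h
    rw [e, mul_div_right_comm, lco]
    have := res_κ.mul ((C.xx_res a).zpow (C.w_ne _) (t ((W p).getD 0 0)))
    simpa [h1] using this
  | succ m ih =>
    have ih' := ih (by omega)
    have hne : (W p).take (m + 1) ≠ [] := by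
      rw [Ne, List.take_eq_nil_iff]
      rintro (h | h)
      · omega
      · rw [h] at hm; simp at hm
    rw [htake (m + 1) hm, Model.Φ_ch_append _ _ _ hne, Finset.sum_div]
    set j := (W p).getD (m + 1) 0 with hj
    obtain ⟨a, h1, h2⟩ := C.ex p (m + 1) hm
    have haA : a ∈ (C.ini p (m + 1 + 1)).filter (fun a => (C.mod n).col a = j) := by
      rw [Finset.mem_filter, mem_ini]
      exact ⟨⟨h1, by omega⟩, C.col_eq h1 h2⟩
    have e : lco n (W p) (m + 1) *
        C.w p ^ (((W p).take (m + 1) ++ [j]).map t).sum =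
        ∑ b ∈ (C.ini p (m + 1 + 1)).filter (fun a => (C.mod n).col a = j), if b = a then
          C.w p ^ t j * (lcf n (W p) (m + 1) * (lco n (W p) m *
            C.w p ^ (((W p).take (m + 1)).map t).sum)) else 0 := by
      rw [Finset.sum_ite_eq' , if_pos haA, lco, List.map_append, List.sum_append, List.map_singleton,
        List.sum_singleton, zpow_add₀ (C.w_ne p)]
      ring
    rw [e]
    refine Res.sum _ fun b hb => ?_
    obtain ⟨hb1, hb2⟩ := Finset.mem_filter.1 hb
    obtain ⟨hb3, hb4⟩ := C.mem_ini.1 hb1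
    have hb2 : C.col b = j := hb2
    have hB : ∀ c ∈ (C.ini p (m + 1 + 1)).erase b, C.cl c = C.cl b := fun c hc => by
      rw [(C.mem_ini.1 (Finset.mem_erase.1 hc).2).1, hb3]
    have hz1 := C.res_zz_left n (Finset.notMem_erase b _) hB
    have hz2 := C.res_zz_right n (Finset.notMem_erase b _) hB
    have hx := (C.xx_res b).zpow (C.w_ne _) (t j)
    rw [mul_div_assoc, mul_div_assoc]
    split_ifs with hba
    · subst hba
      rw [C.erase_ini h1 h2] at hz1 hz2 ⊢
      have p1 : ∏ c ∈ C.ini p (m + 1), zr (aD n (C.col c) (C.col b)) (C.pos c) (C.pos b) =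
          ∏ k ∈ Finset.range (m + 1), zr (aD n ((W p).getD k 0) j) k (m + 1 : ℕ) := by
        rw [← C.prod_ini (p := p) (show m + 1 ≤ (W p).length by omega)
          (fun k => zr (aD n ((W p).getD k 0) j) k (m + 1 : ℕ)), hb2, h2]
        exact Finset.prod_congr rfl fun c hc => by
          rw [C.col_eq (C.mem_ini.1 hc).1 rfl]
      have p2 : ∏ c ∈ C.ini p (m + 1), zr (aD n (C.col b) (C.col c)) (C.pos b) (C.pos c) =
          ∏ k ∈ Finset.range (m + 1), zr (aD n j ((W p).getD k 0)) (m + 1 : ℕ) k := by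
        rw [← C.prod_ini (p := p) (show m + 1 ≤ (W p).length by omega)
          (fun k => zr (aD n j ((W p).getD k 0)) (m + 1 : ℕ) k), hb2, h2]
        exact Finset.prod_congr rfl fun c hc => by
          rw [C.col_eq (C.mem_ini.1 hc).1 rfl]
      rw [p1] at hz1
      rw [p2] at hz2
      have h5 := hx.mul ((hz1.sub (hu.mul hz2)).mul ih')
      rw [one_mul, h1] at h5
      exact h5
    · have hpos : C.pos b ≠ m + 1 := fun h => hba (C.inj _ _ (hb3.trans h1.symm) (h.trans h2.symm))
      have hk : C.pos b < m + 1 := by omega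
      obtain ⟨g1, g2, g3, g4, g5⟩ := (hW (m + 1) (by omega) hm).1 (C.pos b) hk
        ((C.col_eq hb3 rfl).symm.trans hb2)
      obtain ⟨c, hc1, hc2⟩ := C.ex p (C.pos b - 1) (by omega)
      obtain ⟨d, hd1, hd2⟩ := C.ex p (C.pos b + 1) (by omega)
      have hcm : c ∈ (C.ini p (m + 1 + 1)).erase b := by
        rw [Finset.mem_erase, mem_ini]
        exact ⟨by rintro rfl; omega, hc1, by omega⟩
      have hdm : d ∈ (C.ini p (m + 1 + 1)).erase b := by
        rw [Finset.mem_erase, mem_ini]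
        exact ⟨by rintro rfl; omega, hd1, by omega⟩
      have p1 : ∏ c ∈ (C.ini p (m + 1 + 1)).erase b,
          zr (aD n (C.col c) (C.col b)) (C.pos c) (C.pos b) = 0 := by
        refine Finset.prod_eq_zero hcm ?_
        rw [C.col_eq hc1 hc2, hb2, g2, zr, if_neg (by norm_num), hc2]
        have : (-1 : ℤ) + (C.pos b : ℤ) - ((C.pos b - 1 : ℕ) : ℤ) = 0 := by omega
        rw [this]; simp
      have p2 : ∏ c ∈ (C.ini p (m + 1 + 1)).erase b,
          zr (aD n (C.col b) (C.col c)) (C.pos b) (C.pos c) = 0 := by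
        refine Finset.prod_eq_zero hdm ?_
        rw [C.col_eq hd1 hd2, hb2, aD_symm, g4, zr, if_neg (by norm_num), hd2]
        have : (-1 : ℤ) + ((C.pos b + 1 : ℕ) : ℤ) - (C.pos b : ℤ) = 0 := by omega
        rw [this]; simp
      rw [p1] at hz1
      rw [p2] at hz2
      have hG := (C.good_ch n hu t ((W p).take (m + 1))).2 ((C.ini p (m + 1 + 1)).erase b)
      have hnc : 1 ≤ C.nc ((C.ini p (m + 1 + 1)).erase b) :=
        Finset.card_pos.2 ⟨_, Finset.mem_image_of_mem _ hcm⟩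
      obtain ⟨z, hz⟩ := hG.mono hnc
      rw [pow_one] at hz
      have h5 := hx.mul ((hz1.sub (hu.mul hz2)).mul hz)
      rw [mul_zero, sub_self, zero_mul, mul_zero] at h5
      exact h5

lemma ρ_ch_self {u : KK} (hu : Res u 1) (t : ℕ → ℤ) {p : P} (hW : GoodWord n (W p))
    (h0 : W p ≠ []) : C.ρ ((C.mod n).ch u t (W p)) {p} =
      lco n (W p) ((W p).length - 1) * C.w p ^ ((W p).map t).sum := by
  have hl := List.length_pos_iff.2 h0
  have h := C.res_ini n hu t hW ((W p).length - 1) (by omega)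
  rw [Nat.sub_add_cancel hl, List.take_length, C.ini_length] at h
  apply C.ρ_eq
  rw [Finset.card_singleton, pow_one]
  exact h

lemma map_col_full (p : P) : (C.full {p}).val.map C.col = (W p : Multiset ℕ) := by
  have h : (C.full {p}).val.map C.pos = (Finset.range (W p).length).val := by
    have : (C.full {p}).image C.pos = Finset.range (W p).length := by
      ext k
      simp only [Finset.mem_image, mem_full, Finset.mem_singleton, Finset.mem_range]
      constructor
      · rintro ⟨a, rfl, rfl⟩; exact C.lt a
      · intro hk
        obtain ⟨a, h1, h2⟩ := C.ex p k hk
        exact ⟨a, h1, h2⟩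
    rw [← this, Finset.image_val_of_injOn]
    intro a ha b hb hab
    simp only [Finset.mem_coe, mem_full, Finset.mem_singleton] at ha hb
    exact C.inj a b (ha.trans hb.symm) hab
  have e : (C.full {p}).val.map C.col =
      ((C.full {p}).val.map C.pos).map (fun k => (W p).getD k 0) := by
    rw [Multiset.map_map]
    refine Multiset.map_congr rfl fun a ha => ?_
    have : C.cl a = p := by simpa [mem_full] using ha
    exact C.col_eq this rfl
  rw [e, h, Finset.range_val, Multiset.range, Multiset.map_coe]
  congr 1
  refine List.ext_getElem (by simp) fun k h1 h2 => ?_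
  simp [List.getElem?_eq_getElem h2]

lemma ρ_ch_of_not_perm (u : KK) (t : ℕ → ℤ) {p : P} {w : List ℕ} (h : ¬ w.Perm (W p)) :
    C.ρ ((C.mod n).ch u t w) {p} = 0 := by
  apply C.ρ_eq
  have : Φ ((C.mod n).ch u t w) (C.full {p}) = 0 := by
    by_contra h'
    have := (C.mod n).Φ_ch_content u t w _ h'
    have e : (C.full {p}).val.map (C.mod n).col = (W p : Multiset ℕ) := C.map_col_full p
    rw [e] at this
    exact h (Multiset.coe_eq_coe.1 this).symm
  rw [this, zero_div]
  exact Res.zero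

end Clu
end Shuffle

/-! ### The words of positive roots are in general position -/

namespace Shuffle
open LoopAlg
variable {n : ℕ}

lemma wd_length {i p : ℕ} (h : IsTriple n i p) :
    (wd n i p).length = if i + p < n ∨ i = n then p + 1 else p := by
  obtain ⟨h1, h2, h3⟩ := h
  unfold Vp at h3
  rw [wd]
  split_ifs <;> simp <;> omega

lemma wd_eq_append {i p : ℕ} (h : IsTriple n i p) (hA : ¬ (i + p < n ∨ i = n)) :
    wd n i p = List.range' i (n - 1 - i) ++
      n :: (List.range' (2 * n - i - p) (n - (2 * n - i - p))).reverse := by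
  obtain ⟨h1, h2, h3⟩ := h
  unfold Vp at h3
  rw [wd, if_neg hA]
  split_ifs with hB hC
  · have e : n - (2 * n - i - p) = 0 := by omega
    rw [e]; rfl
  · have e : n - (2 * n - i - p) = 1 := by omega
    have e' : 2 * n - i - p = n - 1 := by omega
    rw [e, e']; rfl
  · rw [List.append_assoc]; rfl

lemma wd_getD {i p : ℕ} (h : IsTriple n i p) {k : ℕ} (hk : k < (wd n i p).length) :
    (wd n i p).getD k 0 = if i + p < n ∨ i = n ∨ k < n - 1 - i then i + k
      else if k = n - 1 - i then n else 2 * n - 1 - i - k := by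
  rw [wd_length h] at hk
  by_cases hA : i + p < n ∨ i = n
  · rw [if_pos hA] at hk
    rw [if_pos (by omega), List.getD_eq_getElem?_getD, wd, if_pos hA, List.getElem?_range' hk]
    simp
  · rw [if_neg hA] at hk
    rw [List.getD_eq_getElem?_getD, wd_eq_append h hA]
    obtain ⟨h1, h2, h3⟩ := h
    unfold Vp at h3
    rcases lt_trichotomy k (n - 1 - i) with hk1 | hk1 | hk1
    · rw [if_pos (by omega), List.getElem?_append_left (by simpa using hk1),
        List.getElem?_range' hk1]
      simp
    · rw [if_neg (by omega), if_pos hk1, List.getElem?_append_right (by simp [hk1]),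
        List.length_range', hk1, Nat.sub_self]
      rfl
    · obtain ⟨q, rfl⟩ : ∃ q, k = n - 1 - i + (q + 1) := ⟨k - (n - 1 - i) - 1, by omega⟩
      have hq : q < n - (2 * n - i - p) := by omega
      have hq' : n - (2 * n - i - p) - 1 - q < n - (2 * n - i - p) := by omega
      rw [if_neg (by omega), if_neg (by omega), List.getElem?_append_right (by simp),
        List.length_range', Nat.add_sub_cancel_left, List.getElem?_cons_succ,
        List.getElem?_reverse (by simpa using hq), List.length_range', List.getElem?_range' hq']
      simp only [Option.getD_some]
      omega

lemma wd_getD_cases {i p : ℕ} (h : IsTriple n i p) {k : ℕ} (hk : k < (wd n i p).length) :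
    ((i + p < n ∨ i = n ∨ k < n - 1 - i) ∧ (wd n i p).getD k 0 = i + k) ∨
    (n ≤ i + p ∧ i < n ∧ k = n - 1 - i ∧ (wd n i p).getD k 0 = n) ∨
    (n ≤ i + p ∧ i < n ∧ n - 1 - i < k ∧ (wd n i p).getD k 0 = 2 * n - 1 - i - k) := by
  have h2 := h.2.1
  rw [wd_getD h hk]
  split_ifs <;> omega

lemma wd_length_cases {i p : ℕ} (h : IsTriple n i p) :
    ((i + p < n ∨ i = n) ∧ (wd n i p).length = p + 1) ∨
    (n ≤ i + p ∧ i < n ∧ (wd n i p).length = p) := by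
  have h2 := h.2.1
  rw [wd_length h]
  split_ifs <;> omega

lemma aD_eq_neg_one {i j : ℕ} (h : (i + 1 = j ∧ j + 1 ≤ n) ∨ (j + 1 = i ∧ i + 1 ≤ n) ∨
    (i + 2 = n ∧ j = n) ∨ (j + 2 = n ∧ i = n)) : aD n i j = -1 := by
  unfold aD
  rw [if_neg (by omega)]
  split_ifs <;> omega

lemma aD_eq_zero {i j : ℕ} (h : i ≠ j ∧ ¬ ((i + 1 = j ∧ j + 1 ≤ n) ∨ (j + 1 = i ∧ i + 1 ≤ n) ∨
    (i + 2 = n ∧ j = n) ∨ (j + 2 = n ∧ i = n))) : aD n i j = 0 := by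
  unfold aD
  rw [if_neg (by omega), if_neg (by omega), if_neg (by omega)]

lemma goodWord_wd {i p : ℕ} (h : IsTriple n i p) : GoodWord n (wd n i p) := by
  intro m hm1 hm2
  have hl := wd_length_cases h
  have hg := fun k (hk : k < (wd n i p).length) => wd_getD_cases h hk
  obtain ⟨h1, h2, h3⟩ := h
  unfold Vp at h3
  generalize wd n i p = w at *
  have hgm := hg m hm2
  generalize hy : w.getD m 0 = y at *
  constructor
  · intro k hk hkm
    have hgk := hg k (by omega)
    rw [hkm] at hgk
    have hc : n ≤ i + p ∧ i < n ∧ n - 1 - i < m ∧ k < n - 1 - i := by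
      rcases hgk with ⟨h4, h5⟩ | ⟨h4, h5, h6, h7⟩ | ⟨h4, h5, h6, h7⟩ <;>
      rcases hgm with ⟨h4', h5'⟩ | ⟨h4', h5', h6', h7'⟩ | ⟨h4', h5', h6', h7'⟩ <;> omega
    have hm' : y = 2 * n - 1 - i - m := by omega
    have hk' : y = i + k := by omega
    have hlp : w.length = p := by omega
    have hk1 : 1 ≤ k ∧ k + 1 < m ∧ m ≠ k + 2 := by omega
    have hg1 : w.getD (k - 1) 0 = i + (k - 1) := by
      have := hg (k - 1) (by omega)
      omega
    have hg2 : w.getD (k + 1) 0 = i + (k + 1) ∧ k + 1 < n - 1 - i ∨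
        w.getD (k + 1) 0 = n ∧ k + 1 = n - 1 - i := by
      have := hg (k + 1) (by omega)
      omega
    exact ⟨hk1.1, aD_eq_neg_one (by omega), hk1.2.1, aD_eq_neg_one (by omega), hk1.2.2⟩
  · have hg1 := hg (m - 1) (by omega)
    by_cases hA : i + p < n ∨ i = n
    · left
      have e1 : y = i + m := by omega
      have e2 : w.getD (m - 1) 0 = i + (m - 1) := by omega
      exact aD_eq_neg_one (by omega)
    have hlp : w.length = p := by omega
    rcases lt_trichotomy m (n - 1 - i) with hm | hm | hm
    · left
      have e1 : y = i + m := by omega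
      have e2 : w.getD (m - 1) 0 = i + (m - 1) := by omega
      exact aD_eq_neg_one (by omega)
    · left
      have e1 : y = n := by omega
      have e2 : w.getD (m - 1) 0 = i + (m - 1) := by omega
      exact aD_eq_neg_one (by omega)
    have e1 : y = 2 * n - 1 - i - m := by omega
    by_cases hx : m = n - i
    · right
      have hg2 := hg (m - 2) (by omega)
      have e2 : w.getD (m - 1) 0 = n := by omega
      have e3 : w.getD (m - 2) 0 = n - 2 := by omega
      refine ⟨by omega, aD_eq_zero (by omega), aD_eq_neg_one (by omega), fun k hk => ?_⟩
      have hgk := hg k (by omega)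
      have e4 : w.getD k 0 = i + k := by omega
      exact aD_eq_zero (by omega)
    · left
      have e2 : w.getD (m - 1) 0 = 2 * n - 1 - i - (m - 1) := by omega
      exact aD_eq_neg_one (by omega)

lemma mem_wd {i p : ℕ} (h : IsTriple n i p) {j : ℕ} (hj : j ∈ wd n i p) : i ≤ j ∧ j ≤ n := by
  obtain ⟨k, hk, rfl⟩ := List.mem_iff_getElem.1 hj
  have hg := wd_getD h hk
  rw [List.getD_eq_getElem _ _ hk] at hg
  rw [wd_length h] at hk
  rw [hg]
  obtain ⟨h1, h2, h3⟩ := h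
  unfold Vp at h3
  split_ifs at hk ⊢ <;> omega

lemma left_mem_wd {i p : ℕ} (h : IsTriple n i p) : i ∈ wd n i p := by
  have h0 : 0 < (wd n i p).length := List.length_pos_iff.2 (wd_ne_nil h.2.1 h.2.2)
  have hg := wd_getD h h0
  rw [List.getD_eq_getElem _ _ h0] at hg
  have : (wd n i p)[0] = i := by
    rw [hg]
    rw [wd_length h] at h0
    obtain ⟨h1, h2, h3⟩ := h
    unfold Vp at h3
    split_ifs at h0 ⊢ <;> omega
  have h5 := List.getElem_mem h0
  rwa [this] at h5

lemma right_mem_wd {i p : ℕ} (h : IsTriple n i p) : n ∈ wd n i p ↔ n ≤ i + p := by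
  constructor
  · intro hn
    obtain ⟨k, hk, hkn⟩ := List.mem_iff_getElem.1 hn
    have hg := wd_getD h hk
    rw [List.getD_eq_getElem _ _ hk, hkn] at hg
    rw [wd_length h] at hk
    obtain ⟨h1, h2, h3⟩ := h
    unfold Vp at h3
    split_ifs at hk hg <;> omega
  · intro hn
    by_cases hi : i = n
    · have := left_mem_wd h
      rwa [hi] at this ⊢
    have hk : n - 1 - i < (wd n i p).length := by
      rw [wd_length h, if_neg (by omega)]
      obtain ⟨h1, h2, h3⟩ := h
      unfold Vp at h3
      omega
    have hg := wd_getD h hk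
    rw [List.getD_eq_getElem _ _ hk, if_neg (by omega), if_pos rfl] at hg
    have h5 := List.getElem_mem hk
    rwa [hg] at h5

lemma wordD_perm {β β' : PosRootD n} (h : (wordD β).Perm (wordD β')) : β = β' := by
  have hβ := isTriple β
  have hβ' := isTriple β'
  rw [wordD_eq, wordD_eq] at h
  have h1 : riD β = riD β' := le_antisymm (mem_wd hβ (h.mem_iff.2 (left_mem_wd hβ'))).1
    (mem_wd hβ' (h.mem_iff.1 (left_mem_wd hβ))).1
  have h2 := h.length_eq
  have h3 : n ≤ riD β + rtD β ↔ n ≤ riD β' + rtD β' := by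
    rw [← right_mem_wd hβ, ← right_mem_wd hβ', h.mem_iff]
  rw [wd_length hβ, wd_length hβ'] at h2
  have h4 : rtD β = rtD β' := by
    split_ifs at h2 <;> omega
  apply Subtype.ext
  apply ofLex.injective
  exact Prod.ext (Fin.ext h1) (Fin.ext h4)

end Shuffle

/-! ### Separation of labelled monomial permanents -/

namespace Shuffle

section Per
variable {P ι : Type} [DecidableEq P]

lemma per_scale {R : Type} [CommSemiring R] (k : ι → R) (f : ι → P → R) (l : List ι) (S : Finset P) :
    per (l.map fun x p => k x * f x p) S = (l.map k).prod * per (l.map f) S := by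
  induction l generalizing S with
  | nil => simp
  | cons x l ih =>
    simp only [List.map_cons, per, ih, List.prod_cons, Finset.mul_sum]
    exact Finset.sum_congr rfl fun p _ => by ring

lemma map_per {R R' : Type} [CommSemiring R] [CommSemiring R'] (φ : R →+* R') (f : ι → P → R)
    (l : List ι) (S : Finset P) :
    φ (per (l.map f) S) = per (l.map fun x p => φ (f x p)) S := by
  induction l generalizing S with
  | nil => simp only [List.map_nil, per]; split_ifs <;> simp
  | cons x l ih => simp only [List.map_cons, per, map_sum, map_mul, ih]

end Per

section Labels
variable {P B : Type} [DecidableEq P] [DecidableEq B] (b : P → B)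

/-- the labelled Laurent monomial in the variable `p`. -/
def lmono (x : B × ℤ) (p : P) : AddMonoidAlgebra ℚ (P → ℤ) :=
  if b p = x.1 then AddMonoidAlgebra.single (Pi.single p x.2) 1 else 0

lemma coeff_per_cons (x : B × ℤ) (l : List (B × ℤ)) (S : Finset P) (d : P → ℤ) :
    (per ((x :: l).map (lmono b)) S).coeff d = ∑ p ∈ S,
      if b p = x.1 then (per (l.map (lmono b)) (S.erase p)).coeff (d - Pi.single p x.2) else 0 := by
  rw [List.map_cons, per, AddMonoidAlgebra.coeff_sum, Finsupp.finsetSum_apply]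
  refine Finset.sum_congr rfl fun p _ => ?_
  rw [lmono]
  split_ifs
  · rw [AddMonoidAlgebra.coeff_single_mul_apply, one_mul, neg_add_eq_sub]
  · rw [zero_mul]; rfl

lemma coeff_per_nonneg (l : List (B × ℤ)) (S : Finset P) (d : P → ℤ) :
    0 ≤ (per (l.map (lmono b)) S).coeff d := by
  induction l generalizing S d with
  | nil =>
    rw [List.map_nil, per]
    split_ifs
    · classical
      rw [AddMonoidAlgebra.one_def, AddMonoidAlgebra.coeff_single, Finsupp.single_apply]
      split_ifs <;> norm_num
    · exact le_rfl
  | cons x l ih =>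
    rw [coeff_per_cons]
    refine Finset.sum_nonneg fun p _ => ?_
    split_ifs
    · exact ih _ _
    · exact le_rfl

lemma support_of_coeff_per_ne_zero (l : List (B × ℤ)) (S : Finset P) (d : P → ℤ)
    (h : (per (l.map (lmono b)) S).coeff d ≠ 0) {q : P} (hq : q ∉ S) : d q = 0 := by
  induction l generalizing S d with
  | nil =>
    rw [List.map_nil, per] at h
    split_ifs at h with h1
    · classical
      rw [AddMonoidAlgebra.one_def, AddMonoidAlgebra.coeff_single, Finsupp.single_apply] at h
      split_ifs at h with h2
      · rw [← h2]; rfl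
      · exact absurd rfl h
    · exact absurd rfl h
  | cons x l ih =>
    rw [coeff_per_cons] at h
    obtain ⟨p, hp, h1⟩ := Finset.exists_ne_zero_of_sum_ne_zero h
    split_ifs at h1 with h2
    · have h3 := ih _ _ h1 (fun h => hq (Finset.mem_erase.1 h).2)
      have : q ≠ p := by rintro rfl; exact hq hp
      simpa [this] using h3
    · exact absurd rfl h1

lemma content_of_coeff_per_ne_zero (l : List (B × ℤ)) (S : Finset P) (d : P → ℤ)
    (h : (per (l.map (lmono b)) S).coeff d ≠ 0) :
    S.val.map (fun p => (b p, d p)) = (l : Multiset (B × ℤ)) := by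
  induction l generalizing S d with
  | nil =>
    rw [List.map_nil, per] at h
    split_ifs at h with h1
    · subst h1; rfl
    · exact absurd rfl h
  | cons x l ih =>
    rw [coeff_per_cons] at h
    obtain ⟨p, hp, h1⟩ := Finset.exists_ne_zero_of_sum_ne_zero h
    split_ifs at h1 with h2
    · have h3 := ih _ _ h1
      have h4 : d p = x.2 := by
        have := support_of_coeff_per_ne_zero b _ _ _ h1 (Finset.notMem_erase p S)
        simpa [sub_eq_zero] using this
      rw [← Finset.insert_erase hp, Finset.insert_val_of_notMem (Finset.notMem_erase _ _),
        Multiset.map_cons, ← Multiset.cons_coe, ← h3, h2, h4]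
      congr 1
      refine Multiset.map_congr rfl fun q hq => ?_
      have : q ≠ p := (Finset.mem_erase.1 hq).1
      simp [this]
    · exact absurd rfl h1

lemma coeff_per_pos (ps : List P) (hps : ps.Nodup) (s : P → ℤ) :
    0 < (per ((ps.map fun p => (b p, s p)).map (lmono b)) ps.toFinset).coeff
      (fun q => if q ∈ ps then s q else 0) := by
  induction ps with
  | nil =>
    classical
    rw [List.map_nil, List.map_nil, per, List.toFinset_nil, if_pos rfl, AddMonoidAlgebra.one_def,
      AddMonoidAlgebra.coeff_single, Finsupp.single_apply, if_pos]
    · norm_num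
    · ext; simp
  | cons p ps ih =>
    rw [List.nodup_cons] at hps
    rw [List.map_cons, coeff_per_cons]
    refine Finset.sum_pos' (fun q _ => ?_) ⟨p, by simp, ?_⟩
    · split_ifs
      · exact coeff_per_nonneg _ _ _ _
      · exact le_rfl
    · rw [if_pos rfl]
      have h1 : (p :: ps).toFinset.erase p = ps.toFinset := by
        rw [List.toFinset_cons, Finset.erase_insert (by simpa using hps.1)]
      have h2 : ((fun q => if q ∈ p :: ps then s q else 0) - Pi.single p (s p) : P → ℤ) =
          fun q => if q ∈ ps then s q else 0 := by
        ext q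
        by_cases hq : q = p
        · subst hq
          simp [hps.1]
        · simp [hq]
      rw [h1, h2]
      exact ih hps.2

variable [Fintype P]

/-- evaluation of Laurent polynomials at a tuple of nonzero rationals. -/
def lev (w : P → ℚ) (hw : ∀ p, w p ≠ 0) : AddMonoidAlgebra ℚ (P → ℤ) →ₐ[ℚ] ℚ :=
  AddMonoidAlgebra.lift ℚ ℚ (P → ℤ)
    { toFun := fun d => ∏ p, w p ^ (Multiplicative.toAdd d p)
      map_one' := by simp
      map_mul' := fun d d' => by
        rw [← Finset.prod_mul_distrib]
        exact Finset.prod_congr rfl fun p _ => zpow_add₀ (hw p) _ _ }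

lemma lev_single (w : P → ℚ) (hw : ∀ p, w p ≠ 0) (d : P → ℤ) (c : ℚ) :
    lev w hw (AddMonoidAlgebra.single d c) = c * ∏ p, w p ^ d p := by
  rw [lev, AddMonoidAlgebra.lift_single]; rfl

lemma lev_apply (w : P → ℚ) (hw : ∀ p, w p ≠ 0) (f : AddMonoidAlgebra ℚ (P → ℤ)) :
    lev w hw f = f.coeff.sum fun d c => c * ∏ p, w p ^ d p := by
  rw [lev, AddMonoidAlgebra.lift_apply]; rfl

lemma lev_lmono (w : P → ℚ) (hw : ∀ p, w p ≠ 0) (x : B × ℤ) (p : P) :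
    lev w hw (lmono b x p) = if b p = x.1 then w p ^ x.2 else 0 := by
  rw [lmono]
  split_ifs
  · rw [lev_single, one_mul, Finset.prod_eq_single p]
    · simp
    · intro q _ hq; simp [hq]
    · simp
  · rw [map_zero]

end Labels

lemma padicValRat_prod_zpow {P : Type} (S : Finset P) (q : ℕ) [Fact q.Prime] (w : P → ℚ)
    (hw : ∀ p, w p ≠ 0) (d : P → ℤ) :
    padicValRat q (∏ p ∈ S, w p ^ d p) = ∑ p ∈ S, d p * padicValRat q (w p) := by
  classical
  induction S using Finset.induction_on with
  | empty => simp
  | insert p S hp ih =>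
    rw [Finset.prod_insert hp, Finset.sum_insert hp, padicValRat.mul (zpow_ne_zero _ (hw p))
      (Finset.prod_ne_zero_iff.2 fun _ _ => zpow_ne_zero _ (hw _)), padicValRat.zpow, ih]

lemma prod_nth_prime_zpow_injective (m : ℕ) : Function.Injective fun d : Fin m → ℤ =>
    ∏ p : Fin m, ((Nat.nth Nat.Prime p : ℕ) : ℚ) ^ d p := by
  intro d d' h
  ext p
  have hw : ∀ q : Fin m, ((Nat.nth Nat.Prime q : ℕ) : ℚ) ≠ 0 := fun q =>
    Nat.cast_ne_zero.2 (Nat.prime_nth_prime q).ne_zero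
  have key : ∀ d : Fin m → ℤ, padicValRat (Nat.nth Nat.Prime p)
      (∏ p : Fin m, ((Nat.nth Nat.Prime p : ℕ) : ℚ) ^ d p) = d p := by
    intro d
    have : Fact (Nat.nth Nat.Prime p).Prime := ⟨Nat.prime_nth_prime p⟩
    rw [padicValRat_prod_zpow _ _ _ hw, Finset.sum_eq_single p]
    · rw [padicValRat.self (Nat.prime_nth_prime p).one_lt, mul_one]
    · intro q _ hq
      have : Fact (Nat.nth Nat.Prime q).Prime := ⟨Nat.prime_nth_prime q⟩
      rw [padicValRat.of_nat, padicValNat_primes, Nat.cast_zero, mul_zero]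
      intro h
      exact hq (Fin.ext (Nat.nth_injective Nat.infinite_setOfPred_prime h).symm)
    · simp
  have := congrArg (padicValRat (Nat.nth Nat.Prime p)) h
  simp only at this
  rwa [key, key] at this

lemma eq_zero_of_lev {m : ℕ} (f : AddMonoidAlgebra ℚ (Fin m → ℤ))
    (h : ∀ (w : Fin m → ℚ) (hw : ∀ p, w p ≠ 0), Function.Injective w → lev w hw f = 0) : f = 0 := by
  set χ := fun d : Fin m → ℤ => ∏ p : Fin m, ((Nat.nth Nat.Prime p : ℕ) : ℚ) ^ d p with hχ
  have hχi : Function.Injective χ := prod_nth_prime_zpow_injective m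
  have hw0 : ∀ q : Fin m, ((Nat.nth Nat.Prime q : ℕ) : ℚ) ≠ 0 := fun q =>
    Nat.cast_ne_zero.2 (Nat.prime_nth_prime q).ne_zero
  have hχ0 : ∀ d, χ d ≠ 0 := fun d => Finset.prod_ne_zero_iff.2 fun q _ => zpow_ne_zero _ (hw0 q)
  have hsum : ∀ t : ℕ, ∑ d ∈ f.coeff.support, f.coeff d * χ d * χ d ^ t = 0 := by
    intro t
    have := h (fun q => ((Nat.nth Nat.Prime q : ℕ) : ℚ) ^ (t + 1))
      (fun q => pow_ne_zero _ (hw0 q)) (by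
        intro q q' hqq
        have := (pow_left_inj₀ (Nat.cast_nonneg _) (Nat.cast_nonneg _) (Nat.succ_ne_zero t)).1 hqq
        exact Fin.ext (Nat.nth_injective Nat.infinite_setOfPred_prime (Nat.cast_injective this)))
    rw [lev_apply, Finsupp.sum] at this
    rw [← this]
    refine Finset.sum_congr rfl fun d _ => ?_
    rw [mul_assoc, ← pow_succ', hχ]
    congr 1
    rw [← Finset.prod_pow]
    refine Finset.prod_congr rfl fun q _ => ?_
    rw [← zpow_natCast, ← zpow_natCast, ← zpow_mul, ← zpow_mul, mul_comm]
  have hli := linearIndependent_monoidHom (Multiplicative ℕ) ℚ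
  have hinj : Function.Injective fun d : Fin m → ℤ => powersHom ℚ (χ d) :=
    (powersHom ℚ).injective.comp hχi
  have hli' := hli.comp _ hinj
  rw [linearIndependent_iff'] at hli'
  have h0 := hli' f.coeff.support (fun d => f.coeff d * χ d) (by
    ext t
    rw [Finset.sum_apply]
    exact hsum (Multiplicative.toAdd t))
  apply AddMonoidAlgebra.coeff_injective
  ext d
  by_contra hd
  have := h0 d (Finsupp.mem_support_iff.2 hd)
  exact hd ((mul_eq_zero.1 this).resolve_right (hχ0 d))

end Shuffle

/-! ### Linear independence of the ordered monomials -/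

namespace Shuffle
variable {n : ℕ}

/-- the factors of the ordered monomial of `h`, in increasing order. -/
def factors (h : Lex (PosRootD n × ℤ) →₀ ℕ) : List (PosRootD n × ℤ) :=
  ((Finsupp.toMultiset h).sort (· ≤ ·)).map ofLex

lemma factors_eq_of_perm {h h' : Lex (PosRootD n × ℤ) →₀ ℕ} (e : (factors h).Perm (factors h')) :
    h = h' := by
  apply Multiset.toFinsupp.symm.injective
  show Finsupp.toMultiset h = Finsupp.toMultiset h'
  have := (List.map_perm_map_iff ofLex.injective).1 e
  rwa [← Multiset.coe_eq_coe, Multiset.sort_eq, Multiset.sort_eq] at this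

lemma rttMon_eq (ε : Bool) (T : PosRootD n × ℤ → (ℕ → ℤ)) (h : Lex (PosRootD n × ℤ) →₀ ℕ) :
    rttMon ε T h = ((factors h).map fun x => rttED ε x.1 (T x)).prod := by
  rw [rttMon, ordMon_eq, factors, List.map_map]
  rfl

lemma shuffleRep_rttED {V : Type} [DecidableEq V] [Fintype V] (m : Model vv n V) (ε : Bool)
    (β : PosRootD n) (t : ℕ → ℤ) :
    shuffleRep m (rttED ε β t) = m.ch (vpow (sgn ε)) t (wordD β) := by
  rw [rttED_eq, Model.shuffleRep_chl, wordD_eq]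
  intro j hj
  have h := mem_wd (isTriple β) hj
  exact ⟨(isTriple β).1.trans h.1, h.2⟩

lemma shuffleRep_rttMon {V : Type} [DecidableEq V] [Fintype V] (m : Model vv n V) (ε : Bool)
    (T : PosRootD n × ℤ → (ℕ → ℤ)) (h : Lex (PosRootD n × ℤ) →₀ ℕ) :
    shuffleRep m (rttMon ε T h) =
      ((factors h).map fun x => m.ch (vpow (sgn ε)) (T x) (wordD x.1)).prod := by
  rw [rttMon_eq, map_list_prod, List.map_map]
  congr 2
  funext x
  exact shuffleRep_rttED m ε x.1 (T x)

lemma wordD_ne_nil (β : PosRootD n) : wordD β ≠ [] := by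
  rw [wordD_eq]
  exact wd_ne_nil (isTriple β).2.1 (isTriple β).2.2

lemma goodWord_wordD (β : PosRootD n) : GoodWord n (wordD β) := by
  rw [wordD_eq]
  exact goodWord_wd (isTriple β)

lemma res_vpow_sgn (ε : Bool) : Res (vpow (sgn ε)) 1 := by
  rcases vpow_sgn ε with h | h <;> rw [h]
  · exact Res.var
  · simpa using Res.var.inv one_ne_zero

/-- the configuration of clusters with root labels `b` and base points `w`. -/
def cluOf {m : ℕ} (b : Fin m → PosRootD n) (w : Fin m → ℚ) (hw : ∀ p, w p ≠ 0)
    (hi : Function.Injective w) :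
    Clu (Σ p, Fin (wordD (b p)).length) (Fin m) (fun p => wordD (b p)) where
  cl a := a.1
  pos a := a.2
  inj := by
    rintro ⟨p, k⟩ ⟨q, l⟩ h h'
    obtain rfl : p = q := h
    obtain rfl : k = l := Fin.ext h'
    rfl
  lt a := a.2.2
  ex p k hk := ⟨⟨p, k, hk⟩, rfl, rfl⟩
  w := w
  w_ne := hw
  w_inj p q h := hi h

/-- the leading coefficient of the root vector of `β`. -/
def rootCoeff (β : PosRootD n) : ℚ := lco n (wordD β) ((wordD β).length - 1)

lemma rootCoeff_ne_zero (β : PosRootD n) : rootCoeff β ≠ 0 :=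
  lco_ne_zero (goodWord_wordD β)
    (Nat.sub_lt (List.length_pos_of_ne_nil (wordD_ne_nil β)) one_pos)

section Residue
variable {m : ℕ} (b : Fin m → PosRootD n) (w : Fin m → ℚ) (hw : ∀ p, w p ≠ 0)
  (hi : Function.Injective w) (ε : Bool) (T : PosRootD n × ℤ → (ℕ → ℤ))

lemma good_rttMon (h : Lex (PosRootD n × ℤ) →₀ ℕ) : (cluOf b w hw hi).Good n
    (shuffleRep ((cluOf b w hw hi).mod n) (rttMon ε T h)) := by
  rw [shuffleRep_rttMon]
  apply Clu.good_prod
  intro f hf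
  obtain ⟨x, _, rfl⟩ := List.mem_map.1 hf
  exact Clu.good_ch _ n (res_vpow_sgn ε) _ _

lemma ρ_rttMon (hT : ∀ p, sOfD p.1 (T p) = p.2) (h : Lex (PosRootD n × ℤ) →₀ ℕ)
    (hm : m ≤ (factors h).length) :
    (cluOf b w hw hi).ρ (shuffleRep ((cluOf b w hw hi).mod n) (rttMon ε T h)) Finset.univ =
      ((factors h).map fun x => rootCoeff x.1).prod *
        lev w hw (per ((factors h).map (lmono b)) Finset.univ) := by
  rw [shuffleRep_rttMon, Clu.ρ_prod (n := n)]
  · rw [List.map_map]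
    have e := map_per (lev w hw).toRingHom (lmono b) (factors h) Finset.univ
    refine Eq.trans ?_ (congrArg _ e.symm)
    rw [← per_scale]
    congr 2
    funext x p
    show _ = rootCoeff x.1 * lev w hw (lmono b x p)
    rw [lev_lmono]
    simp only [Function.comp]
    split_ifs with hb
    · rw [← hb]
      refine ((cluOf b w hw hi).ρ_ch_self n (res_vpow_sgn ε) (T x) (p := p)
        (goodWord_wordD (b p)) (wordD_ne_nil (b p))).trans ?_
      have hs : ((wordD (b p)).map (T x)).sum = x.2 := by
        rw [hb]
        exact hT x
      rw [hs]
      rfl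
    · rw [mul_zero]
      exact Clu.ρ_ch_of_not_perm _ n _ _ fun hp => hb (wordD_perm hp).symm
  · exact fun p => wordD_ne_nil _
  · intro f hf
    obtain ⟨x, _, rfl⟩ := List.mem_map.1 hf
    exact Clu.good_ch _ n (res_vpow_sgn ε) _ _
  · intro f hf
    obtain ⟨x, _, rfl⟩ := List.mem_map.1 hf
    exact Clu.Φ_ch_empty _ n _ _ _
  · simpa using hm

lemma sum_residue_eq_zero (hi : Function.Injective w) (hT : ∀ p, sOfD p.1 (T p) = p.2)
    (c : (Lex (PosRootD n × ℤ) →₀ ℕ) →₀ KK) (hc : (c.sum fun h a => a • rttMon ε T h) = 0)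
    (d : KK) (a : (Lex (PosRootD n × ℤ) →₀ ℕ) → ℚ) (ha : ∀ h, Res (c h * d) (a h))
    (hmin : ∀ h, a h ≠ 0 → m ≤ (factors h).length) :
    lev w hw (∑ h ∈ c.support, (a h * ((factors h).map fun x => rootCoeff x.1).prod) •
      per ((factors h).map (lmono b)) Finset.univ) = 0 := by
  set C := cluOf b w hw hi with hC
  have h1 : ∑ h ∈ c.support, c h * Φ (shuffleRep (C.mod n) (rttMon ε T h))
      (C.full Finset.univ) = 0 := by
    have := congrArg (fun x => Φ (shuffleRep (C.mod n) x) (C.full Finset.univ)) hc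
    simp only [Finsupp.sum, map_sum, map_smul, map_zero] at this
    simpa only [Φ, LinearMap.sum_apply, Finset.sum_apply, LinearMap.smul_apply, Pi.smul_apply,
      smul_eq_mul, LinearMap.zero_apply, Pi.zero_apply] using this
  have h2 : ∀ h ∈ c.support, Res (c h * d * (Φ (shuffleRep (C.mod n) (rttMon ε T h))
      (C.full Finset.univ) / ϖ ^ (Finset.univ : Finset (Fin m)).card))
      (a h * C.ρ (shuffleRep (C.mod n) (rttMon ε T h)) Finset.univ) := fun h _ =>
    (ha h).mul ((good_rttMon b w hw hi ε T h).res (fun p => wordD_ne_nil _) _)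
  have h3 := Res.sum _ h2
  have h4 : ∑ h ∈ c.support, c h * d * (Φ (shuffleRep (C.mod n) (rttMon ε T h))
      (C.full Finset.univ) / ϖ ^ (Finset.univ : Finset (Fin m)).card) = 0 := by
    rw [← zero_mul (d / ϖ ^ (Finset.univ : Finset (Fin m)).card), ← h1, Finset.sum_mul]
    exact Finset.sum_congr rfl fun h _ => by ring
  rw [h4] at h3
  rw [map_sum, ← h3.unique Res.zero]
  refine Finset.sum_congr rfl fun h _ => ?_
  rw [map_smul, smul_eq_mul, mul_assoc]
  by_cases h0 : a h = 0
  · rw [h0, zero_mul, zero_mul]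
  · rw [ρ_rttMon b w hw hi ε T hT h (hmin h h0)]

end Residue

theorem rttMon_linearIndependent (ε : Bool) (T : PosRootD n × ℤ → (ℕ → ℤ))
    (hT : ∀ p, sOfD p.1 (T p) = p.2) (c : (Lex (PosRootD n × ℤ) →₀ ℕ) →₀ KK)
    (hc : (c.sum fun h a => a • rttMon ε T h) = 0) : c = 0 := by
  by_contra hne
  obtain ⟨d, a, ha, h1, ha1⟩ := exists_scale c hne
  obtain ⟨h0, hmem, hmin⟩ := WellFounded.has_min
    (measure fun h : Lex (PosRootD n × ℤ) →₀ ℕ => (factors h).length).wf {h | a h ≠ 0} ⟨h1, ha1⟩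
  have hsupp : h0 ∈ c.support := by
    rw [Finsupp.mem_support_iff]
    intro h
    have := ha h0
    rw [h, zero_mul] at this
    exact hmem (this.unique Res.zero)
  set m := (factors h0).length with hm
  set b : Fin m → PosRootD n := fun p => ((factors h0).get p).1
  set s : Fin m → ℤ := fun p => ((factors h0).get p).2
  have hl : (List.finRange m).map (fun p => (b p, s p)) = factors h0 := by
    exact List.map_get_finRange (factors h0)
  have hz := eq_zero_of_lev _ fun w hw hi => sum_residue_eq_zero b w hw ε T hi hT c hc d a ha
    fun h hh => not_lt.1 (hmin h hh)
  have hco := congrArg (fun f => f.coeff s) hz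
  simp only [AddMonoidAlgebra.coeff_sum, Finsupp.finsetSum_apply,
    AddMonoidAlgebra.coeff_smul_apply] at hco
  rw [Finset.sum_eq_single_of_mem h0 hsupp] at hco
  · have hp := coeff_per_pos b (List.finRange m) (List.nodup_finRange m) s
    rw [hl, List.toFinset_finRange] at hp
    simp only [List.mem_finRange, if_true] at hp
    have hk : ((factors h0).map fun x => rootCoeff x.1).prod ≠ 0 := by
      apply List.prod_ne_zero
      intro h
      obtain ⟨x, _, hx⟩ := List.mem_map.1 h
      exact rootCoeff_ne_zero _ hx
    exact mul_ne_zero (mul_ne_zero hmem hk) hp.ne' hco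
  · intro h _ hh
    by_contra hcon
    have hcon' := right_ne_zero_of_mul hcon
    have := content_of_coeff_per_ne_zero b _ _ _ hcon'
    apply hh
    apply factors_eq_of_perm
    rw [← Multiset.coe_eq_coe, ← this, ← hl]
    rfl

end Shuffle

end

/-- **The RTT integral form of `U_v^>(Lo_{2n})` (type `D_n`)**:
(a) `𝓤_v^>(Lo_{2n})` is independent of the sign `ε` and of the choices of decompositions
used in defining the elements `Ẽ^ε_{β,s}`;
(b) for any fixed such choices, the ordered monomials `𝓔̃^ε_h` form a `ℤ[v,v⁻¹]`-basis of
`𝓤_v^>(Lo_{2n})`. -/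
theorem rtt_form_typeD (n : ℕ) (hn : 4 ≤ n) :
    (∀ (ε ε' : Bool) (T T' : PosRootD n × ℤ → (ℕ → ℤ)),
      (∀ p, sOfD p.1 (T p) = p.2) → (∀ p, sOfD p.1 (T' p) = p.2) →
      RttFormD ε T = RttFormD ε' T') ∧
    (∀ (ε : Bool) (T : PosRootD n × ℤ → (ℕ → ℤ)), (∀ p, sOfD p.1 (T p) = p.2) →
      (∀ c : (Lex (PosRootD n × ℤ) →₀ ℕ) →₀ KK, (∀ h, c h ∈ Rint) →
        (c.sum fun h a => a • ordMon (fun p => rttED ε (ofLex p).1 (T (ofLex p))) h) = 0 →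
          c = 0) ∧
      (∀ x : UD n, x ∈ RttFormD ε T ↔
        ∃ c : (Lex (PosRootD n × ℤ) →₀ ℕ) →₀ KK, (∀ h, c h ∈ Rint) ∧
          x = c.sum fun h a => a • ordMon (fun p => rttED ε (ofLex p).1 (T (ofLex p))) h)) :=
  ⟨fun ε ε' T T' hT hT' => RttFormD_indep ε ε' T T' hT hT',
    fun ε T hT => ⟨fun c _ hc => Shuffle.rttMon_linearIndependent ε T hT c hc,
      RttFormD_spanned ε T hT⟩⟩
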